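/- arXiv:1312.7540 — 2 statements merged into one kernel-verified Lean document; each statement's English description precedes it below -/
import Mathlib

section
/- Let W be a finite Coxeter group and let w = uv be the left parabolic decomposition of w with respect to J ⊆ S (u ∈ W_J, v ∈ ^J W). The following are equivalent: (a) the multiplication map [e,u] × ([e,v] ∩ ^J W) → [e,w] is surjective (hence bijective); (b) u is the unique maximal element of [e,w] ∩ W_J; (c) S(v) ∩ J ⊆ D_R(u), the right descent set of u; (d) P_w(q) = P_u(q)·^J P_v(q), i.e. w = uv is a left BP decomposition. -/
noncomputable section
namespace Paper
open Polynomial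

variable {B W : Type*} [Group W] {M : CoxeterMatrix B} (cs : CoxeterSystem M W)

/-- The crystallographic condition: together with finiteness, this characterizes
the Coxeter systems of finite Weyl groups. -/
def IsWeylMatrix (M : CoxeterMatrix B) : Prop :=
  ∀ i j : B, i ≠ j → M i j ∈ ({2, 3, 4, 6} : Set ℕ)

/-- Bruhat order on `W`. -/
def bruhatLE (u w : W) : Prop :=
  Relation.ReflTransGen
    (fun x y => cs.length x < cs.length y ∧ ∃ t, cs.IsReflection t ∧ y = t * x) u w

/-- The Poincaré polynomial of `w`: the length generating function of the Bruhat
interval `[e,w]`. -/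
def poin (w : W) : Polynomial ℤ :=
  ∑ᶠ x ∈ {x : W | bruhatLE cs x w}, X ^ cs.length x

/-- `w` is rationally smooth iff its Poincaré polynomial is palindromic. -/
def RatSmooth (w : W) : Prop :=
  ∀ i ≤ cs.length w, (poin cs w).coeff i = (poin cs w).coeff (cs.length w - i)

/-- The `q`-integer `[m]_q = 1 + q + ⋯ + q^(m-1)`. -/
def qint (m : ℕ) : Polynomial ℤ := ∑ j ∈ Finset.range m, X ^ j

/-- The support of `w`: the simple reflections appearing in some reduced word for `w`. -/
def supp (w : W) : Set B :=
  {i | ∃ ω : List B, cs.IsReduced ω ∧ cs.wordProd ω = w ∧ i ∈ ω}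

/-- `i` is a leaf of the Dynkin diagram of `W_{S(w)}`. -/
def IsLeaf (w : W) (i : B) : Prop :=
  i ∈ supp cs w ∧ {j | j ∈ supp cs w ∧ j ≠ i ∧ M i j ≠ 2}.Subsingleton

/-- The standard parabolic subgroup `W_J`. -/
def WJc (J : Set B) : Subgroup W := Subgroup.closure (cs.simple '' J)

/-- `v ∈ ᴶW`: `v` is a minimal length right coset representative. -/
def MinRight (J : Set B) (v : W) : Prop :=
  ∀ i ∈ J, cs.length v < cs.length (cs.simple i * v)

/-- `v ∈ Wᴶ`: `v` is a minimal length left coset representative. -/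
def MinLeft (J : Set B) (v : W) : Prop :=
  ∀ i ∈ J, cs.length v < cs.length (v * cs.simple i)

/-- The Poincaré polynomial `ᴶP_v`, summing over `[e,v] ∩ ᴶW`. -/
def poinRight (J : Set B) (v : W) : Polynomial ℤ :=
  ∑ᶠ x ∈ {x : W | bruhatLE cs x v ∧ MinRight cs J x}, X ^ cs.length x

/-- The Poincaré polynomial `P_v^J`, summing over `[e,v] ∩ Wᴶ`. -/
def poinLeft (J : Set B) (v : W) : Polynomial ℤ :=
  ∑ᶠ x ∈ {x : W | bruhatLE cs x v ∧ MinLeft cs J x}, X ^ cs.length x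

/-- `[e,v] ∩ ᴶW` is a chain in Bruhat order. -/
def ChainRight (J : Set B) (v : W) : Prop :=
  ∀ x y : W, (bruhatLE cs x v ∧ MinRight cs J x) → (bruhatLE cs y v ∧ MinRight cs J y) →
    bruhatLE cs x y ∨ bruhatLE cs y x

/-- `[e,v] ∩ Wᴶ` is a chain in Bruhat order. -/
def ChainLeft (J : Set B) (v : W) : Prop :=
  ∀ x y : W, (bruhatLE cs x v ∧ MinLeft cs J x) → (bruhatLE cs y v ∧ MinLeft cs J y) →
    bruhatLE cs x y ∨ bruhatLE cs y x

/-- `w = u * v` is a left Billey–Postnikov decomposition with respect to `J`. -/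
def LeftBP (J : Set B) (u v w : W) : Prop :=
  w = u * v ∧ u ∈ WJc cs J ∧ MinRight cs J v ∧
    poin cs w = poin cs u * poinRight cs J v

/-- `w = v * u` is a right Billey–Postnikov decomposition with respect to `J`. -/
def RightBP (J : Set B) (u v w : W) : Prop :=
  w = v * u ∧ u ∈ WJc cs J ∧ MinLeft cs J v ∧
    poin cs w = poin cs u * poinLeft cs J v

/-- A (nontrivial) left chain BP decomposition. -/
def LeftChainBP (J : Set B) (u v w : W) : Prop :=
  LeftBP cs J u v w ∧ v ≠ 1 ∧ ChainRight cs J v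

/-- A (nontrivial) right chain BP decomposition. -/
def RightChainBP (J : Set B) (u v w : W) : Prop :=
  RightBP cs J u v w ∧ v ≠ 1 ∧ ChainLeft cs J v

/-- `x` is the longest (maximal) element of the set `K`. -/
def IsLongestIn (K : Set W) (x : W) : Prop :=
  x ∈ K ∧ ∀ y ∈ K, cs.length y ≤ cs.length x

/-- Directed distance in the Bruhat graph. -/
def bgDist (u w : W) : ℕ :=
  sInf {m | ∃ c : ℕ → W, c 0 = u ∧ c m = w ∧
    ∀ i < m, cs.length (c i) < cs.length (c (i + 1)) ∧
      ∃ t, cs.IsReflection t ∧ c (i + 1) = t * c i}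

/-- Absolute (reflection) length. -/
def absLen (x : W) : ℕ :=
  sInf {m | ∃ g : Fin m → W, (∀ i, cs.IsReflection (g i)) ∧ x = (List.ofFn g).prod}

/-- The HLSS condition. -/
def HLSS (w : W) : Prop :=
  ∀ u, bruhatLE cs u w → bgDist cs u w = absLen cs (u * w⁻¹)

/-- The Coxeter matrix of type `Dₙ` (chain `1 - 2 - ⋯ - (n-1)` with extra node `0`
attached to node `2`). -/
def Dmat (i j : ℕ) : ℕ :=
  if i = j then 1
  else if (i = 0 ∧ j = 2) ∨ (j = 0 ∧ i = 2) ∨ (1 ≤ i ∧ 1 ≤ j ∧ (i + 1 = j ∨ j + 1 = i))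
    then 3 else 2

/-- The Coxeter matrix of type `Eₙ` in the labelling of the paper (shifted by one:
index `i` is the paper's node `i+1`): chain `1 - 2 - ⋯ - (n-1)` with node `0` attached
to node `3`. -/
def Emat (i j : ℕ) : ℕ :=
  if i = j then 1
  else if (i = 0 ∧ j = 3) ∨ (j = 0 ∧ i = 3) ∨ (1 ≤ i ∧ 1 ≤ j ∧ (i + 1 = j ∨ j + 1 = i))
    then 3 else 2

/-- The Coxeter matrix of type `F₄`. -/
def Fmat (i j : ℕ) : ℕ :=
  if i = j then 1
  else if (i = 0 ∧ j = 1) ∨ (i = 1 ∧ j = 0) ∨ (i = 2 ∧ j = 3) ∨ (i = 3 ∧ j = 2) then 3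
  else if (i = 1 ∧ j = 2) ∨ (i = 2 ∧ j = 1) then 4
  else 2

section StrongExchange

open scoped Classical in
/-- The action of a simple reflection on signed reflections, extended to all of `W × ZMod 2`. -/
def signedConj (i : B) : Equiv.Perm (W × ZMod 2) :=
  Function.Involutive.toPerm
    (fun p => (cs.simple i * p.1 * cs.simple i, p.2 + if p.1 = cs.simple i then 1 else 0)) <| by
    rintro ⟨t, e⟩
    have h : cs.simple i * t * cs.simple i = cs.simple i ↔ t = cs.simple i := by
      constructor
      · intro h
        have := congrArg (fun x => cs.simple i * x * cs.simple i) h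
        simpa [mul_assoc] using this
      · rintro rfl; simp
    ext
    · simp [mul_assoc]
    · simp only [h, add_assoc, CharTwo.add_self_eq_zero, add_zero]

open scoped Classical in
theorem signedConj_apply (i : B) (t : W) (e : ZMod 2) :
    signedConj cs i (t, e) =
      (cs.simple i * t * cs.simple i, e + if t = cs.simple i then 1 else 0) := rfl

theorem rotation_pow_conj (i j : B) (k : ℕ) :
    cs.simple j * (cs.simple i * cs.simple j) ^ k =
      ((cs.simple i * cs.simple j) ^ k)⁻¹ * cs.simple j := by
  induction k with
  | zero => simp
  | succ k ih =>
    rw [pow_succ, ← mul_assoc, ih, ← pow_succ, pow_succ' _ k, mul_inv_rev]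
    simp [mul_assoc]

theorem conj_rotation_pow_eq_iff (i j : B) (k : ℕ) (t x : W) :
    (cs.simple i * cs.simple j) ^ k * t * ((cs.simple i * cs.simple j) ^ k)⁻¹ =
      cs.simple j * x ↔
    t = cs.simple j * (cs.simple i * cs.simple j) ^ k * x * (cs.simple i * cs.simple j) ^ k := by
  rw [rotation_pow_conj, mul_inv_eq_iff_eq_mul, mul_assoc _ (cs.simple j) x,
    mul_assoc (_⁻¹) (cs.simple j * x), eq_inv_mul_iff_mul_eq]

open scoped Classical in
theorem signedConj_mul_pow_apply (i j : B) (n : ℕ) (t : W) (e : ZMod 2) :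
    ((signedConj cs i * signedConj cs j) ^ n) (t, e) =
      ((cs.simple i * cs.simple j) ^ n * t * ((cs.simple i * cs.simple j) ^ n)⁻¹,
        e + ∑ k ∈ Finset.range (2 * n),
          if t = cs.simple j * (cs.simple i * cs.simple j) ^ k then 1 else 0) := by
  induction n with
  | zero => simp
  | succ n ih =>
    rw [pow_succ', Equiv.Perm.mul_apply, ih, Equiv.Perm.mul_apply, signedConj_apply,
      signedConj_apply, mul_add_one, Finset.sum_range_succ, Finset.sum_range_succ]
    have h0 := conj_rotation_pow_eq_iff cs i j n t 1
    have h1 := conj_rotation_pow_eq_iff cs i j n t (cs.simple i * cs.simple j)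
    have e0 : cs.simple j * (cs.simple i * cs.simple j) ^ n * 1 * (cs.simple i * cs.simple j) ^ n
        = cs.simple j * (cs.simple i * cs.simple j) ^ (2 * n) := by
      rw [two_mul, pow_add]; simp [mul_assoc]
    have e1 : cs.simple j * (cs.simple i * cs.simple j) ^ n * (cs.simple i * cs.simple j) *
        (cs.simple i * cs.simple j) ^ n
        = cs.simple j * (cs.simple i * cs.simple j) ^ (2 * n + 1) := by
      rw [two_mul, add_assoc, add_comm n 1, pow_add, pow_add, pow_one]; simp only [mul_assoc]
    have h2 : cs.simple j * ((cs.simple i * cs.simple j) ^ n * t *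
        ((cs.simple i * cs.simple j) ^ n)⁻¹) * cs.simple j = cs.simple i ↔
        (cs.simple i * cs.simple j) ^ n * t * ((cs.simple i * cs.simple j) ^ n)⁻¹ =
        cs.simple j * (cs.simple i * cs.simple j) := by
      generalize (cs.simple i * cs.simple j) ^ n * t * ((cs.simple i * cs.simple j) ^ n)⁻¹ = y
      constructor
      · intro h
        rw [← h]; simp [mul_assoc]
      · intro h
        rw [h]; simp [mul_assoc]
    rw [e0, mul_one] at h0
    rw [e1] at h1
    simp only [h0, h1, h2]
    ext
    · simp [pow_succ', mul_assoc]
    · simp only [add_assoc]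

theorem signedConj_isLiftable : M.IsLiftable (signedConj cs) := by
  classical
  intro i j
  ext1 ⟨t, e⟩
  rw [signedConj_mul_pow_apply, two_mul, Finset.sum_range_add]
  simp [pow_add, CharTwo.add_self_eq_zero]

/-- The action of `W` on signed reflections. -/
def signedAction : W →* Equiv.Perm (W × ZMod 2) :=
  cs.lift ⟨signedConj cs, signedConj_isLiftable cs⟩

theorem signedAction_simple (i : B) : signedAction cs (cs.simple i) = signedConj cs i :=
  cs.lift_apply_simple _ _

open scoped Classical in
theorem signedAction_wordProd (ω : List B) (t : W) (e : ZMod 2) :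
    signedAction cs (cs.wordProd ω) (t, e) =
      (cs.wordProd ω * t * (cs.wordProd ω)⁻¹, e + ((cs.rightInvSeq ω).count t : ZMod 2)) := by
  induction ω with
  | nil => simp
  | cons i ω ih =>
    rw [cs.wordProd_cons, map_mul, Equiv.Perm.mul_apply, ih, signedAction_simple,
      signedConj_apply, CoxeterSystem.rightInvSeq, List.count_cons]
    have h : cs.wordProd ω * t * (cs.wordProd ω)⁻¹ = cs.simple i ↔
        (cs.wordProd ω)⁻¹ * cs.simple i * cs.wordProd ω = t := by
      rw [mul_inv_eq_iff_eq_mul, mul_assoc, inv_mul_eq_iff_eq_mul, eq_comm]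
    ext
    · simp [mul_assoc]
    · simp only [h, beq_iff_eq, add_assoc]
      push_cast
      rfl

theorem signedAction_apply_add (w t : W) (e : ZMod 2) :
    signedAction cs w (t, e) = (w * t * w⁻¹, e + (signedAction cs w (t, 0)).2) := by
  obtain ⟨ω, rfl⟩ := cs.wordProd_surjective w
  simp [signedAction_wordProd]

theorem signedAction_reflection_self {t : W} (ht : cs.IsReflection t) (e : ZMod 2) :
    signedAction cs t (t, e) = (t, e + 1) := by
  obtain ⟨w, i, rfl⟩ := ht
  have h := signedAction_apply_add cs w⁻¹ (w * cs.simple i * w⁻¹) e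
  have e1 : w⁻¹ * (w * cs.simple i * w⁻¹) * w⁻¹⁻¹ = cs.simple i := by group
  rw [e1] at h
  set n := (signedAction cs w⁻¹ (w * cs.simple i * w⁻¹, 0)).2
  have h' : signedAction cs w (cs.simple i, e + n) = (w * cs.simple i * w⁻¹, e) := by
    rw [← h, ← Equiv.Perm.mul_apply, ← map_mul]; simp
  rw [map_mul, map_mul, Equiv.Perm.mul_apply, Equiv.Perm.mul_apply, h, signedAction_simple,
    signedConj_apply]
  rw [cs.simple_mul_simple_self, one_mul]
  rw [signedAction_apply_add] at h' ⊢
  have h2 := congrArg Prod.snd h'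
  simp only at h2
  ext
  · simp
  · simp only [if_true]
    rw [add_right_comm, h2]

/-- Strong exchange property, for arbitrary words, right-handed version. -/
theorem mem_rightInvSeq_of_isRightInversion {ω : List B} {t : W}
    (h : cs.IsRightInversion (cs.wordProd ω) t) : t ∈ cs.rightInvSeq ω := by
  classical
  by_contra hmem
  obtain ⟨ht, hlt⟩ := h
  obtain ⟨ω', hω', he⟩ := cs.exists_isReduced (cs.wordProd ω * t)
  have h1 : signedAction cs (cs.wordProd ω * t) (t, 0) =
      (cs.wordProd ω * t * (cs.wordProd ω)⁻¹, 0 + 1 + ((0 : ℕ) : ZMod 2)) := by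
    rw [map_mul, Equiv.Perm.mul_apply, signedAction_reflection_self cs ht, signedAction_wordProd,
      List.count_eq_zero_of_not_mem hmem]
  rw [he, signedAction_wordProd] at h1
  have h2 := congrArg Prod.snd h1
  simp only [zero_add, Nat.cast_zero, add_zero] at h2
  have hmem' : t ∈ cs.rightInvSeq ω' := by
    by_contra hn
    rw [List.count_eq_zero_of_not_mem hn] at h2
    exact absurd h2 (by decide)
  have h3 := (cs.isRightInversion_of_mem_rightInvSeq hω' hmem').2
  rw [← he, mul_assoc, ht.mul_self, mul_one] at h3
  exact lt_asymm hlt h3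

/-- Strong exchange property, for arbitrary words. -/
theorem exists_eraseIdx_of_length_lt {ω : List B} {t : W} (ht : cs.IsReflection t)
    (h : cs.length (t * cs.wordProd ω) < cs.length (cs.wordProd ω)) :
    ∃ j < ω.length, t * cs.wordProd ω = cs.wordProd (ω.eraseIdx j) := by
  have h1 : cs.IsRightInversion (cs.wordProd ω.reverse) t := by
    rw [cs.wordProd_reverse, cs.isRightInversion_inv_iff]
    exact ⟨ht, h⟩
  have h2 := mem_rightInvSeq_of_isRightInversion cs h1
  rw [cs.rightInvSeq_reverse, List.mem_reverse] at h2
  obtain ⟨j, hj, rfl⟩ := List.mem_iff_getElem.mp h2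
  refine ⟨j, by simpa using hj, ?_⟩
  rw [← cs.getD_leftInvSeq_mul_wordProd, List.getD_eq_getElem _ 1 hj]

end StrongExchange

section Bruhat

variable {cs}

theorem bruhatLE.refl (w : W) : bruhatLE cs w w := Relation.ReflTransGen.refl

theorem bruhatLE.trans {x y z : W} (h : bruhatLE cs x y) (h' : bruhatLE cs y z) :
    bruhatLE cs x z := Relation.ReflTransGen.trans h h'

theorem bruhatLE.length_le {x y : W} (h : bruhatLE cs x y) : cs.length x ≤ cs.length y := by
  induction h with
  | refl => exact le_rfl
  | tail _ h ih => exact ih.trans h.1.le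

theorem bruhatLE_reflection_mul {t x : W} (ht : cs.IsReflection t)
    (h : cs.length x < cs.length (t * x)) : bruhatLE cs x (t * x) :=
  Relation.ReflTransGen.single ⟨h, t, ht, rfl⟩

theorem bruhatLE_simple_mul {x : W} {i : B} (h : cs.length (cs.simple i * x) < cs.length x) :
    bruhatLE cs (cs.simple i * x) x := by
  have := bruhatLE_reflection_mul (cs.isReflection_simple i) (x := cs.simple i * x) (by simpa)
  simpa using this

theorem bruhatLE.exists_sublist {x : W} {ω : List B} (h : bruhatLE cs x (cs.wordProd ω)) :
    ∃ σ, σ.Sublist ω ∧ cs.wordProd σ = x := by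
  induction h using Relation.ReflTransGen.head_induction_on with
  | refl => exact ⟨ω, List.Sublist.refl _, rfl⟩
  | @head x _ h _ ih =>
    obtain ⟨hlt, t, ht, rfl⟩ := h
    obtain ⟨σ, hσ, he⟩ := ih
    have e : t * cs.wordProd σ = x := by rw [he, ← mul_assoc, ht.mul_self, one_mul]
    obtain ⟨j, -, hj⟩ := exists_eraseIdx_of_length_lt cs (ω := σ) ht (by rwa [e, he])
    exact ⟨σ.eraseIdx j, (List.eraseIdx_sublist _ _).trans hσ, by rw [← hj, e]⟩

theorem exists_isReduced_cons {y : W} {i : B}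
    (h : cs.length (cs.simple i * y) < cs.length y) :
    ∃ η, cs.IsReduced (i :: η) ∧ cs.wordProd (i :: η) = y := by
  obtain ⟨η, hη, he⟩ := cs.exists_isReduced (cs.simple i * y)
  have e : cs.wordProd (i :: η) = y := by rw [cs.wordProd_cons, ← he]; simp
  refine ⟨η, ?_, e⟩
  have := cs.isLeftDescent_iff.1 h
  rw [CoxeterSystem.IsReduced, e, ← this, he, hη.eq, List.length_cons]

theorem length_simple_mul_lt_of_length_lt {x t : W} (i : B) (ht : cs.IsReflection t)
    (h : cs.length x < cs.length (t * x)) :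
    cs.simple i * x = t * x ∨
      cs.length (cs.simple i * x) < cs.length (cs.simple i * (t * x)) := by
  rcases cs.length_simple_mul (t * x) i with hy | hy
  · rcases cs.length_simple_mul x i with hx | hx <;> right <;> omega
  · obtain ⟨η, hη, he⟩ := exists_isReduced_cons (cs := cs) (y := t * x) (i := i) (by omega)
    have e : t * cs.wordProd (i :: η) = x := by rw [he, ← mul_assoc, ht.mul_self, one_mul]
    obtain ⟨j, hj, hej⟩ := exists_eraseIdx_of_length_lt cs (ω := i :: η) ht (by rwa [e, he])
    rw [e] at hej
    cases j with
    | zero =>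
      left
      rw [← he, cs.wordProd_cons, hej, List.eraseIdx_cons_zero]
    | succ j =>
      right
      have hl := cs.length_wordProd_le (η.eraseIdx j)
      have hr := hη.eq
      rw [he, List.length_cons] at hr
      rw [List.length_cons] at hj
      rw [List.length_eraseIdx_of_lt (by omega)] at hl
      have : cs.simple i * x = cs.wordProd (η.eraseIdx j) := by
        rw [hej, List.eraseIdx_cons_succ, cs.wordProd_cons]; simp
      rw [this]
      omega

theorem bruhatLE.simple_mul {x y : W} (i : B) (h : bruhatLE cs x y) :
    bruhatLE cs (cs.simple i * x) (cs.simple i * y) ∨ bruhatLE cs (cs.simple i * x) y := by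
  induction h using Relation.ReflTransGen.head_induction_on with
  | refl => exact Or.inl (.refl _)
  | @head x _ h h' ih =>
    obtain ⟨hlt, t, ht, rfl⟩ := h
    rcases length_simple_mul_lt_of_length_lt i ht hlt with he | hl
    · right; rw [he]; exact h'
    · have hstep : bruhatLE cs (cs.simple i * x) (cs.simple i * (t * x)) := by
        refine Relation.ReflTransGen.single ⟨hl, _, ht.conj (cs.simple i), ?_⟩
        simp [mul_assoc]
      exact ih.imp hstep.trans hstep.trans

theorem bruhatLE_wordProd_of_sublist {σ ω : List B} (hω : cs.IsReduced ω) (h : σ.Sublist ω) :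
    bruhatLE cs (cs.wordProd σ) (cs.wordProd ω) := by
  induction ω generalizing σ with
  | nil => rw [List.sublist_nil.1 h]; exact .refl _
  | cons i ω ih =>
    have hr : cs.IsReduced ω := by simpa using hω.drop 1
    have hle : bruhatLE cs (cs.wordProd ω) (cs.wordProd (i :: ω)) := by
      have := bruhatLE_simple_mul (cs := cs) (x := cs.wordProd (i :: ω)) (i := i) (by
        rw [hω.eq, cs.wordProd_cons, cs.simple_mul_simple_cancel_left, hr.eq]; simp)
      rwa [cs.wordProd_cons, cs.simple_mul_simple_cancel_left, ← cs.wordProd_cons] at this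
    cases h with
    | cons _ h => exact (ih hr h).trans hle
    | cons_cons _ h =>
      rcases (ih hr h).simple_mul i with h' | h'
      · rwa [cs.wordProd_cons, cs.wordProd_cons]
      · rw [cs.wordProd_cons]; exact h'.trans hle

/-- Deletion property: every word contains a reduced word with the same product. -/
theorem exists_isReduced_sublist (ω : List B) :
    ∃ σ, σ.Sublist ω ∧ cs.IsReduced σ ∧ cs.wordProd σ = cs.wordProd ω := by
  induction ω with
  | nil => exact ⟨[], .refl _, by simp [CoxeterSystem.IsReduced], rfl⟩
  | cons i ω ih =>
    obtain ⟨σ, hσ, hr, he⟩ := ih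
    rw [cs.wordProd_cons, ← he]
    rcases cs.length_simple_mul (cs.wordProd σ) i with h | h
    · refine ⟨i :: σ, hσ.cons_cons i, ?_, cs.wordProd_cons _ _⟩
      rw [CoxeterSystem.IsReduced, cs.wordProd_cons, h, hr.eq, List.length_cons]
    · obtain ⟨j, hj, hej⟩ := exists_eraseIdx_of_length_lt cs (ω := σ)
        (cs.isReflection_simple i) (by omega)
      refine ⟨σ.eraseIdx j, ((List.eraseIdx_sublist _ _).trans hσ).cons i, ?_, hej.symm⟩
      rw [CoxeterSystem.IsReduced, ← hej, List.length_eraseIdx_of_lt hj, ← hr.eq]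
      omega

theorem isReduced_append {ω η : List B} (hω : cs.IsReduced ω) (hη : cs.IsReduced η)
    (h : cs.length (cs.wordProd ω * cs.wordProd η) =
      cs.length (cs.wordProd ω) + cs.length (cs.wordProd η)) : cs.IsReduced (ω ++ η) := by
  rw [CoxeterSystem.IsReduced, cs.wordProd_append, h, hω.eq, hη.eq, List.length_append]

theorem bruhatLE.mul {a b u v : W} (hl : cs.length (u * v) = cs.length u + cs.length v)
    (ha : bruhatLE cs a u) (hb : bruhatLE cs b v) : bruhatLE cs (a * b) (u * v) := by
  obtain ⟨ω, hω, rfl⟩ := cs.exists_isReduced u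
  obtain ⟨η, hη, rfl⟩ := cs.exists_isReduced v
  obtain ⟨σ, hσ, rfl⟩ := ha.exists_sublist
  obtain ⟨τ, hτ, rfl⟩ := hb.exists_sublist
  rw [← cs.wordProd_append, ← cs.wordProd_append]
  exact bruhatLE_wordProd_of_sublist (isReduced_append hω hη hl) (hσ.append hτ)

theorem bruhatLE.exists_mul {x u v : W} (hl : cs.length (u * v) = cs.length u + cs.length v)
    (h : bruhatLE cs x (u * v)) :
    ∃ a b, bruhatLE cs a u ∧ bruhatLE cs b v ∧ x = a * b := by
  obtain ⟨ω, hω, rfl⟩ := cs.exists_isReduced u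
  obtain ⟨η, hη, rfl⟩ := cs.exists_isReduced v
  rw [← cs.wordProd_append] at h
  obtain ⟨σ, hσ, rfl⟩ := h.exists_sublist
  obtain ⟨σ₁, σ₂, rfl, h₁, h₂⟩ := List.sublist_append_iff.1 hσ
  exact ⟨_, _, bruhatLE_wordProd_of_sublist hω h₁, bruhatLE_wordProd_of_sublist hη h₂,
    cs.wordProd_append _ _⟩

/-- Lifting property: the lower interval of `u` is stable under right descents of `u`. -/
theorem bruhatLE.mul_simple {x u : W} {i : B} (h : bruhatLE cs x u)
    (hi : cs.length (u * cs.simple i) < cs.length u) : bruhatLE cs (x * cs.simple i) u := by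
  have hl : cs.length (u * cs.simple i * cs.simple i) =
      cs.length (u * cs.simple i) + cs.length (cs.simple i) := by
    rw [cs.simple_mul_simple_cancel_right, cs.length_simple, cs.isRightDescent_iff.1 hi]
  rw [← cs.simple_mul_simple_cancel_right (w := u) i] at h
  obtain ⟨a, b, ha, hb, rfl⟩ := h.exists_mul hl
  rw [← cs.wordProd_singleton] at hb
  obtain ⟨τ, hτ, rfl⟩ := hb.exists_sublist
  have key : bruhatLE cs (cs.wordProd τ * cs.simple i) (cs.simple i) := by
    have hr : cs.IsReduced [i] := by simp [CoxeterSystem.IsReduced]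
    rcases List.sublist_singleton.1 hτ with rfl | rfl
    · simpa using .refl _
    · have := bruhatLE_wordProd_of_sublist hr (List.nil_sublist _)
      simpa using this
  have := bruhatLE.mul hl ha key
  rwa [cs.simple_mul_simple_cancel_right, ← mul_assoc] at this

theorem one_bruhatLE (w : W) : bruhatLE cs 1 w := by
  obtain ⟨ω, hω, rfl⟩ := cs.exists_isReduced w
  simpa using bruhatLE_wordProd_of_sublist hω (List.nil_sublist ω)

theorem simple_bruhatLE_iff_mem_supp {w : W} {i : B} :
    bruhatLE cs (cs.simple i) w ↔ i ∈ supp cs w := by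
  constructor
  · intro h
    obtain ⟨ω, hω, rfl⟩ := cs.exists_isReduced w
    obtain ⟨σ, hσ, he⟩ := h.exists_sublist
    obtain ⟨τ, hτσ, hτ, heτ⟩ := exists_isReduced_sublist (cs := cs) σ
    rw [he] at heτ
    have hτl := hτ.eq
    rw [heτ, cs.length_simple, eq_comm, List.length_eq_one_iff] at hτl
    obtain ⟨j, rfl⟩ := hτl
    have hj : j ∈ ω := List.singleton_sublist.1 (hτσ.trans hσ)
    have hji : cs.simple j = cs.simple i := by simpa using heτ
    obtain ⟨l₁, l₂, rfl⟩ := List.append_of_mem hj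
    have e : cs.wordProd (l₁ ++ i :: l₂) = cs.wordProd (l₁ ++ j :: l₂) := by
      simp only [cs.wordProd_append, cs.wordProd_cons, hji]
    refine ⟨l₁ ++ i :: l₂, ?_, e, by simp⟩
    rw [CoxeterSystem.IsReduced, e, hω.eq]
    simp
  · rintro ⟨ω, hω, rfl, hi⟩
    simpa using bruhatLE_wordProd_of_sublist hω (List.singleton_sublist.2 hi)

end Bruhat

section Parabolic

variable {cs} {J : Set B}

theorem simple_mem_WJc {i : B} (hi : i ∈ J) : cs.simple i ∈ WJc cs J :=
  Subgroup.subset_closure ⟨i, hi, rfl⟩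

theorem wordProd_mem_WJc {ω : List B} (h : ∀ i ∈ ω, i ∈ J) : cs.wordProd ω ∈ WJc cs J := by
  induction ω with
  | nil => simp
  | cons i ω ih =>
    rw [cs.wordProd_cons]
    exact mul_mem (simple_mem_WJc (h i (by simp))) (ih fun j hj => h j (by simp [hj]))

theorem exists_isReduced_of_mem_WJc {u : W} (hu : u ∈ WJc cs J) :
    ∃ ω, cs.IsReduced ω ∧ cs.wordProd ω = u ∧ ∀ i ∈ ω, i ∈ J := by
  suffices ∃ ω, cs.wordProd ω = u ∧ ∀ i ∈ ω, i ∈ J by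
    obtain ⟨ω, rfl, hω⟩ := this
    obtain ⟨σ, hσ, hr, he⟩ := exists_isReduced_sublist (cs := cs) ω
    exact ⟨σ, hr, he, fun i hi => hω i (hσ.subset hi)⟩
  induction hu using Subgroup.closure_induction_left with
  | one => exact ⟨[], by simp, by simp⟩
  | mul_left x hx y hy ih =>
    obtain ⟨i, hi, rfl⟩ := hx
    obtain ⟨ω, rfl, hω⟩ := ih
    exact ⟨i :: ω, cs.wordProd_cons _ _, by simpa [hi] using hω⟩
  | inv_mul_cancel x hx y hy ih =>
    obtain ⟨i, hi, rfl⟩ := hx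
    obtain ⟨ω, rfl, hω⟩ := ih
    exact ⟨i :: ω, by rw [cs.wordProd_cons, cs.inv_simple], by simpa [hi] using hω⟩

theorem bruhatLE.mem_WJc {a u : W} (h : bruhatLE cs a u) (hu : u ∈ WJc cs J) :
    a ∈ WJc cs J := by
  obtain ⟨ω, -, rfl, hω⟩ := exists_isReduced_of_mem_WJc hu
  obtain ⟨σ, hσ, rfl⟩ := h.exists_sublist
  exact wordProd_mem_WJc fun i hi => hω i (hσ.subset hi)

theorem length_mul_of_forall_length_le {u v : W} (hu : u ∈ WJc cs J)
    (hv : ∀ g ∈ WJc cs J, cs.length v ≤ cs.length (g * v)) :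
    cs.length (u * v) = cs.length u + cs.length v := by
  obtain ⟨ω, hω, rfl, hJ⟩ := exists_isReduced_of_mem_WJc hu
  clear hu
  induction ω with
  | nil => simp
  | cons i ω ih =>
    have hr : cs.IsReduced ω := by simpa using hω.drop 1
    have hJ' : ∀ j ∈ ω, j ∈ J := fun j hj => hJ j (by simp [hj])
    have ih := ih hr hJ'
    rw [hω.eq, List.length_cons, cs.wordProd_cons, mul_assoc]
    rcases cs.length_simple_mul (cs.wordProd ω * v) i with h | h
    · rw [h, ih, hr.eq]; omega
    · exfalso
      obtain ⟨η, hη, rfl⟩ := cs.exists_isReduced v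
      rw [← cs.wordProd_append] at h
      obtain ⟨j, hj, he⟩ := exists_eraseIdx_of_length_lt cs (ω := ω ++ η)
        (cs.isReflection_simple i) (by omega)
      rcases lt_or_ge j ω.length with hlt | hge
      · rw [List.eraseIdx_append_of_lt_length hlt, cs.wordProd_append, cs.wordProd_append,
          ← mul_assoc, mul_left_inj, ← cs.wordProd_cons] at he
        have h1 := cs.length_wordProd_le (ω.eraseIdx j)
        rw [← he, hω.eq, List.length_eraseIdx_of_lt hlt, List.length_cons] at h1
        omega
      · rw [List.eraseIdx_append_of_length_le hge, cs.wordProd_append, cs.wordProd_append] at he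
        have hg := hv ((cs.wordProd ω)⁻¹ * cs.simple i * cs.wordProd ω)
          (mul_mem (mul_mem (inv_mem (wordProd_mem_WJc hJ'))
            (simple_mem_WJc (hJ i (by simp)))) (wordProd_mem_WJc hJ'))
        rw [mul_assoc, mul_assoc, he, inv_mul_cancel_left, hη.eq] at hg
        have h1 := cs.length_wordProd_le (η.eraseIdx (j - ω.length))
        rw [List.length_append] at hj
        rw [List.length_eraseIdx_of_lt (by omega)] at h1
        omega

theorem MinRight.length_le {v g : W} (hv : MinRight cs J v) (hg : g ∈ WJc cs J) :
    cs.length v ≤ cs.length (g * v) := by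
  obtain ⟨g₀, hg₀⟩ : ∃ g₀ : WJc cs J, ∀ g : WJc cs J, cs.length (g₀ * v) ≤ cs.length (g * v) :=
    ⟨_, fun g => Function.argmin_le (fun g : WJc cs J => cs.length (g * v)) g⟩
  have hmin : ∀ g ∈ WJc cs J, cs.length (g₀ * v) ≤ cs.length (g * (g₀ * v)) := by
    intro g hg
    have := hg₀ (⟨g, hg⟩ * g₀)
    simpa [mul_assoc] using this
  obtain ⟨ω, hω, he, hJ⟩ := exists_isReduced_of_mem_WJc (inv_mem g₀.2)
  cases ω with
  | nil =>
    rw [cs.wordProd_nil, eq_comm, inv_eq_one] at he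
    have := hg₀ ⟨g, hg⟩
    simpa [he] using this
  | cons i ω =>
    exfalso
    have h1 := length_mul_of_forall_length_le (wordProd_mem_WJc hJ) hmin
    have h2 := length_mul_of_forall_length_le
      (wordProd_mem_WJc (cs := cs) fun j hj => hJ j (List.mem_cons_of_mem i hj)) hmin
    have hr : cs.IsReduced ω := by simpa using hω.drop 1
    have e : cs.simple i * v = cs.wordProd ω * (g₀ * v) := by
      rw [← mul_assoc, ← cs.simple_mul_simple_cancel_left (w := cs.wordProd ω) i,
        ← cs.wordProd_cons, he]
      simp [mul_assoc]
    rw [hω.eq, he, inv_mul_cancel_left, List.length_cons] at h1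
    have h3 := hv i (hJ i (by simp))
    rw [e, h2, hr.eq] at h3
    omega

theorem MinRight.length_mul {u v : W} (hv : MinRight cs J v) (hu : u ∈ WJc cs J) :
    cs.length (u * v) = cs.length u + cs.length v :=
  length_mul_of_forall_length_le hu fun _ => hv.length_le

theorem MinRight.mul_injective {a a' b b' : W} (ha : a ∈ WJc cs J) (ha' : a' ∈ WJc cs J)
    (hb : MinRight cs J b) (hb' : MinRight cs J b') (h : a * b = a' * b') :
    a = a' ∧ b = b' := by
  have h1 : b' = (a'⁻¹ * a) * b := by rw [mul_assoc, h, inv_mul_cancel_left]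
  have h2 : b = (a⁻¹ * a') * b' := by rw [mul_assoc, ← h, inv_mul_cancel_left]
  have l1 := hb.length_mul (mul_mem (inv_mem ha') ha)
  have l2 := hb'.length_le (mul_mem (inv_mem ha) ha')
  rw [← h1] at l1
  rw [← h2] at l2
  have h3 : a'⁻¹ * a = 1 := cs.length_eq_zero_iff.1 (by omega)
  rw [h3, one_mul] at h1
  exact ⟨(inv_mul_eq_one.1 h3).symm, h1.symm⟩

theorem MinRight.eq_one_of_mem_WJc {b : W} (hb : MinRight cs J b) (h : b ∈ WJc cs J) :
    b = 1 := by
  have := hb.length_le (inv_mem h)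
  rw [inv_mul_cancel, cs.length_one, Nat.le_zero, cs.length_eq_zero_iff] at this
  exact this

/-- If the right descent set of `u` contains `S(v) ∩ J`, then every `y ≤ v` factors as `a * b`
with `b ∈ ᴶW` below `y` and right multiplication by `a` preserving `[e,u]`. -/
theorem exists_factor_of_supp_subset {u v y : W}
    (h : ∀ i ∈ J, i ∈ supp cs v → cs.length (u * cs.simple i) < cs.length u)
    (hy : bruhatLE cs y v) :
    ∃ a b, (∀ x, bruhatLE cs x u → bruhatLE cs (x * a) u) ∧ bruhatLE cs b v ∧
      MinRight cs J b ∧ y = a * b := by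
  induction hn : cs.length y using Nat.strong_induction_on generalizing y with
  | _ n ih =>
    by_cases hm : MinRight cs J y
    · exact ⟨1, y, by simp, hy, hm, by simp⟩
    · simp only [MinRight, not_forall, not_lt] at hm
      obtain ⟨i, hi, hle⟩ := hm
      have hlt := hle.lt_of_ne (cs.length_simple_mul_ne y i)
      obtain ⟨a, b, ha, hb, hbm, he⟩ :=
        ih _ (hn ▸ hlt) ((bruhatLE_simple_mul hlt).trans hy) rfl
      have hsupp : i ∈ supp cs v := by
        obtain ⟨η, hη, hηe⟩ := exists_isReduced_cons hlt
        exact simple_bruhatLE_iff_mem_supp.1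
          ((simple_bruhatLE_iff_mem_supp.2 ⟨_, hη, hηe, by simp⟩).trans hy)
      refine ⟨cs.simple i * a, b, fun x hx => ?_, hb, hbm, ?_⟩
      · rw [← mul_assoc]
        exact ha _ (hx.mul_simple (h i hi hsupp))
      · rw [mul_assoc, ← he, cs.simple_mul_simple_cancel_left]

theorem surjective_iff_poin_eq [Finite W] {u v : W} (hu : u ∈ WJc cs J) (hv : MinRight cs J v) :
    (∀ x, bruhatLE cs x (u * v) →
        ∃ a b, bruhatLE cs a u ∧ bruhatLE cs b v ∧ MinRight cs J b ∧ x = a * b)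
      ↔ poin cs (u * v) = poin cs u * poinRight cs J v := by
  classical
  have hl := hv.length_mul hu
  set C := (Set.toFinite {x : W | bruhatLE cs x (u * v)}).toFinset with hC
  set A := (Set.toFinite {x : W | bruhatLE cs x u}).toFinset with hA
  set D := (Set.toFinite {x : W | bruhatLE cs x v ∧ MinRight cs J x}).toFinset with hD
  have mC : ∀ x, x ∈ C ↔ bruhatLE cs x (u * v) := fun x => by simp [hC]
  have mA : ∀ x, x ∈ A ↔ bruhatLE cs x u := fun x => by simp [hA]
  have mD : ∀ x, x ∈ D ↔ bruhatLE cs x v ∧ MinRight cs J x := fun x => by simp [hD]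
  have hinj : Set.InjOn (fun p : W × W => p.1 * p.2) (A ×ˢ D : Finset (W × W)) := by
    rintro ⟨a, b⟩ hab ⟨a', b'⟩ hab' he
    simp only [Finset.coe_product, Set.mem_prod, Finset.mem_coe, mA, mD] at hab hab'
    obtain ⟨rfl, rfl⟩ := MinRight.mul_injective (hab.1.mem_WJc hu) (hab'.1.mem_WJc hu)
      hab.2.2 hab'.2.2 he
    rfl
  have hsub : (A ×ˢ D).image (fun p => p.1 * p.2) ⊆ C := by
    rintro x hx
    obtain ⟨⟨a, b⟩, hab, rfl⟩ := Finset.mem_image.1 hx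
    rw [Finset.mem_product, mA, mD] at hab
    exact (mC _).2 (bruhatLE.mul hl hab.1 hab.2.1)
  have hprod : poin cs u * poinRight cs J v =
      ∑ x ∈ (A ×ˢ D).image (fun p => p.1 * p.2), (X : ℤ[X]) ^ cs.length x := by
    rw [Finset.sum_image hinj, poin, poinRight, finsum_mem_eq_finite_toFinset_sum _ (Set.toFinite _),
      finsum_mem_eq_finite_toFinset_sum _ (Set.toFinite _), Finset.sum_mul_sum,
      ← Finset.sum_product']
    refine Finset.sum_congr rfl fun p hp => ?_
    rw [Finset.mem_product, mA, mD] at hp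
    rw [hp.2.2.length_mul (hp.1.mem_WJc hu), pow_add]
  have hpoin : poin cs (u * v) = ∑ x ∈ C, (X : ℤ[X]) ^ cs.length x :=
    finsum_mem_eq_finite_toFinset_sum _ _
  rw [hprod, hpoin]
  constructor
  · intro h
    congr 1
    refine (hsub.antisymm fun x hx => ?_).symm
    obtain ⟨a, b, ha, hb, hbm, rfl⟩ := h x ((mC x).1 hx)
    exact Finset.mem_image.2 ⟨(a, b), Finset.mem_product.2 ⟨(mA a).2 ha, (mD b).2 ⟨hb, hbm⟩⟩, rfl⟩
  · intro h x hx
    have hcard := congrArg (eval 1) h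
    simp only [eval_finsetSum, eval_pow, eval_X, one_pow, Finset.sum_const, nsmul_eq_mul,
      mul_one, Nat.cast_inj] at hcard
    rw [← mC, ← Finset.eq_of_subset_of_card_le hsub hcard.le] at hx
    obtain ⟨⟨a, b⟩, hab, rfl⟩ := Finset.mem_image.1 hx
    rw [Finset.mem_product, mA, mD] at hab
    exact ⟨a, b, hab.1, hab.2.1, hab.2.2, rfl⟩

end Parabolic

theorem statement_8 {B W : Type*} [Group W] [Finite W]
    {M : CoxeterMatrix B} (cs : CoxeterSystem M W) (J : Set B) (u v w : W)
    (hu : u ∈ WJc cs J) (hv : MinRight cs J v) (hw : w = u * v) :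
    ((∀ x, bruhatLE cs x w →
        ∃ a b, bruhatLE cs a u ∧ bruhatLE cs b v ∧ MinRight cs J b ∧ x = a * b)
      ↔ poin cs w = poin cs u * poinRight cs J v) ∧
    ((bruhatLE cs u w ∧ ∀ x, bruhatLE cs x w → x ∈ WJc cs J → bruhatLE cs x u)
      ↔ poin cs w = poin cs u * poinRight cs J v) ∧
    ((∀ i ∈ J, i ∈ supp cs v → cs.length (u * cs.simple i) < cs.length u)
      ↔ poin cs w = poin cs u * poinRight cs J v) := by
  subst hw
  have hl := hv.length_mul hu
  rw [← surjective_iff_poin_eq hu hv]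
  have hab : (∀ x, bruhatLE cs x (u * v) →
      ∃ a b, bruhatLE cs a u ∧ bruhatLE cs b v ∧ MinRight cs J b ∧ x = a * b) →
      (bruhatLE cs u (u * v) ∧ ∀ x, bruhatLE cs x (u * v) → x ∈ WJc cs J → bruhatLE cs x u) := by
    refine fun h => ⟨by simpa using bruhatLE.mul hl (.refl u) (one_bruhatLE v), ?_⟩
    intro x hx hxJ
    obtain ⟨a, b, ha, -, hbm, rfl⟩ := h x hx
    have hb : b ∈ WJc cs J := (Subgroup.mul_mem_cancel_left _ (ha.mem_WJc hu)).1 hxJ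
    rwa [hbm.eq_one_of_mem_WJc hb, mul_one]
  have hbc : (bruhatLE cs u (u * v) ∧
      ∀ x, bruhatLE cs x (u * v) → x ∈ WJc cs J → bruhatLE cs x u) →
      ∀ i ∈ J, i ∈ supp cs v → cs.length (u * cs.simple i) < cs.length u := by
    intro h i hi his
    have := h.2 _ (bruhatLE.mul hl (.refl u) (simple_bruhatLE_iff_mem_supp.2 his))
      (mul_mem hu (simple_mem_WJc hi))
    exact this.length_le.lt_of_ne (cs.length_mul_simple_ne u i)
  have hca : (∀ i ∈ J, i ∈ supp cs v → cs.length (u * cs.simple i) < cs.length u) →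
      ∀ x, bruhatLE cs x (u * v) →
        ∃ a b, bruhatLE cs a u ∧ bruhatLE cs b v ∧ MinRight cs J b ∧ x = a * b := by
    intro h x hx
    obtain ⟨u', y, hu', hy, rfl⟩ := hx.exists_mul hl
    obtain ⟨a, b, ha, hb, hbm, rfl⟩ := exists_factor_of_supp_subset h hy
    exact ⟨u' * a, b, ha u' hu', hb, hbm, (mul_assoc _ _ _).symm⟩
  exact ⟨Iff.rfl, ⟨hca ∘ hbc, hab⟩, ⟨hca, hbc ∘ hab⟩⟩

end Paper
end
end

section
/- Let W be a finite Coxeter group. If w ∈ W is rationally smooth, then w satisfies the HLSS condition, i.e. d(u,w) = ℓ'(uw^{-1}) for all u ≤ w. -/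
noncomputable section
namespace Paper
open Polynomial

variable {B W : Type*} [Group W] {M : CoxeterMatrix B} (cs : CoxeterSystem M W)

/-- A finite family of orthogonal reflections in a group acting on a Euclidean space, with a
choice of positive roots given by a regular vector `v₀`. -/
structure ReflSys (W V : Type*) [Group W] [AddCommGroup V] [Module ℝ V] where
  /-- the linear action -/
  ρ : W →* Module.End ℝ V
  /-- the inner product -/
  b : V →ₗ[ℝ] V →ₗ[ℝ] ℝ
  /-- the reflections -/
  T : Finset W
  /-- the positive root of a reflection -/
  α : W → V
  /-- a regular vector -/
  v₀ : V
  b_symm : ∀ u v, b u v = b v u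
  b_pos : ∀ v, v ≠ 0 → 0 < b v v
  b_inv : ∀ g u v, b (ρ g u) (ρ g v) = b u v
  mul_self : ∀ t ∈ T, t * t = 1
  refl : ∀ t ∈ T, ∀ v, ρ t v = v - b v (α t) • α t
  norm : ∀ t ∈ T, b (α t) (α t) = 2
  root_pos : ∀ t ∈ T, 0 < b (α t) v₀
  conj : ∀ r ∈ T, ∀ t ∈ T, r * t * r ∈ T
  pair_ne : ∀ t ∈ T, ∀ x, b (α t) (ρ x v₀) ≠ 0
  orbit_inj : ∀ x y, ρ x v₀ = ρ y v₀ → x = y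
  rank_one : ∀ g ∈ Subgroup.closure (T : Set W), ∀ a, g ≠ 1 →
    (∀ v, ∃ c : ℝ, ρ g v - v = c • a) → g ∈ T

namespace ReflSys

variable {W V : Type*} [Group W] [AddCommGroup V] [Module ℝ V] (D : ReflSys W V)

/-- The value of the positive root of `t` on the chamber of `x`. -/
def pair (t x : W) : ℝ := D.b (D.α t) (D.ρ x D.v₀)

/-- The (left) inversions of `x`. -/
def N (x : W) : Finset W := D.T.filter fun t => D.pair t x < 0

/-- The number of inversions. -/
def n (x : W) : ℕ := (D.N x).card

/-- An upward edge of the Bruhat graph. -/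
def Step (x y : W) : Prop := ∃ t ∈ D.T, 0 < D.pair t x ∧ y = t * x

/-- The Bruhat order of the reflection system. -/
def Le (x y : W) : Prop := Relation.ReflTransGen D.Step x y

variable {D}

lemma mem_N {t x : W} : t ∈ D.N x ↔ t ∈ D.T ∧ D.pair t x < 0 := by simp [N]

lemma ρ_mul (g h : W) (v : V) : D.ρ (g * h) v = D.ρ g (D.ρ h v) := by simp

lemma inv_eq {t : W} (ht : t ∈ D.T) : t⁻¹ = t := inv_eq_of_mul_eq_one_left (D.mul_self t ht)

lemma mul_cancel {t : W} (ht : t ∈ D.T) (x : W) : t * (t * x) = x := by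
  rw [← mul_assoc, D.mul_self t ht, one_mul]

lemma conj_conj {r : W} (hr : r ∈ D.T) (t : W) : r * (r * t * r) * r = t := by
  simp [mul_assoc, D.mul_self r hr, mul_cancel hr]

lemma pair_neg_or_pos {t : W} (ht : t ∈ D.T) (x : W) : D.pair t x < 0 ∨ 0 < D.pair t x :=
  lt_or_gt_of_ne (D.pair_ne t ht x)

lemma pair_one {t : W} : D.pair t 1 = D.b (D.α t) D.v₀ := by simp [pair]

lemma pair_mul {t : W} (ht : t ∈ D.T) (r x : W) :
    D.pair r (t * x) = D.pair r x - D.b (D.α r) (D.α t) * D.pair t x := by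
  rw [pair, pair, pair, ρ_mul, D.refl t ht, D.b_symm (D.ρ x D.v₀)]
  simp; ring

lemma pair_mul_self {t : W} (ht : t ∈ D.T) (x : W) : D.pair t (t * x) = -D.pair t x := by
  rw [pair_mul ht, D.norm t ht]; ring

lemma ρ_root_self {t : W} (ht : t ∈ D.T) : D.ρ t (D.α t) = -D.α t := by
  rw [D.refl t ht, D.norm t ht, two_smul]; abel

lemma ρ_root_eq_or_neg {t t' g : W} (ht : t ∈ D.T) (ht' : t' ∈ D.T) (h : t' = g * t * g⁻¹) :
    D.ρ g (D.α t) = D.α t' ∨ D.ρ g (D.α t) = -D.α t' := by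
  have h1 : D.ρ t' (D.ρ g (D.α t)) = -D.ρ g (D.α t) := by
    rw [← ρ_mul, h, inv_mul_cancel_right, ρ_mul, ρ_root_self ht, map_neg]
  rw [D.refl t' ht'] at h1
  set a := D.ρ g (D.α t) with ha
  have h2 : (2 : ℝ) • a = D.b a (D.α t') • D.α t' := by
    rw [two_smul]; rw [sub_eq_iff_eq_add] at h1; nth_rw 1 [h1]; abel
  set c := D.b a (D.α t') with hc
  have h3 : D.b ((2 : ℝ) • a) ((2 : ℝ) • a) = D.b (c • D.α t') (c • D.α t') := by rw [h2]
  have h4 : D.b a a = 2 := by rw [ha, D.b_inv, D.norm t ht]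
  simp only [map_smul, LinearMap.smul_apply, smul_eq_mul, h4, D.norm t' ht'] at h3
  have h5 : (c - 2) * (c + 2) = 0 := by linarith
  rcases mul_eq_zero.1 h5 with h | h
  · left
    rw [show c = 2 by linarith] at h2
    exact smul_right_injective V (two_ne_zero (α := ℝ)) h2
  · right
    rw [show c = -2 by linarith, neg_smul, ← smul_neg] at h2
    exact smul_right_injective V (two_ne_zero (α := ℝ)) h2

lemma ρ_root {r t : W} (hr : r ∈ D.T) (ht : t ∈ D.T) (h : 0 < D.b (D.ρ r (D.α t)) D.v₀) :
    D.ρ r (D.α t) = D.α (r * t * r) := by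
  have hc := D.conj r hr t ht
  rcases ρ_root_eq_or_neg ht hc (g := r) (by rw [inv_eq hr]) with h1 | h1
  · exact h1
  · rw [h1] at h
    simp only [map_neg, LinearMap.neg_apply] at h
    linarith [D.root_pos _ hc]

lemma ρ_root_of_neg {r t : W} (hr : r ∈ D.T) (ht : t ∈ D.T) (h : D.b (D.ρ r (D.α t)) D.v₀ < 0) :
    D.ρ r (D.α t) = -D.α (r * t * r) := by
  have hc := D.conj r hr t ht
  rcases ρ_root_eq_or_neg ht hc (g := r) (by rw [inv_eq hr]) with h1 | h1
  · rw [h1] at h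
    linarith [D.root_pos _ hc]
  · exact h1

lemma root_inj {s t : W} (hs : s ∈ D.T) (ht : t ∈ D.T) (h : D.α s = D.α t) : s = t := by
  apply D.orbit_inj
  rw [D.refl s hs, D.refl t ht, h]

lemma pair_conj {r t : W} (hr : r ∈ D.T) (ht : t ∈ D.T) (h : 0 < D.b (D.ρ r (D.α t)) D.v₀)
    (x : W) : D.pair (r * t * r) (r * x) = D.pair t x := by
  rw [pair, pair, ρ_mul, ← ρ_root hr ht h, D.b_inv]

lemma n_lt_of_step {x y : W} (h : D.Step x y) : D.n x < D.n y := by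
  classical
  obtain ⟨t, ht, hp, rfl⟩ := h
  have key : ∀ r ∈ D.N x, r ∉ D.N (t * x) → t * r * t ∈ D.N (t * x) ∧ t * r * t ∉ D.N x := by
    intro r hr hr'
    rw [mem_N] at hr hr'
    have h1 : ¬ D.pair r (t * x) < 0 := fun h => hr' ⟨hr.1, h⟩
    rw [pair_mul ht] at h1
    have hκ : D.b (D.α r) (D.α t) < 0 := by
      by_contra hc
      push Not at hc h1
      nlinarith [mul_nonneg hc hp.le]
    have hpos : 0 < D.b (D.ρ t (D.α r)) D.v₀ := by
      rw [D.refl t ht]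
      simp only [map_sub, map_smul, LinearMap.sub_apply, LinearMap.smul_apply, smul_eq_mul]
      nlinarith [D.root_pos t ht, D.root_pos r hr.1, mul_pos (neg_pos.2 hκ) (D.root_pos t ht)]
    have hc := D.conj t ht r hr.1
    refine ⟨mem_N.2 ⟨hc, ?_⟩, fun h => ?_⟩
    · rw [pair_conj ht hr.1 hpos]; exact hr.2
    · have h2 := (mem_N.1 h).2
      rw [pair, ← ρ_root ht hr.1 hpos, D.refl t ht] at h2
      simp only [map_sub, map_smul, LinearMap.sub_apply, LinearMap.smul_apply, smul_eq_mul] at h2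
      exact h1 h2
  have htx : t ∉ D.N x := fun h => absurd (mem_N.1 h).2 (not_lt.2 hp.le)
  have htt : t * t * t = t := by rw [D.mul_self t ht, one_mul]
  rw [n, n, ← Nat.succ_le_iff]
  have hmap : ∀ r ∈ insert t (D.N x), (fun r => if r ∈ D.N (t * x) then r else t * r * t) r
      ∈ D.N (t * x) := by
    intro r hr
    dsimp only
    split_ifs with h
    · exact h
    · rcases Finset.mem_insert.1 hr with rfl | hr
      · exact absurd (mem_N.2 ⟨ht, by rw [pair_mul_self ht]; linarith⟩) h
      · exact (key r hr h).1
  have htm : t ∈ D.N (t * x) := mem_N.2 ⟨ht, by rw [pair_mul_self ht]; linarith⟩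
  have hinj : Set.InjOn (fun r => if r ∈ D.N (t * x) then r else t * r * t)
      (insert t (D.N x) : Finset W) := by
    intro r hr r' hr' h
    dsimp only at h
    have aux : ∀ a ∈ insert t (D.N x), ∀ c ∈ insert t (D.N x), a ∈ D.N (t * x) →
        c ∉ D.N (t * x) → a ≠ t * c * t := by
      intro a ha c hc ha' hc' e
      have hcx : c ∈ D.N x := by
        rcases Finset.mem_insert.1 hc with rfl | hc
        · exact absurd htm hc'
        · exact hc
      rcases Finset.mem_insert.1 ha with rfl | ha
      · have : c = a := by
          have := congrArg (fun z => a * z * a) e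
          simp only [conj_conj ht] at this
          rw [← this, htt]
        exact hc' (this ▸ htm)
      · exact (key c hcx hc').2 (e ▸ ha)
    split_ifs at h with h1 h2 h2
    · exact h
    · exact absurd h (aux r hr r' hr' h1 h2)
    · exact absurd h.symm (aux r' hr' r hr h2 h1)
    · simpa using h
  have := Finset.card_le_card_of_injOn _ hmap hinj
  rwa [Finset.card_insert_of_notMem htx] at this

lemma pair_pos_iff {t : W} (ht : t ∈ D.T) (x : W) : 0 < D.pair t x ↔ D.n x < D.n (t * x) := by
  refine ⟨fun h => n_lt_of_step ⟨t, ht, h, rfl⟩, fun h => ?_⟩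
  rcases pair_neg_or_pos ht x with h' | h'
  · have : D.Step (t * x) x :=
      ⟨t, ht, by rw [pair_mul_self ht]; linarith, (mul_cancel ht x).symm⟩
    exact absurd (n_lt_of_step this) (by omega)
  · exact h'

lemma pair_neg_iff {t : W} (ht : t ∈ D.T) (x : W) : D.pair t x < 0 ↔ D.n (t * x) < D.n x := by
  have := pair_pos_iff ht (t * x)
  rw [pair_mul_self ht, mul_cancel ht] at this
  rw [← this]; simp

lemma Le.refl (x : W) : D.Le x x := Relation.ReflTransGen.refl

lemma Le.trans {x y z : W} (h : D.Le x y) (h' : D.Le y z) : D.Le x z :=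
  Relation.ReflTransGen.trans h h'

lemma Step.le {x y : W} (h : D.Step x y) : D.Le x y := Relation.ReflTransGen.single h

lemma Le.n_le {x y : W} (h : D.Le x y) : D.n x ≤ D.n y := by
  induction h with
  | refl => exact le_rfl
  | tail _ h ih => exact ih.trans (n_lt_of_step h).le

lemma Le.eq_or_lt {x y : W} (h : D.Le x y) : x = y ∨ D.n x < D.n y := by
  rcases Relation.ReflTransGen.cases_tail h with h | ⟨z, h1, h2⟩
  · exact Or.inl h.symm
  · exact Or.inr ((Le.n_le h1).trans_lt (n_lt_of_step h2))

lemma Le.n_lt {x y : W} (h : D.Le x y) (hne : x ≠ y) : D.n x < D.n y :=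
  h.eq_or_lt.resolve_left hne

lemma Le.antisymm {x y : W} (hxy : D.Le x y) (hyx : D.Le y x) : x = y :=
  hxy.eq_or_lt.resolve_right (not_lt.2 hyx.n_le)

/-- A reflection permuting the positive roots different from its own root. -/
def Simple (D : ReflSys W V) (s : W) : Prop :=
  s ∈ D.T ∧ ∀ t ∈ D.T, t ≠ s → 0 < D.b (D.ρ s (D.α t)) D.v₀

lemma exists_simple {w : W} (hw : D.n w ≠ 0) : ∃ s, D.Simple s ∧ D.pair s w < 0 := by
  obtain ⟨t₀, ht₀⟩ := Finset.card_ne_zero.1 hw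
  rw [mem_N] at ht₀
  obtain ⟨m, hm, hmax⟩ := D.T.exists_max_image
    (fun t => -D.pair t w / D.b (D.α t) D.v₀) ⟨t₀, ht₀.1⟩
  set c := -D.pair m w / D.b (D.α m) D.v₀ with hc
  obtain ⟨s, hs, hmin⟩ := (D.T.filter fun t => -D.pair t w / D.b (D.α t) D.v₀ = c).exists_min_image
    (fun t => D.b (D.α t) D.v₀) ⟨m, by simp [hm, hc]⟩
  rw [Finset.mem_filter] at hs
  obtain ⟨hs, hsc⟩ := hs
  have hcpos : 0 < c :=
    (div_pos (neg_pos.2 ht₀.2) (D.root_pos _ ht₀.1)).trans_le (hmax t₀ ht₀.1)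
  have hsγ : -D.pair s w = c * D.b (D.α s) D.v₀ := by
    rw [← hsc, div_mul_cancel₀ _ (D.root_pos s hs).ne']
  have hle : ∀ t ∈ D.T, -D.pair t w ≤ c * D.b (D.α t) D.v₀ := fun t ht =>
    (div_le_iff₀ (D.root_pos t ht)).1 (hmax t ht)
  have hβ : ∀ t ∈ D.T, -D.pair t w = c * D.b (D.α t) D.v₀ →
      D.b (D.α s) D.v₀ ≤ D.b (D.α t) D.v₀ := fun t ht h =>
    hmin t (Finset.mem_filter.2 ⟨ht, by rw [h, mul_div_cancel_right₀ _ (D.root_pos t ht).ne']⟩)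
  refine ⟨s, ⟨hs, fun r hr hrs => ?_⟩, ?_⟩
  swap
  · nlinarith [D.root_pos s hs, mul_pos hcpos (D.root_pos s hs)]
  by_contra hneg
  have hne : D.b (D.ρ s (D.α r)) D.v₀ ≠ 0 := by
    have hc := D.conj s hs r hr
    rcases ρ_root_eq_or_neg hr hc (g := s) (by rw [inv_eq hs]) with h | h
    · rw [h]; exact (D.root_pos _ hc).ne'
    · rw [h, map_neg, LinearMap.neg_apply]; exact (neg_lt_zero.2 (D.root_pos _ hc)).ne
  have hlt := lt_of_le_of_ne (not_lt.1 hneg) hne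
  have hr' := D.conj s hs r hr
  have e := ρ_root_of_neg hs hr hlt
  rw [D.refl s hs] at e
  set κ := D.b (D.α r) (D.α s) with hκ
  have e' : κ • D.α s = D.α r + D.α (s * r * s) := by
    rw [sub_eq_iff_eq_add] at e; rw [e]; abel
  have eβ : κ * D.b (D.α s) D.v₀ = D.b (D.α r) D.v₀ + D.b (D.α (s * r * s)) D.v₀ := by
    have := congrArg (fun v => D.b v D.v₀) e'
    simpa using this
  have eγ : κ * D.pair s w = D.pair r w + D.pair (s * r * s) w := by
    have := congrArg (fun v => D.b v (D.ρ w D.v₀)) e'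
    simpa [pair] using this
  have l1 := hle r hr
  have l2 := hle _ hr'
  have eγ' : κ * (c * D.b (D.α s) D.v₀) = -D.pair r w + -D.pair (s * r * s) w := by
    rw [← hsγ]; linarith
  have eβ' : κ * (c * D.b (D.α s) D.v₀)
      = c * D.b (D.α r) D.v₀ + c * D.b (D.α (s * r * s)) D.v₀ := by
    linear_combination c * eβ
  have g1 := hβ r hr (by linarith)
  have g2 := hβ _ hr' (by linarith)
  have hκ2 : 2 ≤ κ := by
    by_contra h
    push Not at h
    nlinarith [D.root_pos s hs]
  have : D.α r - D.α s = 0 := by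
    by_contra h
    have := D.b_pos _ h
    simp only [map_sub, LinearMap.sub_apply, D.norm r hr, D.norm s hs, D.b_symm (D.α s),
      ← hκ] at this
    linarith
  exact hrs (root_inj hr hs (sub_eq_zero.1 this))

lemma Simple.n_mul {s : W} (hs : D.Simple s) {x : W} (h : 0 < D.pair s x) :
    D.n (s * x) = D.n x + 1 := by
  classical
  refine le_antisymm ?_ (n_lt_of_step ⟨s, hs.1, h, rfl⟩)
  have hmap : ∀ r ∈ (D.N (s * x)).erase s, s * r * s ∈ D.N x := by
    intro r hr
    rw [Finset.mem_erase, mem_N] at hr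
    have := pair_conj hs.1 hr.2.1 (hs.2 r hr.2.1 hr.1) (s * x)
    rw [mul_cancel hs.1] at this
    exact mem_N.2 ⟨D.conj s hs.1 r hr.2.1, by rw [this]; exact hr.2.2⟩
  have := Finset.card_le_card_of_injOn (fun r => s * r * s) hmap
    (fun a _ c _ h => by simpa using h)
  have h2 := Finset.pred_card_le_card_erase (s := D.N (s * x)) (a := s)
  rw [n, n]; omega

lemma Simple.n_mul_of_neg {s : W} (hs : D.Simple s) {x : W} (h : D.pair s x < 0) :
    D.n (s * x) + 1 = D.n x := by
  have := hs.n_mul (x := s * x) (by rw [pair_mul_self hs.1]; linarith)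
  rw [mul_cancel hs.1] at this
  exact this.symm

lemma Simple.pair_conj {s : W} (hs : D.Simple s) {t : W} (ht : t ∈ D.T) (hts : t ≠ s) (x : W) :
    D.pair (s * t * s) (s * x) = D.pair t x :=
  ReflSys.pair_conj hs.1 ht (hs.2 t ht hts) x

lemma Simple.step_mul {s : W} (hs : D.Simple s) {t : W} (ht : t ∈ D.T) (hts : t ≠ s) {x : W}
    (h : 0 < D.pair t x) : D.Step (s * x) (s * (t * x)) :=
  ⟨s * t * s, D.conj s hs.1 t ht, by rwa [hs.pair_conj ht hts], by
    simp [mul_assoc, mul_cancel hs.1]⟩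

lemma step_of_pos {t : W} (ht : t ∈ D.T) {x : W} (h : 0 < D.pair t x) : D.Step x (t * x) :=
  ⟨t, ht, h, rfl⟩

lemma step_of_neg {t : W} (ht : t ∈ D.T) {x : W} (h : D.pair t x < 0) : D.Step (t * x) x :=
  ⟨t, ht, by rw [pair_mul_self ht]; linarith, (mul_cancel ht x).symm⟩

lemma Simple.le_mul_or_le {s : W} (hs : D.Simple s) {x w : W} (h : D.Le x w) :
    D.Le (s * x) (s * w) ∨ D.Le (s * x) w := by
  induction h with
  | refl => exact Or.inl (Le.refl _)
  | tail _ hst ih =>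
    rcases ih with ih | ih
    · obtain ⟨t, ht, hp, rfl⟩ := hst
      by_cases hts : t = s
      · subst hts; exact Or.inr ih
      · exact Or.inl (ih.trans (hs.step_mul ht hts hp).le)
    · exact Or.inr (ih.trans hst.le)

lemma Simple.le_or_mul_le_mul {s : W} (hs : D.Simple s) {x w : W} (h : D.Le x w) :
    D.Le x (s * w) ∨ D.Le (s * x) (s * w) := by
  induction h using Relation.ReflTransGen.head_induction_on with
  | refl => exact Or.inr (Le.refl _)
  | head hst _ ih =>
    rcases ih with ih | ih
    · exact Or.inl (hst.le.trans ih)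
    · obtain ⟨t, ht, hp, rfl⟩ := hst
      by_cases hts : t = s
      · subst hts; rw [mul_cancel ht] at ih; exact Or.inl ih
      · exact Or.inr ((hs.step_mul ht hts hp).le.trans ih)

lemma Simple.mul_le {s : W} (hs : D.Simple s) {x w : W} (h : D.Le x w) (hw : D.pair s w < 0) :
    D.Le (s * x) w := by
  rcases hs.le_mul_or_le h with h | h
  · exact h.trans (step_of_neg hs.1 hw).le
  · exact h

lemma Simple.le_mul {s : W} (hs : D.Simple s) {x w : W} (h : D.Le x w) (hx : 0 < D.pair s x) :
    D.Le x (s * w) := by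
  rcases hs.le_or_mul_le_mul h with h | h
  · exact h
  · exact (step_of_pos hs.1 hx).le.trans h

lemma Simple.mul_le_mul_of_neg {s : W} (hs : D.Simple s) {x w : W} (h : D.Le x w)
    (hx : D.pair s x < 0) : D.Le (s * x) (s * w) := by
  rcases hs.le_or_mul_le_mul h with h | h
  · exact (step_of_neg hs.1 hx).le.trans h
  · exact h

lemma Simple.mul_le_mul_of_pos {s : W} (hs : D.Simple s) {x w : W} (h : D.Le x w)
    (hw : 0 < D.pair s w) : D.Le (s * x) (s * w) := by
  rcases hs.le_mul_or_le h with h | h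
  · exact h
  · exact h.trans (step_of_pos hs.1 hw).le

/-- The reflections leading from `w` to the elements covered by it. -/
def Cov (D : ReflSys W V) (w : W) : Finset W :=
  D.T.filter fun t => D.n (t * w) + 1 = D.n w

lemma mem_Cov {t w : W} : t ∈ D.Cov w ↔ t ∈ D.T ∧ D.n (t * w) + 1 = D.n w := by simp [Cov]

lemma Simple.mem_Cov {s w : W} (hs : D.Simple s) (h : D.pair s w < 0) : s ∈ D.Cov w :=
  ReflSys.mem_Cov.2 ⟨hs.1, hs.n_mul_of_neg h⟩

lemma pair_neg_of_mem_Cov {t w : W} (h : t ∈ D.Cov w) : D.pair t w < 0 := by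
  rw [mem_Cov] at h
  rw [pair_neg_iff h.1]; omega

lemma exists_mem_Cov {x w : W} (h : D.Le x w) (hne : x ≠ w) : ∃ t ∈ D.Cov w, D.Le x (t * w) := by
  induction hk : D.n w using Nat.strong_induction_on generalizing x w with
  | _ k ih =>
    obtain ⟨s, hs, hsw⟩ := exists_simple (D := D) (w := w) (by have := h.n_lt hne; omega)
    have hn := hs.n_mul_of_neg hsw
    rcases pair_neg_or_pos hs.1 x with hsx | hsx
    · obtain ⟨t, ht, hle⟩ := ih (D.n (s * w)) (by omega) (hs.mul_le_mul_of_neg h hsx)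
        (by simpa using hne) rfl
      have htn := pair_neg_of_mem_Cov ht
      rw [ReflSys.mem_Cov] at ht
      have hts : t ≠ s := by
        rintro rfl
        rw [pair_mul_self hs.1] at htn; linarith
      rcases pair_neg_or_pos hs.1 (t * (s * w)) with hy | hy
      · refine ⟨s, hs.mem_Cov hsw, ?_⟩
        have := hs.mul_le hle hy
        rw [mul_cancel hs.1] at this
        exact this.trans (step_of_neg ht.1 htn).le
      · refine ⟨s * t * s, mem_Cov.2 ⟨D.conj s hs.1 t ht.1, ?_⟩, ?_⟩
        · have := hs.n_mul hy
          simp only [mul_assoc] at this ⊢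
          omega
        · have := hs.mul_le_mul_of_pos hle hy
          rw [mul_cancel hs.1] at this
          simpa only [mul_assoc] using this
    · exact ⟨s, hs.mem_Cov hsw, hs.le_mul h hsx⟩

open Classical in
/-- The first reflections of the saturated chains of length two from `w` down to `z`. -/
def Mid (D : ReflSys W V) (w z : W) : Finset W :=
  (D.Cov w).filter fun t => z * w⁻¹ * t ∈ D.Cov (t * w)

lemma mem_Mid {w z t : W} : t ∈ D.Mid w z ↔ (t ∈ D.T ∧ D.n (t * w) + 1 = D.n w) ∧
    z * w⁻¹ * t ∈ D.T ∧ D.n z + 1 = D.n (t * w) := by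
  have h : t ∈ D.T → z * w⁻¹ * t * (t * w) = z := fun ht => by
    simp [mul_assoc, mul_cancel ht]
  simp only [Mid, Finset.mem_filter, mem_Cov]
  constructor
  · rintro ⟨h1, h2⟩; rw [h h1.1] at h2; exact ⟨h1, h2⟩
  · rintro ⟨h1, h2⟩; rw [h h1.1]; exact ⟨h1, h2⟩

/-- The area form of two roots, paired with two vectors. -/
def area (D : ReflSys W V) (u v : V) (t r : W) : ℝ :=
  D.b u (D.α t) * D.b v (D.α r) - D.b v (D.α t) * D.b u (D.α r)

lemma Simple.root_conj {s t : W} (hs : D.Simple s) (ht : t ∈ D.T) (hts : t ≠ s) :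
    D.α (s * t * s) = D.α t - D.b (D.α t) (D.α s) • D.α s := by
  rw [← ρ_root hs.1 ht (hs.2 t ht hts), D.refl s hs.1]

lemma Simple.area_conj {s t r : W} (hs : D.Simple s) (ht : t ∈ D.T) (hr : r ∈ D.T) (hts : t ≠ s)
    (hrs : r ≠ s) (u v : V) :
    D.area (D.ρ s u) (D.ρ s v) (s * t * s) (s * r * s) = D.area u v t r := by
  simp only [area, ← ρ_root hs.1 ht (hs.2 t ht hts), ← ρ_root hs.1 hr (hs.2 r hr hrs), D.b_inv]

lemma area_refl {s : W} (hs : s ∈ D.T) (r : W) (u v : V) :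
    D.area (D.ρ s u) (D.ρ s v) r s = D.area u v s r := by
  simp only [area, D.refl s hs, map_sub, map_smul, LinearMap.sub_apply, LinearMap.smul_apply,
    smul_eq_mul, D.norm s hs, D.b_symm (D.α s) (D.α r)]
  ring

lemma sum_area_eq_zero (w z : W) (u v : V) :
    ∑ t ∈ D.Mid w z, D.area u v t (z * w⁻¹ * t) = 0 := by
  classical
  induction hk : D.n w using Nat.strong_induction_on generalizing w z u v with
  | _ k ih =>
  by_cases hw : D.n w = 0
  · rw [Finset.sum_eq_zero]
    intro t ht
    have := (mem_Mid.1 ht).1.2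
    omega
  by_cases hnz : D.n z + 2 = D.n w
  swap
  · rw [Finset.sum_eq_zero]
    intro t ht
    have := mem_Mid.1 ht
    omega
  obtain ⟨s, hs, hsw⟩ := exists_simple hw
  have hn := hs.n_mul_of_neg hsw
  have hss := D.mul_self s hs.1
  have hsi := inv_eq hs.1
  set g := z * w⁻¹ with hg
  have hgy : ∀ t ∈ D.T, g * t * (t * w) = z := fun t ht => by
    simp [hg, mul_assoc, mul_cancel ht]
  have hstep : ∀ t ∈ D.Mid w z, t ≠ s → D.Step (s * (t * w)) (s * w) := by
    intro t ht hts
    have h := (mem_Mid.1 ht).1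
    have := hs.step_mul h.1 hts (x := t * w) (by rw [pair_pos_iff h.1, mul_cancel h.1]; omega)
    rwa [mul_cancel h.1] at this
  have hstep' : ∀ t ∈ D.Mid w z, g * t ≠ s → D.Step (s * z) (s * (t * w)) := by
    intro t ht hts
    have h := mem_Mid.1 ht
    have e : g * t * z = t * w := by
      have := hgy t h.1.1
      rw [← this, mul_cancel h.2.1]
    have := hs.step_mul h.2.1 hts (x := z) (by rw [pair_pos_iff h.2.1, e]; omega)
    rwa [e] at this
  rcases pair_neg_or_pos hs.1 z with hsz | hsz
  · have hnz' := hs.n_mul_of_neg hsz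
    rw [← ih (D.n (s * w)) (by omega) (s * w) (s * z) (D.ρ s u) (D.ρ s v) rfl]
    have hg1 : s * z * (s * w)⁻¹ = s * g * s := by simp [hg, mul_assoc, hsi]
    rw [hg1]
    have hrs : ∀ t ∈ D.Mid w z, g * t ≠ s := by
      intro t ht e
      have h := mem_Mid.1 ht
      have e2 := hgy t h.1.1
      rw [e] at e2
      have e3 : s * z = t * w := by rw [← e2, mul_cancel hs.1]
      rw [e3] at hnz'; omega
    refine Finset.sum_bij' (fun t _ => if t = s then g * s else s * t * s)
      (fun t _ => if t = g * s then s else s * t * s) ?_ ?_ ?_ ?_ ?_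
    · intro t ht
      have h := mem_Mid.1 ht
      rw [mem_Mid, hg1]
      split_ifs with hts
      · subst hts
        have e : g * t * (t * w) = z := hgy t h.1.1
        have e2 : t * g * t * (g * t) = t := by
          rw [show t * g * t * (g * t) = t * ((g * t) * (g * t)) by group, D.mul_self _ h.2.1,
            mul_one]
        refine ⟨⟨h.2.1, ?_⟩, ?_, ?_⟩
        · rw [e]; omega
        · rw [e2]; exact hs.1
        · rw [e]; omega
      · have hst := hstep t ht hts
        have hst' := hstep' t ht (hrs t ht)
        have e : s * t * s * (s * w) = s * (t * w) := by simp [mul_assoc, mul_cancel hs.1]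
        have e2 : s * g * s * (s * t * s) = s * (g * t) * s := by
          simp [mul_assoc, mul_cancel hs.1]
        have l1 := n_lt_of_step hst
        have l2 := n_lt_of_step hst'
        rw [e, e2]
        exact ⟨⟨D.conj s hs.1 t h.1.1, by omega⟩, D.conj s hs.1 _ h.2.1, by omega⟩
    · intro t ht
      have h := mem_Mid.1 ht
      rw [hg1] at h
      rw [mem_Mid]
      split_ifs with htg
      · subst htg
        have e : s * g * s * (g * s) = s := by
          rw [show s * g * s * (g * s) = s * ((g * s) * (g * s)) by group, D.mul_self _ h.1.1,
            mul_one]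
        refine ⟨⟨hs.1, by omega⟩, h.1.1, by omega⟩
      · have e : s * t * s * w = s * (t * (s * w)) := by simp [mul_assoc]
        have e2 : g * (s * t * s) = s * (s * g * s * t) * s := by simp [mul_assoc, mul_cancel hs.1]
        have hr : s * g * s * t ≠ s := by
          intro e3
          apply htg
          have : t = (g * s)⁻¹ := by
            rw [eq_inv_iff_mul_eq_one, ← mul_eq_one_comm]
            have := congrArg (s * ·) e3
            simpa [mul_assoc, mul_cancel hs.1, hss] using this
          rw [this]
          have h4 := inv_eq h.1.1
          rw [this, inv_inv] at h4
          rw [← h4]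
        have e4 : s * g * s * t * (t * (s * w)) = s * z := by
          simp [hg, mul_assoc, mul_cancel h.1.1, mul_cancel hs.1]
        have e5 : s * g * s * t * (s * z) = t * (s * w) := by rw [← e4, mul_cancel h.2.1]
        have hp : 0 < D.pair (s * g * s * t) (s * z) := by
          rw [pair_pos_iff h.2.1, e5]; omega
        have := n_lt_of_step (hs.step_mul h.2.1 hr hp)
        rw [e5, mul_cancel hs.1] at this
        have h6 : 0 < D.pair s (t * (s * w)) := by
          rw [pair_pos_iff hs.1]; omega
        have h7 := hs.n_mul h6
        rw [e, e2]
        exact ⟨⟨D.conj s hs.1 t h.1.1, by omega⟩, D.conj s hs.1 _ h.2.1, by omega⟩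
    · intro t ht
      have h := mem_Mid.1 ht
      split_ifs with h1 h2 h2
      · exact h1.symm
      · exact absurd rfl h2
      · exfalso
        have e := hgy t h.1.1
        have h3 : s * (t * w) = z := by
          have : t * s = s * g * s := by
            have := congrArg (s * ·) h2
            simpa [mul_assoc, mul_cancel hs.1] using this
          have e2 : s * t = g := by
            have := congrArg (· * s) h2
            simpa [mul_assoc, hss] using this
          rw [← mul_assoc, e2, hg]; simp
        rw [← h3, mul_cancel hs.1] at hnz'
        have := (n_lt_of_step (hstep t ht h1))
        have := n_lt_of_step (hstep' t ht (hrs t ht))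
        rw [← h3, mul_cancel hs.1] at this
        omega
      · exact conj_conj hs.1 t
    · intro t ht
      have h := mem_Mid.1 ht
      split_ifs with h1 h2 h2
      · exact h1.symm
      · exact absurd rfl h2
      · exfalso
        have h4 : t = s := by
          have := congrArg (fun a => s * a * s) h2
          simpa [conj_conj hs.1, hss] using this
        rw [h4, mul_cancel hs.1] at h
        omega
      · exact conj_conj hs.1 t
    · intro t ht
      have h := mem_Mid.1 ht
      split_ifs with hts
      · subst hts
        have e2 : t * g * t * (g * t) = t := by
          rw [show t * g * t * (g * t) = t * ((g * t) * (g * t)) by group, D.mul_self _ h.2.1,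
            mul_one]
        rw [e2, area_refl hs.1]
      · have e2 : s * g * s * (s * t * s) = s * (g * t) * s := by
          simp [mul_assoc, mul_cancel hs.1]
        rw [e2, hs.area_conj h.1.1 h.2.1 hts (hrs t ht)]
  · have hnz' := hs.n_mul hsz
    have honly : ∀ t ∈ D.Mid w z, t = s ∨ g * t = s := by
      intro t ht
      by_contra! hc
      have l1 := n_lt_of_step (hstep t ht hc.1)
      have l2 := n_lt_of_step (hstep' t ht hc.2)
      have := mem_Mid.1 ht
      omega
    by_cases hr : g * s ∈ D.T
    · have hgs : g * s ≠ s := by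
        intro e
        have e2 := hgy s hs.1
        rw [e, mul_cancel hs.1] at e2
        rw [e2] at hnz; omega
      have e1 : g * (s * (g * s) * s) = s := by
        rw [show g * (s * (g * s) * s) = ((g * s) * (g * s)) * s by group, D.mul_self _ hr,
            one_mul]
      have e2 : s * (g * s) * s * w = s * z := by
        simp [hg, mul_assoc, mul_cancel hs.1]
      have hne : s ≠ s * (g * s) * s := by
        intro e
        apply hgs
        have := congrArg (fun a => s * a * s) e
        simpa [conj_conj hs.1, hss] using this.symm
      have hM : D.Mid w z = {s, s * (g * s) * s} := by
        ext t
        rw [Finset.mem_insert, Finset.mem_singleton]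
        constructor
        · intro ht
          rcases honly t ht with h | h
          · exact Or.inl h
          · right
            apply mul_left_cancel (a := g)
            rw [e1, h]
        · rintro (rfl | rfl)
          · exact mem_Mid.2 ⟨⟨hs.1, by omega⟩, hr, by omega⟩
          · rw [mem_Mid, e1, e2]
            exact ⟨⟨D.conj s hs.1 _ hr, by omega⟩, hs.1, by omega⟩
      rw [hM, Finset.sum_pair hne, e1]
      simp only [area, hs.root_conj hr hgs, map_sub, map_smul, smul_eq_mul]
      ring
    · rw [Finset.sum_eq_zero]
      intro t ht
      exfalso
      have h := mem_Mid.1 ht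
      rcases honly t ht with rfl | h'
      · exact hr h.2.1
      · apply hr
        have : g = s * t := by
          have := congrArg (· * t) h'
          simpa [mul_assoc, D.mul_self t h.1.1] using this
        rw [this]
        exact D.conj s hs.1 t h.1.1

/-- The pairing with `p + X * q`. -/
def lin (D : ReflSys W V) (p q v : V) : ℝ[X] := C (D.b v p) + C (D.b v q) * X

lemma lin_add (p q u v : V) : D.lin p q (u + v) = D.lin p q u + D.lin p q v := by
  simp [lin]; ring

lemma lin_smul (p q : V) (c : ℝ) (v : V) : D.lin p q (c • v) = C c * D.lin p q v := by
  simp [lin]; ring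

lemma natDegree_lin {p q v : V} (h : D.b v q ≠ 0) : (D.lin p q v).natDegree = 1 := by
  rw [lin, add_comm]; exact natDegree_linear h

lemma leadingCoeff_lin {p q v : V} (h : D.b v q ≠ 0) :
    (D.lin p q v).leadingCoeff = D.b v q := by
  rw [lin, add_comm]; exact leadingCoeff_linear h

lemma lin_ne_zero {p q v : V} (h : D.b v q ≠ 0) : D.lin p q v ≠ 0 := by
  intro h0
  have := natDegree_lin (p := p) h
  rw [h0] at this; simp at this

open Classical in
/-- The equivariant multiplicities attached to the saturated chains from `x` to `w`, restricted
to a line. -/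
def mult (D : ReflSys W V) (p : V) (x w : W) : FractionRing ℝ[X] :=
  if w = x then 1 else
    (∑ t ∈ (D.Cov w).attach, algebraMap ℝ[X] _ (C (-D.pair t w)) * mult D p x (t * w)) /
      algebraMap ℝ[X] _ (D.lin p (D.ρ x D.v₀) (D.ρ x D.v₀ - D.ρ w D.v₀))
termination_by D.n w
decreasing_by
  have := (mem_Cov.1 t.2).2
  omega

variable {p : V} {x w : W}

lemma mult_self : D.mult p x x = 1 := by rw [mult, if_pos rfl]

lemma mult_of_ne (h : w ≠ x) : D.mult p x w =
    (∑ t ∈ D.Cov w, algebraMap ℝ[X] _ (C (-D.pair t w)) * D.mult p x (t * w)) /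
      algebraMap ℝ[X] _ (D.lin p (D.ρ x D.v₀) (D.ρ x D.v₀ - D.ρ w D.v₀)) := by
  rw [mult, if_neg h, Finset.sum_attach (D.Cov w)
    (fun t => algebraMap ℝ[X] _ (C (-D.pair t w)) * D.mult p x (t * w))]

lemma le_of_mem_Cov {t : W} (h : t ∈ D.Cov w) : D.Le (t * w) w :=
  (step_of_neg (mem_Cov.1 h).1 (pair_neg_of_mem_Cov h)).le

lemma le_of_mult_ne_zero (h : D.mult p x w ≠ 0) : D.Le x w := by
  induction hk : D.n w using Nat.strong_induction_on generalizing w with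
  | _ k ih =>
  by_cases hw : w = x
  · subst hw; exact Le.refl _
  rw [mult_of_ne hw] at h
  obtain ⟨t, ht, h1⟩ := Finset.exists_ne_zero_of_sum_ne_zero (div_ne_zero_iff.1 h).1
  have := (mem_Cov.1 ht).2
  exact (ih _ (by omega) (mul_ne_zero_iff.1 h1).2 rfl).trans (le_of_mem_Cov ht)

lemma b_sub_pos (h : w ≠ x) : 0 < D.b (D.ρ x D.v₀ - D.ρ w D.v₀) (D.ρ x D.v₀) := by
  have h1 : D.ρ x D.v₀ - D.ρ w D.v₀ ≠ 0 := fun h0 => h (D.orbit_inj _ _ (sub_eq_zero.1 h0)).symm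
  have h2 := D.b_pos _ h1
  simp only [map_sub, LinearMap.sub_apply, D.b_inv] at h2 ⊢
  rw [D.b_symm (D.ρ x D.v₀) (D.ρ w D.v₀)] at h2
  linarith

lemma lin_sub_ne_zero (h : w ≠ x) :
    D.lin p (D.ρ x D.v₀) (D.ρ x D.v₀ - D.ρ w D.v₀) ≠ 0 := lin_ne_zero (b_sub_pos h).ne'

lemma ρ_mul_sub {t : W} (ht : t ∈ D.T) (w : W) (v : V) :
    D.ρ (t * w) v - D.ρ w v = -D.b (D.α t) (D.ρ w v) • D.α t := by
  rw [ρ_mul, D.refl t ht, D.b_symm (D.α t)]; simp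

lemma sum_chain_eq_zero {F : Type*} [Field F] [Algebra ℝ F] (f : W → F) (w : W) (u v : V) :
    ∑ t ∈ D.Cov w, ∑ r ∈ D.Cov (t * w),
      algebraMap ℝ F (D.b (D.α t) (D.ρ w u) * D.b (D.α r) (D.ρ (t * w) v)
        - D.b (D.α t) (D.ρ w v) * D.b (D.α r) (D.ρ (t * w) u)) * f (r * (t * w)) = 0 := by
  classical
  rw [Finset.sum_sigma']
  rw [← Finset.sum_fiberwise_of_maps_to (t := (((D.Cov w).sigma fun t => D.Cov (t * w)).image
    fun a => a.2 * (a.1 * w))) (g := fun a => a.2 * (a.1 * w))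
    (fun a ha => Finset.mem_image_of_mem _ ha)]
  refine Finset.sum_eq_zero fun z _ => ?_
  have key := sum_area_eq_zero (D := D) w z (D.ρ z u) (D.ρ z v)
  have : (algebraMap ℝ F (∑ t ∈ D.Mid w z, D.area (D.ρ z u) (D.ρ z v) t (z * w⁻¹ * t))) * f z
      = 0 := by rw [key]; simp
  rw [← this, map_sum, Finset.sum_mul]
  refine Finset.sum_bij' (fun a _ => a.1) (fun t _ => ⟨t, z * w⁻¹ * t⟩) ?_ ?_ ?_ ?_ ?_
  · rintro ⟨t, r⟩ h
    simp only [Finset.mem_filter, Finset.mem_sigma] at h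
    obtain ⟨⟨h1, h2⟩, h3⟩ := h
    have : z * w⁻¹ * t = r := by
      rw [← h3]; simp [mul_assoc, D.mul_self t (mem_Cov.1 h1).1]
    simp only [Mid, Finset.mem_filter, this]
    exact ⟨h1, h2⟩
  · intro t h
    simp only [Mid, Finset.mem_filter] at h
    simp only [Finset.mem_filter, Finset.mem_sigma]
    refine ⟨h, ?_⟩
    simp [mul_assoc, mul_cancel (mem_Cov.1 h.1).1]
  · rintro ⟨t, r⟩ h
    simp only [Finset.mem_filter, Finset.mem_sigma] at h
    obtain ⟨⟨h1, h2⟩, h3⟩ := h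
    have : z * w⁻¹ * t = r := by
      rw [← h3]; simp [mul_assoc, D.mul_self t (mem_Cov.1 h1).1]
    simp only [this]
  · intro t h; rfl
  · rintro ⟨t, r⟩ h
    simp only [Finset.mem_filter, Finset.mem_sigma] at h
    obtain ⟨⟨h1, h2⟩, h3⟩ := h
    have e : z * w⁻¹ * t = r := by
      rw [← h3]; simp [mul_assoc, D.mul_self t (mem_Cov.1 h1).1]
    have ht := (mem_Cov.1 h1).1
    have hr := (mem_Cov.1 h2).1
    have e1 : ∀ v, D.ρ (t * w) v = D.ρ r (D.ρ z v) := fun v => by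
      rw [← ρ_mul, ← h3, mul_cancel hr]
    have e2 : ∀ v, D.ρ w v = D.ρ t (D.ρ r (D.ρ z v)) := fun v => by
      rw [← e1, ← ρ_mul, mul_cancel ht]
    simp only [e, h3, area]
    congr 2
    simp only [e1, e2, D.refl t ht, D.refl r hr, map_sub, map_smul, LinearMap.sub_apply,
      LinearMap.smul_apply, smul_eq_mul, D.norm t ht, D.norm r hr, D.b_symm (D.ρ z _) _,
      D.b_symm (D.α r) (D.α t)]
    ring

lemma lin_mul_mult (v : V) :
    algebraMap ℝ[X] (FractionRing ℝ[X]) (D.lin p (D.ρ x D.v₀) (D.ρ x v - D.ρ w v)) * D.mult p x w =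
      ∑ t ∈ D.Cov w, algebraMap ℝ[X] _ (C (-D.b (D.α t) (D.ρ w v))) * D.mult p x (t * w) := by
  induction hk : D.n w using Nat.strong_induction_on generalizing w v with
  | _ k ih =>
  by_cases hw : w = x
  · subst hw
    rw [Finset.sum_eq_zero]
    · simp [lin]
    · intro t ht
      rw [mul_eq_zero]
      right
      by_contra h
      have := (le_of_mult_ne_zero h).n_le
      have := (mem_Cov.1 ht).2
      omega
  have hne := lin_sub_ne_zero (D := D) (p := p) hw
  have hne' : algebraMap ℝ[X] (FractionRing ℝ[X])
      (D.lin p (D.ρ x D.v₀) (D.ρ x D.v₀ - D.ρ w D.v₀)) ≠ 0 := by simpa using hne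
  rw [mult_of_ne hw, ← mul_div_assoc, div_eq_iff hne', Finset.mul_sum, Finset.sum_mul,
    ← sub_eq_zero, ← Finset.sum_sub_distrib]
  have hsplit : ∀ t ∈ D.T, ∀ u, D.lin p (D.ρ x D.v₀) (D.ρ x u - D.ρ w u) =
      D.lin p (D.ρ x D.v₀) (D.ρ x u - D.ρ (t * w) u) +
      C (-D.b (D.α t) (D.ρ w u)) * D.lin p (D.ρ x D.v₀) (D.α t) := by
    intro t ht u
    rw [← lin_smul, ← ρ_mul_sub ht, ← lin_add]; congr 1; abel
  rw [← sum_chain_eq_zero (F := FractionRing ℝ[X]) (D.mult p x) w D.v₀ v]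
  refine Finset.sum_congr rfl fun t ht => ?_
  have hT := (mem_Cov.1 ht).1
  have hlt := (mem_Cov.1 ht).2
  have i1 := ih (D.n (t * w)) (by omega) v rfl
  have i2 := ih (D.n (t * w)) (by omega) D.v₀ rfl
  rw [hsplit t hT v, hsplit t hT D.v₀]
  have e : ∀ c : ℝ, algebraMap ℝ (FractionRing ℝ[X]) c = algebraMap ℝ[X] _ (C c) := fun c => by
    rw [IsScalarTower.algebraMap_apply ℝ ℝ[X] (FractionRing ℝ[X])]; rfl
  simp only [map_add, RingHom.map_mul, e, map_sub, sub_mul, Finset.sum_sub_distrib]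
  have j1 : ∑ r ∈ D.Cov (t * w), algebraMap ℝ[X] (FractionRing ℝ[X]) (C (D.b (D.α t) (D.ρ w D.v₀)))
      * algebraMap ℝ[X] _ (C (D.b (D.α r) (D.ρ (t * w) v))) * D.mult p x (r * (t * w))
      = algebraMap ℝ[X] _ (C (-D.pair t w)) * ∑ r ∈ D.Cov (t * w),
        algebraMap ℝ[X] _ (C (-D.b (D.α r) (D.ρ (t * w) v))) * D.mult p x (r * (t * w)) := by
    rw [Finset.mul_sum]
    refine Finset.sum_congr rfl fun r _ => ?_
    simp only [pair, map_neg]; ring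
  have j2 : ∑ r ∈ D.Cov (t * w), algebraMap ℝ[X] (FractionRing ℝ[X]) (C (D.b (D.α t) (D.ρ w v)))
      * algebraMap ℝ[X] _ (C (D.b (D.α r) (D.ρ (t * w) D.v₀))) * D.mult p x (r * (t * w))
      = algebraMap ℝ[X] _ (C (-D.b (D.α t) (D.ρ w v))) * ∑ r ∈ D.Cov (t * w),
        algebraMap ℝ[X] _ (C (-D.b (D.α r) (D.ρ (t * w) D.v₀))) * D.mult p x (r * (t * w)) := by
    rw [Finset.mul_sum]
    refine Finset.sum_congr rfl fun r _ => ?_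
    simp only [map_neg]; ring
  rw [j1, j2, ← i1, ← i2]
  simp only [pair]
  ring

open Classical in
/-- The reflections labelling the edges from `x` up to elements below `w`. -/
def Up (D : ReflSys W V) (x w : W) : Finset W :=
  D.T.filter fun t => 0 < D.pair t x ∧ D.Le (t * x) w

lemma mem_Up {x w t : W} : t ∈ D.Up x w ↔ t ∈ D.T ∧ 0 < D.pair t x ∧ D.Le (t * x) w := by
  simp [Up]

lemma Up_mono {x y w : W} (h : D.Le y w) : D.Up x y ⊆ D.Up x w := fun t ht => by
  rw [mem_Up] at ht ⊢; exact ⟨ht.1, ht.2.1, ht.2.2.trans h⟩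

lemma natDegree_prod_lin {p : V} {x w : W} {s : Finset W} (hs : s ⊆ D.Up x w) :
    (∏ t ∈ s, D.lin p (D.ρ x D.v₀) (D.α t)).natDegree = s.card ∧
    0 < (∏ t ∈ s, D.lin p (D.ρ x D.v₀) (D.α t)).leadingCoeff := by
  have h : ∀ t ∈ s, 0 < D.b (D.α t) (D.ρ x D.v₀) := fun t ht => (mem_Up.1 (hs ht)).2.1
  constructor
  · rw [natDegree_prod _ _ fun t ht => lin_ne_zero (h t ht).ne',
      Finset.sum_congr rfl fun t ht => natDegree_lin (h t ht).ne']
    simp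
  · rw [leadingCoeff_prod]
    exact Finset.prod_pos fun t ht => by rw [leadingCoeff_lin (h t ht).ne']; exact h t ht

lemma sum_natDegree_leadingCoeff {ι : Type*} {s : Finset ι} (hs : s.Nonempty) {f : ι → ℝ[X]}
    {d : ℕ} (hd : ∀ i ∈ s, (f i).natDegree = d) (hl : ∀ i ∈ s, 0 < (f i).leadingCoeff) :
    (∑ i ∈ s, f i).natDegree = d ∧ 0 < (∑ i ∈ s, f i).leadingCoeff := by
  have h1 : 0 < (∑ i ∈ s, f i).coeff d := by
    rw [finsetSum_coeff]
    exact Finset.sum_pos (fun i hi => by rw [← hd i hi]; exact hl i hi) hs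
  have h2 : (∑ i ∈ s, f i).natDegree = d :=
    le_antisymm (natDegree_sum_le_of_forall_le s f fun i hi => (hd i hi).le)
      (le_natDegree_of_ne_zero h1.ne')
  exact ⟨h2, by rw [leadingCoeff, h2]; exact h1⟩

lemma mult_pos {p : V} {x : W} (hp : ∀ w, D.Le x w → w ≠ x → w * x⁻¹ ∉ D.T →
      ∃ u, D.b (D.ρ x u - D.ρ w u) (D.ρ x D.v₀) = 0 ∧ D.b (D.ρ x u - D.ρ w u) p ≠ 0)
    {w : W} (hw : D.Le x w) :
    ∃ G : ℝ[X], algebraMap ℝ[X] (FractionRing ℝ[X]) G = D.mult p x w *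
        algebraMap ℝ[X] _ (∏ t ∈ D.Up x w, D.lin p (D.ρ x D.v₀) (D.α t)) ∧
      0 < G.leadingCoeff ∧ G.natDegree + D.n w = (D.Up x w).card + D.n x := by
  classical
  induction hk : D.n w using Nat.strong_induction_on generalizing w with
  | _ k ih =>
  by_cases hwx : w = x
  · subst hwx
    have : D.Up w w = ∅ := by
      refine Finset.eq_empty_of_forall_notMem fun t ht => ?_
      rw [mem_Up] at ht
      have := n_lt_of_step (step_of_pos ht.1 ht.2.1)
      have := ht.2.2.n_le
      omega
    exact ⟨1, by simp [this, mult_self], by simp, by simp [this, hk]⟩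
  set Y := (D.Cov w).filter fun t => D.Le x (t * w) with hY
  have hYne : Y.Nonempty := by
    obtain ⟨t, ht, h⟩ := exists_mem_Cov hw (Ne.symm hwx)
    exact ⟨t, Finset.mem_filter.2 ⟨ht, h⟩⟩
  have hG : ∀ t ∈ Y, ∃ G : ℝ[X], algebraMap ℝ[X] (FractionRing ℝ[X]) G = D.mult p x (t * w) *
        algebraMap ℝ[X] _ (∏ r ∈ D.Up x (t * w), D.lin p (D.ρ x D.v₀) (D.α r)) ∧
      0 < G.leadingCoeff ∧ G.natDegree + D.n (t * w) = (D.Up x (t * w)).card + D.n x := by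
    intro t ht
    rw [hY, Finset.mem_filter] at ht
    have := (mem_Cov.1 ht.1).2
    exact ih _ (by omega) ht.2 rfl
  choose! G hG1 hG2 hG3 using hG
  have hsub : ∀ t ∈ Y, D.Up x (t * w) ⊆ D.Up x w := fun t ht =>
    Up_mono (le_of_mem_Cov (Finset.mem_filter.1 ht).1)
  set R : W → ℝ[X] := fun t =>
    ∏ r ∈ D.Up x w \ D.Up x (t * w), D.lin p (D.ρ x D.v₀) (D.α r) with hR
  set H : V → ℝ[X] := fun v => ∑ t ∈ Y, C (-D.b (D.α t) (D.ρ w v)) * (G t * R t) with hH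
  have hHeq : ∀ v, algebraMap ℝ[X] (FractionRing ℝ[X])
      (D.lin p (D.ρ x D.v₀) (D.ρ x v - D.ρ w v)) * (D.mult p x w *
        algebraMap ℝ[X] _ (∏ t ∈ D.Up x w, D.lin p (D.ρ x D.v₀) (D.α t))) =
      algebraMap ℝ[X] _ (H v) := by
    intro v
    rw [← mul_assoc, lin_mul_mult, hH, map_sum, Finset.sum_mul, hY, Finset.sum_filter]
    refine Finset.sum_congr rfl fun t ht => ?_
    split_ifs with h
    · have htY : t ∈ Y := Finset.mem_filter.2 ⟨ht, h⟩
      rw [← Finset.prod_sdiff (hsub t htY), RingHom.map_mul, RingHom.map_mul, RingHom.map_mul,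
        hG1 t htY]
      ring
    · have : D.mult p x (t * w) = 0 := by
        by_contra h0
        exact h (le_of_mult_ne_zero h0)
      rw [this]; simp
  have hpos : ∀ t ∈ Y, 0 < -D.b (D.α t) (D.ρ w D.v₀) := fun t ht =>
    neg_pos.2 (pair_neg_of_mem_Cov (Finset.mem_filter.1 ht).1)
  obtain ⟨hHd, hHl⟩ : (H D.v₀).natDegree = (D.Up x w).card + D.n x + 1 - D.n w ∧
      0 < (H D.v₀).leadingCoeff := by
    refine sum_natDegree_leadingCoeff hYne (fun t ht => ?_) fun t ht => ?_
    · obtain ⟨d1, l1⟩ := natDegree_prod_lin (p := p) (Finset.sdiff_subset (s := D.Up x w)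
        (t := D.Up x (t * w)))
      have hg : G t ≠ 0 := leadingCoeff_ne_zero.1 (hG2 t ht).ne'
      rw [natDegree_C_mul (hpos t ht).ne', natDegree_mul hg (leadingCoeff_ne_zero.1 l1.ne')]
      have e := Finset.card_sdiff_add_card_eq_card (hsub t ht)
      have e3 := hG3 t ht
      have := (mem_Cov.1 (Finset.mem_filter.1 ht).1).2
      rw [d1]
      omega
    · obtain ⟨d1, l1⟩ := natDegree_prod_lin (p := p) (Finset.sdiff_subset (s := D.Up x w)
        (t := D.Up x (t * w)))
      rw [leadingCoeff_mul, leadingCoeff_mul, leadingCoeff_C]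
      exact mul_pos (hpos t ht) (mul_pos (hG2 t ht) l1)
  have hHn : (H D.v₀).natDegree + D.n w = (D.Up x w).card + D.n x + 1 := by
    obtain ⟨t, ht⟩ := hYne
    have e3 := hG3 t ht
    have e := Finset.card_le_card (hsub t ht)
    have := (mem_Cov.1 (Finset.mem_filter.1 ht).1).2
    omega
  have hb := b_sub_pos (D := D) hwx
  suffices hex : ∃ F : ℝ[X], algebraMap ℝ[X] (FractionRing ℝ[X]) F = D.mult p x w *
        algebraMap ℝ[X] _ (∏ t ∈ D.Up x w, D.lin p (D.ρ x D.v₀) (D.α t)) by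
    obtain ⟨F, hF⟩ := hex
    have hLF : D.lin p (D.ρ x D.v₀) (D.ρ x D.v₀ - D.ρ w D.v₀) * F = H D.v₀ := by
      apply IsFractionRing.injective ℝ[X] (FractionRing ℝ[X])
      rw [RingHom.map_mul, hF, hHeq]
    refine ⟨F, hF, ?_, ?_⟩
    · rw [← hLF, leadingCoeff_mul, leadingCoeff_lin hb.ne'] at hHl
      exact pos_of_mul_pos_right hHl hb.le
    · have hF0 : F ≠ 0 := by
        rintro rfl
        rw [mul_zero] at hLF
        rw [← hLF] at hHl; simp at hHl
      rw [← hLF, natDegree_mul (lin_ne_zero hb.ne') hF0, natDegree_lin hb.ne'] at hHn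
      omega
  by_cases hT : w * x⁻¹ ∈ D.T
  · set t := w * x⁻¹ with ht
    have htx : t * x = w := by simp [ht]
    have hup : 0 < D.pair t x := by
      rw [pair_pos_iff hT, htx]; exact hw.n_lt (Ne.symm hwx)
    have htU : t ∈ D.Up x w := mem_Up.2 ⟨hT, hup, by rw [htx]; exact Le.refl _⟩
    have hdvd : D.lin p (D.ρ x D.v₀) (D.α t) ∣ H D.v₀ := by
      refine Finset.dvd_sum fun r hr => Dvd.dvd.mul_left (Dvd.dvd.mul_left ?_ _) _
      refine Finset.dvd_prod_of_mem (fun r => D.lin p (D.ρ x D.v₀) (D.α r)) ?_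
      rw [Finset.mem_sdiff]
      refine ⟨htU, fun h => ?_⟩
      rw [mem_Up, htx] at h
      have := h.2.2.n_le
      have := (mem_Cov.1 (Finset.mem_filter.1 hr).1).2
      omega
    obtain ⟨Q, hQ⟩ := hdvd
    have hl : D.lin p (D.ρ x D.v₀) (D.ρ x D.v₀ - D.ρ w D.v₀) =
        C (D.pair t x) * D.lin p (D.ρ x D.v₀) (D.α t) := by
      rw [← lin_smul, ← htx, ρ_mul, D.refl t hT, pair, D.b_symm (D.α t), sub_sub_cancel]
    refine ⟨C (D.pair t x)⁻¹ * Q, ?_⟩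
    have h1 := hHeq D.v₀
    rw [hl, hQ, RingHom.map_mul, RingHom.map_mul] at h1
    have hne : algebraMap ℝ[X] (FractionRing ℝ[X]) (D.lin p (D.ρ x D.v₀) (D.α t)) ≠ 0 := by
      simpa using lin_ne_zero (p := p) (D := D) (v := D.α t) (q := D.ρ x D.v₀) hup.ne'
    have h2 : algebraMap ℝ[X] (FractionRing ℝ[X]) (C (D.pair t x)⁻¹) *
        algebraMap ℝ[X] (FractionRing ℝ[X]) (C (D.pair t x)) = 1 := by
      rw [← RingHom.map_mul, ← C_mul, inv_mul_cancel₀ hup.ne', C_1, map_one]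
    rw [RingHom.map_mul]
    apply mul_left_cancel₀ hne
    linear_combination -algebraMap ℝ[X] (FractionRing ℝ[X]) (C (D.pair t x)⁻¹) * h1 +
      algebraMap ℝ[X] (FractionRing ℝ[X]) (D.lin p (D.ρ x D.v₀) (D.α t)) * (D.mult p x w *
        algebraMap ℝ[X] _ (∏ t ∈ D.Up x w, D.lin p (D.ρ x D.v₀) (D.α t))) * h2
  · obtain ⟨u, hu1, hu2⟩ := hp w hw hwx hT
    refine ⟨C (D.b (D.ρ x u - D.ρ w u) p)⁻¹ * H u, ?_⟩
    rw [RingHom.map_mul, ← hHeq u, lin, hu1, C_0, zero_mul, add_zero, ← mul_assoc,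
      ← RingHom.map_mul, ← C_mul, inv_mul_cancel₀ hu2, C_1, map_one, one_mul]

lemma Le.mul_inv_mem {x w : W} (h : D.Le x w) : w * x⁻¹ ∈ Subgroup.closure (D.T : Set W) := by
  induction h with
  | refl => simp
  | tail _ hst ih =>
    obtain ⟨t, ht, -, rfl⟩ := hst
    rw [mul_assoc]
    exact mul_mem (Subgroup.subset_closure ht) ih

lemma exists_generic [Finite W] (D : ReflSys W V) (x : W) :
    ∃ p : V, ∀ w, D.Le x w → w ≠ x → w * x⁻¹ ∉ D.T →
      ∃ u, D.b (D.ρ x u - D.ρ w u) (D.ρ x D.v₀) = 0 ∧ D.b (D.ρ x u - D.ρ w u) p ≠ 0 := by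
  classical
  have := Fintype.ofFinite W
  set A : W → V →ₗ[ℝ] V := fun w => D.ρ x⁻¹ - D.ρ w⁻¹ with hA
  set q := D.ρ x D.v₀ with hq
  set S : W → Submodule ℝ V := fun w => (Submodule.span ℝ {A w q}).comap (A w) with hS
  set s : Finset W := Finset.univ.filter fun w => D.Le x w ∧ w ≠ x ∧ w * x⁻¹ ∉ D.T with hs
  have hadj : ∀ w u v, D.b (D.ρ x u - D.ρ w u) v = D.b u (A w v) := by
    intro w u v
    have h : ∀ g, D.b (D.ρ g u) v = D.b u (D.ρ g⁻¹ v) := fun g => by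
      rw [← D.b_inv g u, ← ρ_mul, mul_inv_cancel, map_one, Module.End.one_apply]
    simp [hA, h]
  have htop : ⊤ ∉ s.image S := by
    intro h
    obtain ⟨w, hw, hwS⟩ := Finset.mem_image.1 h
    rw [hs, Finset.mem_filter] at hw
    obtain ⟨-, h1, h2, h3⟩ := hw
    apply h3
    refine D.rank_one _ h1.mul_inv_mem (D.ρ w (A w q)) (fun h => h2 (mul_inv_eq_one.1 h)) ?_
    intro v
    have hv : v ∈ S w := hwS ▸ Submodule.mem_top
    rw [hS, Submodule.mem_comap, Submodule.mem_span_singleton] at hv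
    obtain ⟨c, hc⟩ := hv
    refine ⟨c, ?_⟩
    have hA' : A w v = D.ρ x⁻¹ v - D.ρ w⁻¹ v := rfl
    rw [← map_smul, hc, hA', map_sub, ← ρ_mul, ← ρ_mul]
    simp
  have hne := Subspace.biUnion_ne_univ_of_top_notMem htop
  rw [Set.ne_univ_iff_exists_notMem] at hne
  obtain ⟨p, hp⟩ := hne
  refine ⟨p, fun w h1 h2 h3 => ?_⟩
  have hpw : A w p ∉ Submodule.span ℝ {A w q} := by
    intro h
    apply hp
    rw [Set.mem_iUnion₂]
    exact ⟨S w, Finset.mem_image_of_mem _ (Finset.mem_filter.2 ⟨Finset.mem_univ _, h1, h2, h3⟩), h⟩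
  simp only [hadj]
  set a := A w p with ha
  set c := A w q with hc
  by_cases hc0 : c = 0
  · refine ⟨a, by simp [hc0], ?_⟩
    refine (D.b_pos a fun h => hpw ?_).ne'
    rw [h]; exact zero_mem _
  · have hcc := D.b_pos c hc0
    set v := a - (D.b a c / D.b c c) • c with hv
    have hvc : D.b v c = 0 := by
      simp [hv, div_mul_cancel₀ _ hcc.ne']
    refine ⟨v, hvc, ?_⟩
    have hva : a = v + (D.b a c / D.b c c) • c := by rw [hv]; abel
    have : D.b v a = D.b v v := by
      rw [hva, map_add, map_smul, hvc]; simp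
    rw [this]
    refine (D.b_pos v fun h => hpw ?_).ne'
    rw [hva, h, zero_add]
    exact Submodule.smul_mem _ _ (Submodule.mem_span_singleton_self c)

open Classical in
/-- The reflections joining `x` to elements below `w`. -/
def Nbr (D : ReflSys W V) (x w : W) : Finset W := D.T.filter fun t => D.Le (t * x) w

lemma mem_Nbr {x w t : W} : t ∈ D.Nbr x w ↔ t ∈ D.T ∧ D.Le (t * x) w := by simp [Nbr]

/-- Deodhar's inequality. -/
theorem n_le_card_Nbr [Finite W] {x w : W} (h : D.Le x w) : D.n w ≤ (D.Nbr x w).card := by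
  classical
  obtain ⟨p, hp⟩ := exists_generic D x
  obtain ⟨G, -, -, hG⟩ := mult_pos hp h
  have hd : Disjoint (D.Up x w) (D.N x) := by
    rw [Finset.disjoint_left]
    intro t h1 h2
    exact absurd (mem_N.1 h2).2 (not_lt.2 (mem_Up.1 h1).2.1.le)
  have hsub : D.Up x w ∪ D.N x ⊆ D.Nbr x w := by
    intro t ht
    rw [mem_Nbr]
    rcases Finset.mem_union.1 ht with ht | ht
    · rw [mem_Up] at ht; exact ⟨ht.1, ht.2.2⟩
    · rw [mem_N] at ht; exact ⟨ht.1, (step_of_neg ht.1 ht.2).le.trans h⟩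
  have := Finset.card_le_card hsub
  rw [Finset.card_union_of_disjoint hd] at this
  rw [n] at hG ⊢
  rw [n] at hG
  omega

lemma ρ_sub_mem {g : W} {s : Set W} (hs : s ⊆ D.T) {U : Submodule ℝ V} (hU : ∀ t ∈ s, D.α t ∈ U)
    (hg : g ∈ Subgroup.closure s) (v : V) : D.ρ g v - v ∈ U := by
  induction hg using Subgroup.closure_induction generalizing v with
  | mem t ht =>
    rw [D.refl t (hs ht), sub_sub_cancel_left]
    exact neg_mem (Submodule.smul_mem _ _ (hU t ht))
  | one => simp
  | mul g h _ _ i j =>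
    have := add_mem (i (D.ρ h v)) (j v)
    rwa [sub_add_sub_cancel, ← ρ_mul] at this
  | inv g _ i =>
    have := neg_mem (i (D.ρ g⁻¹ v))
    rwa [← ρ_mul, mul_inv_cancel, map_one, Module.End.one_apply, neg_sub] at this

open Classical in
/-- The subsystem of the reflections whose root lies in a given subspace. -/
def restrict (D : ReflSys W V) (U : Submodule ℝ V) : ReflSys W V where
  ρ := D.ρ
  b := D.b
  T := D.T.filter fun t => D.α t ∈ U
  α := D.α
  v₀ := D.v₀
  b_symm := D.b_symm
  b_pos := D.b_pos
  b_inv := D.b_inv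
  mul_self t ht := D.mul_self t (Finset.mem_filter.1 ht).1
  refl t ht := D.refl t (Finset.mem_filter.1 ht).1
  norm t ht := D.norm t (Finset.mem_filter.1 ht).1
  root_pos t ht := D.root_pos t (Finset.mem_filter.1 ht).1
  conj r hr t ht := by
    rw [Finset.mem_filter] at hr ht ⊢
    have hc := D.conj r hr.1 t ht.1
    refine ⟨hc, ?_⟩
    have h : D.ρ r (D.α t) ∈ U := by
      rw [D.refl r hr.1]
      exact sub_mem ht.2 (Submodule.smul_mem _ _ hr.2)
    rcases ρ_root_eq_or_neg ht.1 hc (g := r) (by rw [inv_eq hr.1]) with h1 | h1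
    · rwa [h1] at h
    · rw [h1] at h; exact neg_mem_iff.1 h
  pair_ne t ht := D.pair_ne t (Finset.mem_filter.1 ht).1
  orbit_inj := D.orbit_inj
  rank_one g hg a hne h := by
    have hsub : ((D.T.filter fun t => D.α t ∈ U : Finset W) : Set W) ⊆ D.T :=
      Finset.coe_subset.2 (Finset.filter_subset _ _)
    have hT := D.rank_one g (Subgroup.closure_mono hsub hg) a hne h
    rw [Finset.mem_filter]
    refine ⟨hT, ?_⟩
    have := ρ_sub_mem (D := D) hsub (U := U) (fun t ht => (Finset.mem_filter.1 ht).2) hg (D.α g)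
    rw [ρ_root_self hT, ← neg_add', neg_mem_iff, ← two_smul ℝ] at this
    exact (Submodule.smul_mem_iff _ two_ne_zero).1 this

variable {U U' : Submodule ℝ V}

lemma mem_restrict {t : W} : t ∈ (D.restrict U).T ↔ t ∈ D.T ∧ D.α t ∈ U := by
  simp [restrict]

lemma pair_restrict (t x : W) : (D.restrict U).pair t x = D.pair t x := rfl

lemma step_of_restrict {x y : W} (h : (D.restrict U).Step x y) : D.Step x y := by
  obtain ⟨t, ht, hp, rfl⟩ := h
  exact ⟨t, (mem_restrict.1 ht).1, hp, rfl⟩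

lemma le_of_restrict {x y : W} (h : (D.restrict U).Le x y) : D.Le x y :=
  Relation.ReflTransGen.mono (fun _ _ => step_of_restrict) _ _ h

lemma root_eq_of_smul {r t : W} (hr : r ∈ D.T) (ht : t ∈ D.T) {c : ℝ} (h : D.α r = c • D.α t) :
    r = t := by
  have h1 := D.norm r hr
  have hc : 0 < c := by
    have := D.root_pos r hr
    rw [h] at this
    simp only [map_smul, LinearMap.smul_apply, smul_eq_mul] at this
    exact pos_of_mul_pos_left this (D.root_pos t ht).le
  rw [h] at h1
  simp only [map_smul, LinearMap.smul_apply, smul_eq_mul, D.norm t ht] at h1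
  have : c = 1 := by nlinarith
  rw [this, one_smul] at h
  exact root_inj hr ht h

/-- The span of two roots. -/
def plane (D : ReflSys W V) (t r : W) : Submodule ℝ V := Submodule.span ℝ {D.α t, D.α r}

lemma left_mem_plane (t r : W) : D.α t ∈ D.plane t r := Submodule.subset_span (by simp)

lemma right_mem_plane (t r : W) : D.α r ∈ D.plane t r := Submodule.subset_span (by simp)

lemma plane_le {t r : W} (ht : D.α t ∈ U) (hr : D.α r ∈ U) : D.plane t r ≤ U := by
  rw [plane, Submodule.span_le]
  rintro v (rfl | rfl) <;> assumption

lemma plane_comm (t r : W) : D.plane t r = D.plane r t := by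
  rw [plane, plane, Set.pair_comm]

lemma plane_eq {t r r' : W} (ht : t ∈ D.T) (hr' : r' ∈ D.T) (hne : r' ≠ t)
    (h : D.α r' ∈ D.plane t r) : D.plane t r' = D.plane t r := by
  refine le_antisymm (plane_le (left_mem_plane t r) h) (plane_le (left_mem_plane t r') ?_)
  obtain ⟨a, c, hac⟩ := Submodule.mem_span_pair.1 h
  have hc : c ≠ 0 := by
    rintro rfl
    rw [zero_smul, add_zero] at hac
    exact hne (root_eq_of_smul hr' ht hac.symm)
  have : D.α r = c⁻¹ • (D.α r' - a • D.α t) := by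
    rw [← hac, add_sub_cancel_left, smul_smul, inv_mul_cancel₀ hc, one_smul]
  rw [this]
  exact Submodule.smul_mem _ _ (sub_mem (right_mem_plane t r')
    (Submodule.smul_mem _ _ (left_mem_plane t r')))

open Classical in
/-- The planes through the root of `t` spanned by roots of a subspace. -/
def Planes (D : ReflSys W V) (U : Submodule ℝ V) (t : W) : Finset (Submodule ℝ V) :=
  ((D.restrict U).T.erase t).image (D.plane t)

open Classical in
lemma card_filter_eq {S : Finset W} (hS : S ⊆ D.T) {t : W} (htS : t ∈ S) (htU : D.α t ∈ U) :
    (S.filter fun r => D.α r ∈ U).card =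
      ∑ P ∈ D.Planes U t, ((S.filter fun r => D.α r ∈ P).erase t).card + 1 := by
  have h1 : t ∈ S.filter fun r => D.α r ∈ U := Finset.mem_filter.2 ⟨htS, htU⟩
  rw [← Finset.card_erase_add_one h1]
  congr 1
  have hmaps : ∀ r ∈ (S.filter fun r => D.α r ∈ U).erase t, D.plane t r ∈ D.Planes U t := by
    intro r hr
    rw [Finset.mem_erase, Finset.mem_filter] at hr
    exact Finset.mem_image_of_mem _
      (Finset.mem_erase.2 ⟨hr.1, mem_restrict.2 ⟨hS hr.2.1, hr.2.2⟩⟩)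
  rw [Finset.card_eq_sum_card_fiberwise hmaps]
  refine Finset.sum_congr rfl fun P hP => ?_
  obtain ⟨r₀, hr₀, rfl⟩ := Finset.mem_image.1 hP
  rw [Finset.mem_erase, mem_restrict] at hr₀
  congr 1
  ext r
  simp only [Finset.mem_filter, Finset.mem_erase]
  constructor
  · rintro ⟨⟨h1, h2, h3⟩, h4⟩
    exact ⟨h1, h2, h4 ▸ right_mem_plane t r⟩
  · rintro ⟨h1, h2, h3⟩
    exact ⟨⟨h1, h2, plane_le htU hr₀.2.2 h3⟩, plane_eq (hS htS) (hS h2) h1 h3⟩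

lemma mem_Planes_top {t a c : W} (ht : t ∈ D.T) (ha : a ∈ D.T) (hc : c ∈ D.T) (hac : a ≠ c)
    (h : D.α t ∈ D.plane a c) : D.plane a c ∈ D.Planes ⊤ t := by
  classical
  rw [Planes, Finset.mem_image]
  by_cases hta : t = a
  · subst hta
    exact ⟨c, Finset.mem_erase.2 ⟨hac.symm, mem_restrict.2 ⟨hc, trivial⟩⟩, rfl⟩
  · refine ⟨a, Finset.mem_erase.2 ⟨Ne.symm hta, mem_restrict.2 ⟨ha, trivial⟩⟩, ?_⟩
    rw [plane_comm, plane_eq ha ht hta h]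

open Classical in
/-- The number of edges at `x` in the interval below `w` with root in `U`. -/
def deg (D : ReflSys W V) (U : Submodule ℝ V) (x w : W) : ℕ :=
  ((D.Nbr x w).filter fun t => D.α t ∈ U).card

lemma Nbr_subset (x w : W) : D.Nbr x w ⊆ D.T := fun _ h => (mem_Nbr.1 h).1

lemma Nbr_restrict_subset [DecidablePred fun t => D.α t ∈ U] {x u w : W} (hu : D.Le u w) :
    (D.restrict U).Nbr x u ⊆ (D.Nbr x w).filter fun t => D.α t ∈ U := fun t ht => by
  rw [mem_Nbr, mem_restrict] at ht
  exact Finset.mem_filter.2 ⟨mem_Nbr.2 ⟨ht.1.1, (le_of_restrict ht.2).trans hu⟩, ht.1.2⟩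

lemma n_restrict_le_deg [Finite W] {x u w : W} (h : (D.restrict U).Le x u) (hu : D.Le u w) :
    (D.restrict U).n u ≤ D.deg U x w := by
  classical
  exact (n_le_card_Nbr h).trans (Finset.card_le_card (Nbr_restrict_subset hu))

lemma mem_Nbr_restrict_of_deg_le [Finite W] {x u w : W} (h : (D.restrict U).Le x u)
    (hu : D.Le u w) (hd : D.deg U x w ≤ (D.restrict U).n u) {t : W} (ht : t ∈ D.T)
    (htU : D.α t ∈ U) (htx : D.Le (t * x) w) : (D.restrict U).Le (t * x) u := by
  classical
  have := Finset.eq_of_subset_of_card_le (Nbr_restrict_subset (D := D) (U := U) (x := x) hu)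
    (hd.trans (n_le_card_Nbr h))
  have h2 : t ∈ (D.Nbr x w).filter fun t => D.α t ∈ U :=
    Finset.mem_filter.2 ⟨mem_Nbr.2 ⟨ht, htx⟩, htU⟩
  rw [← this] at h2
  exact (mem_Nbr.1 h2).2

/-- The order ideal below `w` meets the cosets of the subsystem of `U` above `x` in intervals,
with a regular Bruhat graph at `x`. -/
def Good (D : ReflSys W V) (w : W) (U : Submodule ℝ V) (x : W) : Prop :=
  ∃ u, (D.restrict U).Le x u ∧ D.Le u w ∧ D.deg U x w = (D.restrict U).n u ∧
    ∀ u', (D.restrict U).Le x u' → D.Le u' w → (D.restrict U).Le u' u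

lemma good_of_forall {w x : W} (hx : D.Le x w)
    (h : ∀ t ∈ D.T, D.α t ∈ U → 0 < D.pair t x → ¬ D.Le (t * x) w) : D.Good w U x := by
  classical
  refine ⟨x, Le.refl x, hx, ?_, fun u' h1 h2 => ?_⟩
  · rw [deg, n]
    congr 1
    ext t
    rw [Finset.mem_filter, mem_Nbr, mem_N, mem_restrict, pair_restrict]
    constructor
    · rintro ⟨⟨h1, h2⟩, h3⟩
      exact ⟨⟨h1, h3⟩, (pair_neg_or_pos h1 x).resolve_right fun h4 => h t h1 h3 h4 h2⟩
    · rintro ⟨⟨h1, h3⟩, h4⟩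
      exact ⟨⟨h1, (step_of_neg h1 h4).le.trans hx⟩, h3⟩
  · rcases Relation.ReflTransGen.cases_head h1 with h3 | ⟨y, ⟨t, ht, hp, rfl⟩, h3⟩
    · rw [h3]; exact Le.refl _
    · rw [mem_restrict] at ht
      exact absurd ((le_of_restrict h3).trans h2) (h t ht.1 ht.2 hp)

lemma deg_eq_erase {x w t : W} [DecidablePred fun t => D.α t ∈ U] [DecidableEq W]
    (ht : t ∈ D.Nbr x w) (htU : D.α t ∈ U) :
    (((D.Nbr x w).filter fun r => D.α r ∈ U).erase t).card + 1 = D.deg U x w := by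
  rw [Finset.card_erase_add_one (Finset.mem_filter.2 ⟨ht, htU⟩), deg]
  congr

lemma mem_Planes {t : W} {P : Submodule ℝ V} : P ∈ D.Planes U t ↔
    ∃ r ∈ D.T, r ≠ t ∧ D.α r ∈ U ∧ P = D.plane t r := by
  classical
  rw [Planes, Finset.mem_image]
  constructor
  · rintro ⟨r, hr, rfl⟩
    rw [Finset.mem_erase, mem_restrict] at hr
    exact ⟨r, hr.2.1, hr.1, hr.2.2, rfl⟩
  · rintro ⟨r, h1, h2, h3, rfl⟩
    exact ⟨r, Finset.mem_erase.2 ⟨h2, mem_restrict.2 ⟨h1, h3⟩⟩, rfl⟩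

lemma good_plane [Finite W] {w : W} (hreg : ∀ x, D.Le x w → (D.Nbr x w).card = D.n w) {x : W}
    (hx : D.Le x w) {a c : W} (ha : a ∈ D.T) (hc : c ∈ D.T) (hac : a ≠ c) :
    D.Good w (D.plane a c) x := by
  classical
  induction hk : D.n w - D.n x using Nat.strong_induction_on generalizing x a c with
  | _ k ih =>
  set P := D.plane a c with hP
  have ih' : ∀ t ∈ D.T, 0 < D.pair t x → D.Le (t * x) w → ∀ a ∈ D.T, ∀ c ∈ D.T, a ≠ c →
      D.Good w (D.plane a c) (t * x) := by
    intro t ht hp hle a ha c hc hac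
    have := n_lt_of_step (step_of_pos ht hp)
    have := hle.n_le
    exact ih _ (by omega) hle ha hc hac rfl
  by_cases hex : ∃ t ∈ D.T, D.α t ∈ P ∧ 0 < D.pair t x ∧ D.Le (t * x) w
  swap
  · push Not at hex
    exact good_of_forall hx hex
  obtain ⟨t, ht, htP, hp, hle⟩ := hex
  set y := t * x with hy
  have htx : t ∈ D.Nbr x w := mem_Nbr.2 ⟨ht, hle⟩
  have hty : t ∈ D.Nbr y w := mem_Nbr.2 ⟨ht, by rw [hy, mul_cancel ht]; exact hx⟩
  have hstep : ∀ Q : Submodule ℝ V, D.α t ∈ Q → (D.restrict Q).Step x y := fun Q hQ =>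
    step_of_pos (D := D.restrict Q) (mem_restrict.2 ⟨ht, hQ⟩) hp
  have hle' : ∀ Q ∈ D.Planes ⊤ t, D.deg Q y w ≤ D.deg Q x w := by
    intro Q hQ
    obtain ⟨r, hr, hrt, -, rfl⟩ := mem_Planes.1 hQ
    obtain ⟨u, h1, h2, h3, -⟩ := ih' t ht hp hle t ht r hr hrt.symm
    rw [h3]
    exact n_restrict_le_deg ((hstep _ (left_mem_plane t r)).le.trans h1) h2
  have hsum : ∀ z, D.Le z w → t ∈ D.Nbr z w →
      ∑ Q ∈ D.Planes ⊤ t, (((D.Nbr z w).filter fun r => D.α r ∈ Q).erase t).card + 1 = D.n w := by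
    intro z hz htz
    rw [← card_filter_eq (Nbr_subset z w) htz (U := ⊤) trivial, ← hreg z hz]
    simp
  have heq : ∀ Q ∈ D.Planes ⊤ t, D.deg Q y w = D.deg Q x w := by
    have he : ∀ z, t ∈ D.Nbr z w → ∀ Q ∈ D.Planes ⊤ t,
        (((D.Nbr z w).filter fun r => D.α r ∈ Q).erase t).card + 1 = D.deg Q z w := by
      intro z hz Q hQ
      obtain ⟨r, hr, hrt, -, rfl⟩ := mem_Planes.1 hQ
      exact deg_eq_erase hz (left_mem_plane t r)
    have h1 := (Finset.sum_eq_sum_iff_of_le (s := D.Planes ⊤ t)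
      (f := fun Q => (((D.Nbr y w).filter fun r => D.α r ∈ Q).erase t).card)
      (g := fun Q => (((D.Nbr x w).filter fun r => D.α r ∈ Q).erase t).card) (fun Q hQ => by
        have := hle' Q hQ
        have := he x htx Q hQ
        have := he y hty Q hQ
        omega)).1 (by have := hsum x hx htx; have := hsum y hle hty; omega)
    intro Q hQ
    have := h1 Q hQ
    rw [← he x htx Q hQ, ← he y hty Q hQ, this]
  obtain ⟨u, h1, h2, h3, h4⟩ := ih' t ht hp hle a ha c hc hac
  have hxu := (hstep P htP).le.trans h1
  have hdeg : D.deg P x w = (D.restrict P).n u := by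
    rw [← heq P (mem_Planes_top ht ha hc hac htP), h3]
  refine ⟨u, hxu, h2, hdeg, fun u' g1 g2 => ?_⟩
  rcases Relation.ReflTransGen.cases_head g1 with g3 | ⟨z, ⟨r, hr, hrp, rfl⟩, g3⟩
  · rw [← g3]; exact hxu
  · rw [mem_restrict] at hr
    have hzw := (le_of_restrict g3).trans g2
    have hzu := mem_Nbr_restrict_of_deg_le hxu h2 hdeg.le hr.1 hr.2 hzw
    obtain ⟨u₂, k1, k2, -, k4⟩ := ih' r hr.1 hrp hzw a ha c hc hac
    exact (k4 u' g3 g2).trans (h4 u₂ (h1.trans (k4 u hzu h2)) k2)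

lemma deg_eq_of_edge [Finite W] {w : W} (hreg : ∀ x, D.Le x w → (D.Nbr x w).card = D.n w)
    {t x : W} (ht : t ∈ D.T) (hp : 0 < D.pair t x) (hle : D.Le (t * x) w) (htU : D.α t ∈ U) :
    D.deg U x w = D.deg U (t * x) w := by
  classical
  have hx := (step_of_pos ht hp).le.trans hle
  have htx : t ∈ D.Nbr x w := mem_Nbr.2 ⟨ht, hle⟩
  have hty : t ∈ D.Nbr (t * x) w := mem_Nbr.2 ⟨ht, by rwa [mul_cancel ht]⟩
  have e : ∀ z, t ∈ D.Nbr z w → D.deg U z w = _ := fun z hz =>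
    card_filter_eq (Nbr_subset z w) hz htU
  rw [e x htx, e _ hty]
  congr 1
  refine Finset.sum_congr rfl fun P hP => ?_
  obtain ⟨r, hr, hrt, -, rfl⟩ := mem_Planes.1 hP
  have hstep : (D.restrict (D.plane t r)).Step x (t * x) :=
    step_of_pos (D := D.restrict _) (mem_restrict.2 ⟨ht, left_mem_plane t r⟩) hp
  obtain ⟨u, h1, h2, h3, h4⟩ := good_plane hreg hx ht hr hrt.symm
  obtain ⟨u', k1, k2, k3, k4⟩ := good_plane hreg hle ht hr hrt.symm
  have : u = u' := Le.antisymm (k4 u (h4 _ hstep.le hle) h2) (h4 u' (hstep.le.trans k1) k2)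
  have e1 := deg_eq_erase htx (left_mem_plane (D := D) t r)
  have e2 := deg_eq_erase hty (left_mem_plane (D := D) t r)
  rw [h3, this, ← k3] at e1
  omega

lemma deg_eq_of_le [Finite W] {w : W} (hreg : ∀ x, D.Le x w → (D.Nbr x w).card = D.n w)
    {x : W} (hx : (D.restrict U).Le x w) : D.deg U x w = (D.restrict U).n w := by
  classical
  induction hx using Relation.ReflTransGen.head_induction_on with
  | refl =>
    rw [deg, n]
    congr 1
    ext t
    rw [Finset.mem_filter, mem_Nbr, mem_N, mem_restrict, pair_restrict]
    constructor
    · rintro ⟨⟨h1, h2⟩, h3⟩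
      refine ⟨⟨h1, h3⟩, (pair_neg_or_pos h1 w).resolve_right fun h4 => ?_⟩
      have := n_lt_of_step (step_of_pos h1 h4)
      have := h2.n_le
      omega
    · rintro ⟨⟨h1, h3⟩, h4⟩
      exact ⟨⟨h1, (step_of_neg h1 h4).le⟩, h3⟩
  | head hst h ih =>
    obtain ⟨t, ht, hp, rfl⟩ := hst
    rw [mem_restrict] at ht
    rw [deg_eq_of_edge hreg ht.1 hp (le_of_restrict h) ht.2, ih]

lemma mem_closure_simple {t : W} (ht : t ∈ D.T) : t ∈ Subgroup.closure {s | D.Simple s} := by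
  classical
  by_contra hcon
  obtain ⟨m, hm, hmin⟩ := (D.T.filter fun t => t ∉ Subgroup.closure {s | D.Simple s})
    |>.exists_min_image (fun t => D.b (D.α t) D.v₀) ⟨t, Finset.mem_filter.2 ⟨ht, hcon⟩⟩
  rw [Finset.mem_filter] at hm
  have hmm : D.pair m m < 0 := by
    have := pair_mul_self hm.1 1
    rw [mul_one, pair_one] at this
    linarith [D.root_pos m hm.1]
  obtain ⟨s, hs, hsm⟩ := exists_simple (D := D) (w := m)
    (Finset.card_ne_zero_of_mem (mem_N.2 ⟨hm.1, hmm⟩))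
  have hsc : s ∈ Subgroup.closure {s | D.Simple s} := Subgroup.subset_closure hs
  have hne : m ≠ s := fun h => hm.2 (h ▸ hsc)
  have hk : 0 < D.b (D.α s) (D.α m) := by
    have := pair_mul hm.1 s 1
    rw [mul_one, pair_one, pair_one] at this
    by_contra h
    push Not at h
    nlinarith [D.root_pos m hm.1, D.root_pos s hs.1,
      mul_nonneg (neg_nonneg.2 h) (D.root_pos m hm.1).le]
  have hmem : s * m * s ∉ Subgroup.closure {s | D.Simple s} := by
    intro h
    apply hm.2
    rw [← conj_conj hs.1 m]
    exact mul_mem (mul_mem hsc h) hsc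
  have h1 := hmin _ (Finset.mem_filter.2 ⟨D.conj s hs.1 m hm.1, hmem⟩)
  rw [hs.root_conj hm.1 hne] at h1
  simp only [map_sub, map_smul, LinearMap.sub_apply, LinearMap.smul_apply, smul_eq_mul] at h1
  rw [D.b_symm (D.α m) (D.α s)] at h1
  nlinarith [mul_pos hk (D.root_pos s hs.1)]

lemma le_mul_of_n_eq_zero {m g : W} (hm : D.n m = 0) (hg : g ∈ Subgroup.closure (D.T : Set W)) :
    D.Le m (g * m) := by
  have hpos : ∀ s, D.Simple s → ∀ x, D.Le m x → D.Le m (s * x) := by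
    intro s hs x hx
    have : 0 < D.pair s m := (pair_neg_or_pos hs.1 m).resolve_left fun h =>
      Finset.card_ne_zero_of_mem (mem_N.2 ⟨hs.1, h⟩) hm
    exact hs.le_mul hx this
  have hle : Subgroup.closure (D.T : Set W) ≤ Subgroup.closure {s | D.Simple s} :=
    (Subgroup.closure_le _).2 fun t ht => mem_closure_simple ht
  replace hg := hle hg
  suffices ∀ x, D.Le m x → D.Le m (g * x) from this m (Le.refl m)
  induction hg using Subgroup.closure_induction'' with
  | mem s hs => exact hpos s hs
  | inv_mem s hs => rw [inv_eq hs.1]; exact hpos s hs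
  | one => simp
  | mul g h _ _ i j => intro x hx; rw [mul_assoc]; exact i (h * x) (j x hx)

lemma exists_min_le (D : ReflSys W V) (w : W) : ∃ m, D.n m = 0 ∧ D.Le m w := by
  induction hk : D.n w using Nat.strong_induction_on generalizing w with
  | _ k ih =>
  by_cases hw : D.n w = 0
  · exact ⟨w, hw, Le.refl w⟩
  · obtain ⟨s, hs, hsw⟩ := exists_simple hw
    have := hs.n_mul_of_neg hsw
    obtain ⟨m, h1, h2⟩ := ih _ (by omega) (s * w) rfl
    exact ⟨m, h1, h2.trans (step_of_neg hs.1 hsw).le⟩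

/-- Below a regular element, the Bruhat order restricted to a coset of a parabolic subgroup is
its intrinsic order. -/
theorem restrict_le_of_le [Finite W] {w : W}
    (hreg : ∀ x, D.Le x w → (D.Nbr x w).card = D.n w) {u : W} (hu : D.Le u w)
    (h : u * w⁻¹ ∈ Subgroup.closure ((D.restrict U).T : Set W)) : (D.restrict U).Le u w := by
  obtain ⟨m, hm, hmw⟩ := exists_min_le (D.restrict U) w
  obtain ⟨m', hm', hmu⟩ := exists_min_le (D.restrict U) u
  have hmm : m = m' := by
    have hg : m' * m⁻¹ ∈ Subgroup.closure ((D.restrict U).T : Set W) := by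
      have := mul_mem (mul_mem (inv_mem hmu.mul_inv_mem) h) hmw.mul_inv_mem
      convert this using 1
      group
    have h1 := le_mul_of_n_eq_zero hm hg
    have h2 := le_mul_of_n_eq_zero hm' (inv_mem hg)
    simp only [inv_mul_cancel_right, mul_inv_rev, inv_inv] at h1 h2
    exact Le.antisymm h1 h2
  subst hmm
  clear hm hm' h
  induction hmu using Relation.ReflTransGen.head_induction_on with
  | refl => exact hmw
  | head hst hxu ih =>
    obtain ⟨t, ht, hp, rfl⟩ := hst
    apply ih
    rw [mem_restrict] at ht
    exact mem_Nbr_restrict_of_deg_le hmw (Le.refl w) (deg_eq_of_le hreg hmw).le ht.1 ht.2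
      ((le_of_restrict hxu).trans hu)

/-- The moved space of a group element. -/
def Mov (D : ReflSys W V) (g : W) : Submodule ℝ V := LinearMap.range (D.ρ g - 1)

lemma mem_Mov {g : W} {v : V} : v ∈ D.Mov g ↔ ∃ x, D.ρ g x - x = v := by
  simp [Mov]

lemma mem_ker_sub_one {g : W} {v : V} : v ∈ LinearMap.ker (D.ρ g - 1) ↔ D.ρ g v = v := by
  simp [sub_eq_zero]

lemma b_eq_zero_of_mem_Mov {g : W} {a y : V} (ha : a ∈ D.Mov g) (hy : D.ρ g y = y) :
    D.b a y = 0 := by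
  obtain ⟨x, rfl⟩ := mem_Mov.1 ha
  rw [map_sub, LinearMap.sub_apply, sub_eq_zero]
  nth_rw 1 [← hy]
  exact D.b_inv g x y

lemma eq_of_forall_b {u v : V} (h : ∀ x, D.b u x = D.b v x) : u = v := by
  by_contra hne
  have := D.b_pos _ (sub_ne_zero.2 hne)
  have h2 := h (u - v)
  rw [map_sub D.b u v, LinearMap.sub_apply, h2, sub_self] at this
  exact lt_irrefl _ this

lemma b_ρ_left (g : W) (u v : V) : D.b (D.ρ g⁻¹ u) v = D.b u (D.ρ g v) := by
  rw [← D.b_inv g (D.ρ g⁻¹ u), ← ρ_mul, mul_inv_cancel, map_one, Module.End.one_apply]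

lemma mem_Mov_of_forall [FiniteDimensional ℝ V] {g : W} {a : V}
    (h : ∀ y, D.ρ g y = y → D.b a y = 0) : a ∈ D.Mov g := by
  have hrefl : LinearMap.BilinForm.IsRefl D.b := fun u v h => by rw [D.b_symm]; exact h
  have hnd : LinearMap.BilinForm.Nondegenerate D.b := by
    refine ⟨fun u hu => ?_, fun u hu => ?_⟩ <;> by_contra hne <;>
      exact (D.b_pos u hne).ne' (hu u)
  rw [← LinearMap.BilinForm.orthogonal_orthogonal hnd hrefl (D.Mov g)]
  rw [LinearMap.BilinForm.mem_orthogonal_iff]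
  intro y hy
  rw [LinearMap.BilinForm.mem_orthogonal_iff] at hy
  change D.b y a = 0
  rw [D.b_symm]
  refine h y ?_
  have h2 : D.ρ g⁻¹ y = y := by
    refine eq_of_forall_b (D := D) fun x => ?_
    have h3 : D.b (D.ρ g x - x) y = 0 := hy _ (mem_Mov.2 ⟨x, rfl⟩)
    rw [map_sub, LinearMap.sub_apply, sub_eq_zero, D.b_symm _ y, D.b_symm x y] at h3
    rw [b_ρ_left, h3]
  nth_rw 1 [← h2]
  rw [← ρ_mul, mul_inv_cancel, map_one, Module.End.one_apply]

lemma root_ne_zero {t : W} (ht : t ∈ D.T) : D.α t ≠ 0 := fun h => by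
  have := D.norm t ht
  rw [h] at this
  simp at this

lemma finrank_Mov_mul_lt [FiniteDimensional ℝ V] {t g : W} (ht : t ∈ D.T) (h : D.α t ∈ D.Mov g) :
    Module.finrank ℝ (D.Mov (t * g)) < Module.finrank ℝ (D.Mov g) := by
  have h1 := LinearMap.finrank_range_add_finrank_ker (D.ρ g - 1)
  have h2 := LinearMap.finrank_range_add_finrank_ker (D.ρ (t * g) - 1)
  have hlt : LinearMap.ker (D.ρ g - 1) < LinearMap.ker (D.ρ (t * g) - 1) := by
    rw [SetLike.lt_iff_le_and_exists]
    constructor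
    · intro y hy
      rw [mem_ker_sub_one] at hy ⊢
      rw [ρ_mul, hy, D.refl t ht, D.b_symm y, b_eq_zero_of_mem_Mov h hy, zero_smul, sub_zero]
    · obtain ⟨x, hx⟩ := mem_Mov.1 h
      have hgx : D.ρ g x = x + D.α t := by rw [← hx]; abel
      have h3 := D.b_inv g x x
      simp only [hgx, map_add, LinearMap.add_apply, D.norm t ht, D.b_symm (D.α t) x] at h3
      refine ⟨x, ?_, ?_⟩
      · rw [mem_ker_sub_one, ρ_mul, D.refl t ht, hgx, map_add, LinearMap.add_apply, D.norm t ht,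
          show D.b x (D.α t) + 2 = 1 by linarith, one_smul, add_sub_cancel_right]
      · rw [mem_ker_sub_one, hgx, add_eq_left]
        exact root_ne_zero ht
  have h3 := Submodule.finrank_lt_finrank_of_lt hlt
  rw [Mov, Mov]
  omega

lemma finrank_Mov_mul_le [FiniteDimensional ℝ V] {t g : W} (ht : t ∈ D.T) :
    Module.finrank ℝ (D.Mov (t * g)) ≤ Module.finrank ℝ (D.Mov g) + 1 := by
  have h1 : D.Mov (t * g) ≤ D.Mov g ⊔ Submodule.span ℝ {D.α t} := by
    intro v hv
    obtain ⟨x, rfl⟩ := mem_Mov.1 hv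
    rw [ρ_mul, D.refl t ht, sub_right_comm]
    exact sub_mem (Submodule.mem_sup_left (mem_Mov.2 ⟨x, rfl⟩))
      (Submodule.mem_sup_right (Submodule.smul_mem _ _ (Submodule.mem_span_singleton_self _)))
  have h2 := Submodule.finrank_mono h1
  have h3 := Submodule.finrank_add_le_finrank_add_finrank (D.Mov g) (Submodule.span ℝ {D.α t})
  rw [finrank_span_singleton (root_ne_zero ht)] at h3
  exact h2.trans h3

lemma finrank_Mov_prod_le [FiniteDimensional ℝ V] {l : List W} (hl : ∀ t ∈ l, t ∈ D.T) :
    Module.finrank ℝ (D.Mov l.prod) ≤ l.length := by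
  induction l with
  | nil => rw [List.prod_nil, Mov, map_one, sub_self, LinearMap.range_zero, finrank_bot]; simp
  | cons t l ih =>
    rw [List.prod_cons, List.length_cons]
    exact (finrank_Mov_mul_le (hl t (by simp))).trans
      (Nat.add_le_add_right (ih fun s hs => hl s (by simp [hs])) 1)

lemma mem_closure_of_fix_dominant (hconj : ∀ g, ∀ t ∈ D.T, g * t * g⁻¹ ∈ D.T)
    (hone : ∀ g, D.n g = 0 → g = 1) {h : V} (hdom : ∀ t ∈ D.T, 0 ≤ D.b (D.α t) h) {g : W}
    (hg : D.ρ g h = h) : g ∈ Subgroup.closure {t | t ∈ D.T ∧ D.b (D.α t) h = 0} := by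
  induction hk : D.n g using Nat.strong_induction_on generalizing g with
  | _ k ih =>
  by_cases h0 : D.n g = 0
  · rw [hone g h0]; exact one_mem _
  obtain ⟨t, ht⟩ := Finset.card_ne_zero.1 h0
  rw [mem_N] at ht
  have htT := ht.1
  have hc := hconj g⁻¹ t htT
  have hb : D.b (D.α t) h = 0 := by
    refine le_antisymm ?_ (hdom t htT)
    have e1 : D.b (D.ρ g⁻¹ (D.α t)) h = D.b (D.α t) h := by rw [b_ρ_left, hg]
    have e2 : D.b (D.ρ g⁻¹ (D.α t)) D.v₀ < 0 := by rw [b_ρ_left]; exact ht.2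
    rcases ρ_root_eq_or_neg htT hc rfl with h1 | h1
    · rw [h1] at e2
      exact absurd e2 (D.root_pos _ hc).le.not_gt
    · rw [← e1, h1, map_neg, LinearMap.neg_apply, neg_nonpos]
      exact hdom _ hc
  have htc : t ∈ Subgroup.closure {t | t ∈ D.T ∧ D.b (D.α t) h = 0} :=
    Subgroup.subset_closure ⟨htT, hb⟩
  have hlt := n_lt_of_step (step_of_neg htT ht.2)
  have := ih _ (hk ▸ hlt) (g := t * g)
    (by rw [ρ_mul, hg, D.refl t htT, D.b_symm h, hb, zero_smul, sub_zero]) rfl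
  rw [← mul_cancel htT g]
  exact mul_mem htc this

/-- Steinberg's fixed point theorem. -/
lemma mem_closure_of_fix [Finite W] (hconj : ∀ g, ∀ t ∈ D.T, g * t * g⁻¹ ∈ D.T)
    (hone : ∀ g, D.n g = 0 → g = 1) {f : V} {g : W}
    (hg : D.ρ g f = f) : g ∈ Subgroup.closure {t | t ∈ D.T ∧ D.b (D.α t) f = 0} := by
  obtain ⟨z, hz⟩ := Finite.exists_max fun z => D.b (D.ρ z f) D.v₀
  have hdom : ∀ t ∈ D.T, 0 ≤ D.b (D.α t) (D.ρ z f) := by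
    intro t ht
    have h1 := hz (t * z)
    rw [ρ_mul, D.refl t ht, D.b_symm (D.ρ z f) (D.α t)] at h1
    simp only [map_sub, map_smul, LinearMap.sub_apply, LinearMap.smul_apply, smul_eq_mul] at h1
    by_contra hneg
    push Not at hneg
    nlinarith [mul_pos (neg_pos.2 hneg) (D.root_pos t ht)]
  have hfix : D.ρ (z * g * z⁻¹) (D.ρ z f) = D.ρ z f := by
    rw [← ρ_mul, inv_mul_cancel_right, ρ_mul, hg]
  have h1 := mem_closure_of_fix_dominant hconj hone hdom hfix
  have h2 : Subgroup.closure {t | t ∈ D.T ∧ D.b (D.α t) (D.ρ z f) = 0} ≤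
      (Subgroup.closure {t | t ∈ D.T ∧ D.b (D.α t) f = 0}).comap
        (MulAut.conj z⁻¹).toMonoidHom := by
    rw [Subgroup.closure_le]
    rintro t ⟨ht, hb⟩
    refine Subgroup.subset_closure ⟨hconj z⁻¹ t ht, ?_⟩
    have hc := hconj z⁻¹ t ht
    rw [← b_ρ_left] at hb
    rcases ρ_root_eq_or_neg ht hc rfl with h | h
    · rwa [h] at hb
    · rw [h, map_neg, LinearMap.neg_apply, neg_eq_zero] at hb; exact hb
  have h3 := h2 h1
  rw [Subgroup.mem_comap] at h3
  convert h3 using 1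
  simp [mul_assoc]

lemma mem_closure_restrict_Mov [Finite W] [FiniteDimensional ℝ V]
    (hconj : ∀ g, ∀ t ∈ D.T, g * t * g⁻¹ ∈ D.T)
    (hone : ∀ g, D.n g = 0 → g = 1) (g : W) :
    g ∈ Subgroup.closure ((D.restrict (D.Mov g)).T : Set W) := by
  classical
  set F := LinearMap.ker (D.ρ g - 1) with hF
  obtain ⟨f, hfF, hf⟩ : ∃ f ∈ F, ∀ t : {t // t ∈ D.T ∧ ∃ y ∈ F, D.b (D.α t) y ≠ 0},
      D.b (D.α t) f ≠ 0 := by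
    have := Module.Dual.exists_forall_mem_ne_zero_of_forall_exists F
      (f := fun t : {t // t ∈ D.T ∧ ∃ y ∈ F, D.b (D.α t) y ≠ 0} => D.b (D.α t))
      (fun t => t.2.2)
    obtain ⟨f, h1, h2⟩ := this
    exact ⟨f, h1, h2⟩
  have h1 := mem_closure_of_fix hconj hone (mem_ker_sub_one.1 hfF)
  refine Subgroup.closure_mono ?_ h1
  rintro t ⟨ht, htf⟩
  refine mem_restrict.2 ⟨ht, mem_Mov_of_forall fun y hy => ?_⟩
  by_contra hne
  exact hf ⟨t, ht, y, mem_ker_sub_one.2 hy, hne⟩ htf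

/-- Below a regular element, the directed distance in the Bruhat graph is at most the rank of the
moved space. -/
theorem exists_path [Finite W] [FiniteDimensional ℝ V]
    (hconj : ∀ g, ∀ t ∈ D.T, g * t * g⁻¹ ∈ D.T) (hone : ∀ g, D.n g = 0 → g = 1) {w : W}
    (hreg : ∀ x, D.Le x w → (D.Nbr x w).card = D.n w) {u : W} (hu : D.Le u w) :
    ∃ m ≤ Module.finrank ℝ (D.Mov (u * w⁻¹)), ∃ c : ℕ → W, c 0 = u ∧ c m = w ∧
      ∀ i < m, D.Step (c i) (c (i + 1)) := by
  induction hk : D.n w - D.n u using Nat.strong_induction_on generalizing u with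
  | _ k ih =>
  have h1 := restrict_le_of_le hreg hu (mem_closure_restrict_Mov hconj hone (u * w⁻¹))
  rcases Relation.ReflTransGen.cases_head h1 with h2 | ⟨y, hst, h2⟩
  · exact ⟨0, Nat.zero_le _, fun _ => u, rfl, h2, by simp⟩
  · have hst' := step_of_restrict hst
    obtain ⟨t, ht, hp, rfl⟩ := hst
    rw [mem_restrict] at ht
    have hyw := le_of_restrict h2
    have := n_lt_of_step hst'
    have := hyw.n_le
    obtain ⟨m, hm, c, hc0, hcm, hc⟩ := ih _ (by omega) hyw rfl
    have hlt := finrank_Mov_mul_lt ht.1 ht.2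
    rw [← mul_assoc] at hlt
    refine ⟨m + 1, by omega, fun i => Nat.casesOn i u c, rfl, hcm, fun i hi => ?_⟩
    cases i with
    | zero => simpa [hc0] using hst'
    | succ i => exact hc i (by omega)

lemma card_Nbr {x w : W} (hx : D.Le x w) : (D.Nbr x w).card = D.n x + (D.Up x w).card := by
  classical
  rw [n, ← Finset.card_union_of_disjoint]
  · congr 1
    ext t
    rw [Finset.mem_union, mem_Nbr, mem_N, mem_Up]
    constructor
    · rintro ⟨h1, h2⟩
      exact (pair_neg_or_pos h1 x).imp (fun h => ⟨h1, h⟩) fun h => ⟨h1, h, h2⟩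
    · rintro (⟨h1, h2⟩ | ⟨h1, -, h2⟩)
      · exact ⟨h1, (step_of_neg h1 h2).le.trans hx⟩
      · exact ⟨h1, h2⟩
  · rw [Finset.disjoint_left]
    intro t h1 h2
    exact (mem_N.1 h1).2.not_gt (mem_Up.1 h2).2.1

lemma sum_card_Up {w : W} {I : Finset W} (hI : ∀ x, x ∈ I ↔ D.Le x w) :
    ∑ x ∈ I, (D.Up x w).card = ∑ x ∈ I, D.n x := by
  classical
  simp only [n]
  rw [← Finset.card_sigma, ← Finset.card_sigma]
  refine Finset.card_nbij' (fun p => ⟨p.2 * p.1, p.2⟩) (fun p => ⟨p.2 * p.1, p.2⟩) ?_ ?_ ?_ ?_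
  · rintro ⟨x, t⟩ h
    simp only [Finset.coe_sigma, Set.mem_sigma_iff, Finset.mem_coe, mem_Up, hI, mem_N] at h ⊢
    exact ⟨h.2.2.2, h.2.1, by rw [pair_mul_self h.2.1]; linarith [h.2.2.1]⟩
  · rintro ⟨x, t⟩ h
    simp only [Finset.coe_sigma, Set.mem_sigma_iff, Finset.mem_coe, mem_Up, hI, mem_N] at h ⊢
    refine ⟨(step_of_neg h.2.1 h.2.2).le.trans h.1, h.2.1, ?_, ?_⟩
    · rw [pair_mul_self h.2.1]; linarith [h.2.2]
    · rw [mul_cancel h.2.1]; exact h.1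
  · rintro ⟨x, t⟩ h
    simp only [Finset.coe_sigma, Set.mem_sigma_iff, Finset.mem_coe, mem_Up] at h
    simp [mul_cancel h.2.1]
  · rintro ⟨x, t⟩ h
    simp only [Finset.coe_sigma, Set.mem_sigma_iff, Finset.mem_coe, mem_N] at h
    simp [mul_cancel h.2.1]

lemma card_Nbr_eq [Finite W] {w : W} {I : Finset W} (hI : ∀ x, x ∈ I ↔ D.Le x w)
    (hsum : 2 * ∑ x ∈ I, D.n x = ∑ _x ∈ I, D.n w) (x : W) (hx : D.Le x w) :
    (D.Nbr x w).card = D.n w := by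
  have h1 : ∑ x ∈ I, (D.Nbr x w).card = ∑ x ∈ I, D.n w := by
    rw [Finset.sum_congr rfl fun x hx => card_Nbr ((hI x).1 hx), Finset.sum_add_distrib,
      sum_card_Up hI, ← two_mul, hsum]
  exact ((Finset.sum_eq_sum_iff_of_le fun x hx => n_le_card_Nbr ((hI x).1 hx)).1 h1.symm x
    ((hI x).2 hx)).symm

end ReflSys

lemma two_mul_sum_eq_of_palindromic {ι : Type*} {I : Finset ι} {f : ι → ℕ} {N : ℕ}
    (hf : ∀ x ∈ I, f x ≤ N)
    (h : ∀ i ≤ N, (∑ x ∈ I, (X : ℤ[X]) ^ f x).coeff i =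
      (∑ x ∈ I, (X : ℤ[X]) ^ f x).coeff (N - i)) :
    2 * ∑ x ∈ I, f x = ∑ _x ∈ I, N := by
  set p := ∑ x ∈ I, (X : ℤ[X]) ^ f x with hp
  have hcoeff : ∀ i, p.coeff i = ∑ x ∈ I, if i = f x then 1 else 0 := by
    intro i
    simp [hp, Polynomial.coeff_X_pow]
  have key : ∀ g : ℕ → ℤ, ∑ x ∈ I, g (f x) = ∑ i ∈ Finset.range (N + 1), p.coeff i * g i := by
    intro g
    simp only [hcoeff, Finset.sum_mul]
    rw [Finset.sum_comm]
    refine Finset.sum_congr rfl fun x hx => ?_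
    simp [Nat.lt_succ_of_le (hf x hx)]
  have h1 : ∑ x ∈ I, (f x : ℤ) = ∑ x ∈ I, ((N - f x : ℕ) : ℤ) := by
    rw [key (fun i => (i : ℤ)), key (fun i => ((N - i : ℕ) : ℤ)), ← Finset.sum_range_reflect]
    refine Finset.sum_congr rfl fun i hi => ?_
    rw [Finset.mem_range] at hi
    rw [h i (by omega), Nat.add_sub_cancel]
  have h2 : ∑ x ∈ I, f x = ∑ x ∈ I, (N - f x) := by exact_mod_cast h1
  rw [two_mul]
  nth_rw 2 [h2]
  rw [← Finset.sum_add_distrib]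
  exact Finset.sum_congr rfl fun x hx => Nat.add_sub_cancel' (hf x hx)

section Realization

variable {B W V : Type*} [Group W] {M : CoxeterMatrix B} {cs : CoxeterSystem M W}
  [AddCommGroup V] [Module ℝ V] {D : ReflSys W V}

lemma step_iff (hT : ∀ t, t ∈ D.T ↔ cs.IsReflection t) (hn : ∀ x, D.n x = cs.length x) (x y : W) :
    D.Step x y ↔ cs.length x < cs.length y ∧ ∃ t, cs.IsReflection t ∧ y = t * x := by
  constructor
  · intro h
    have hlt := ReflSys.n_lt_of_step h
    obtain ⟨t, ht, -, rfl⟩ := h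
    exact ⟨by rwa [← hn, ← hn], t, (hT t).1 ht, rfl⟩
  · rintro ⟨hlt, t, ht, rfl⟩
    have ht := (hT t).2 ht
    refine ⟨t, ht, (ReflSys.pair_neg_or_pos ht x).resolve_left fun h => ?_, rfl⟩
    have := ReflSys.n_lt_of_step (ReflSys.step_of_neg ht h)
    rw [hn, hn] at this
    omega

lemma le_iff_bruhatLE (hT : ∀ t, t ∈ D.T ↔ cs.IsReflection t) (hn : ∀ x, D.n x = cs.length x)
    (x y : W) : D.Le x y ↔ bruhatLE cs x y := by
  rw [ReflSys.Le, bruhatLE, show D.Step = _ from funext₂ fun x y => propext (step_iff hT hn x y)]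

theorem hlss_of_realization [Finite W] [FiniteDimensional ℝ V]
    (hT : ∀ t, t ∈ D.T ↔ cs.IsReflection t) (hn : ∀ x, D.n x = cs.length x) {w : W}
    (hw : RatSmooth cs w) : HLSS cs w := by
  classical
  have hstep := step_iff hT hn
  have hle := le_iff_bruhatLE hT hn
  set I := (Set.toFinite {x | bruhatLE cs x w}).toFinset with hI
  have hI' : ∀ x, x ∈ I ↔ D.Le x w := fun x => by simp [hI, hle]
  have hpoin : poin cs w = ∑ x ∈ I, X ^ cs.length x := by
    rw [poin, finsum_mem_eq_finite_toFinset_sum]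
  have hreg := ReflSys.card_Nbr_eq hI' (by
    simp only [hn]
    refine two_mul_sum_eq_of_palindromic (fun x hx => ?_) ?_
    · rw [← hn, ← hn]; exact ((hI' x).1 hx).n_le
    · rw [← hpoin]; exact hw)
  have hconj : ∀ g, ∀ t ∈ D.T, g * t * g⁻¹ ∈ D.T := fun g t ht =>
    (hT _).2 (((hT t).1 ht).conj g)
  have hone : ∀ g, D.n g = 0 → g = 1 := fun g h => by
    rwa [hn, cs.length_eq_zero_iff] at h
  intro u hu
  obtain ⟨m, hm, c, hc0, hcm, hc⟩ := ReflSys.exists_path hconj hone hreg ((hle u w).2 hu)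
  have habs : ∀ k, ∀ c : ℕ → W, (∀ i < k, ∃ t, cs.IsReflection t ∧ c (i + 1) = t * c i) →
      ∃ g : Fin k → W, (∀ i, cs.IsReflection (g i)) ∧ c 0 * (c k)⁻¹ = (List.ofFn g).prod := by
    intro k c hc
    choose t ht hct using hc
    refine ⟨fun i => t i i.2, fun i => ht i i.2, ?_⟩
    clear_value I
    induction k with
    | zero => simp
    | succ k ih =>
      rw [List.ofFn_succ', List.concat_eq_append, List.prod_append, List.prod_singleton]
      have := ih (fun i hi => t i (by omega)) (fun i hi => ht i (by omega))
        (fun i hi => hct i (by omega))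
      simp only [Fin.val_castSucc, Fin.val_last] at this ⊢
      rw [← this, hct k (by omega), mul_inv_rev, (ht k (by omega)).inv, mul_assoc]
  have hpath : m ∈ {m | ∃ c : ℕ → W, c 0 = u ∧ c m = w ∧
      ∀ i < m, cs.length (c i) < cs.length (c (i + 1)) ∧
        ∃ t, cs.IsReflection t ∧ c (i + 1) = t * c i} :=
    ⟨c, hc0, hcm, fun i hi => (hstep _ _).1 (hc i hi)⟩
  have hmem : bgDist cs u w ∈ {m | ∃ g : Fin m → W, (∀ i, cs.IsReflection (g i)) ∧
      u * w⁻¹ = (List.ofFn g).prod} := by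
    obtain ⟨c, hc0, hcm, hc⟩ := Nat.sInf_mem ⟨m, hpath⟩
    have := habs _ c fun i hi => (hc i hi).2
    rwa [hc0, hcm] at this
  apply le_antisymm
  · obtain ⟨g, hg, hprod⟩ := Nat.sInf_mem ⟨_, hmem⟩
    have h1 := ReflSys.finrank_Mov_prod_le (D := D) (l := List.ofFn g) (by
      intro t ht
      obtain ⟨i, rfl⟩ := (List.mem_ofFn' _ _).1 ht
      exact (hT _).2 (hg i))
    rw [← hprod, List.length_ofFn] at h1
    exact (Nat.sInf_le hpath).trans (hm.trans h1)
  · exact Nat.sInf_le hmem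

end Realization

namespace Tits

variable {B W : Type*} [Group W] {M : CoxeterMatrix B}

/-- The coroot of a simple reflection in the geometric representation. -/
def coroot (M : CoxeterMatrix B) (i : B) : (B →₀ ℝ) →ₗ[ℝ] ℝ :=
  Finsupp.linearCombination ℝ fun j => -2 * Real.cos (Real.pi / M i j)

/-- The simple root. -/
abbrev e (i : B) : B →₀ ℝ := Finsupp.single i 1

lemma coroot_e (i j : B) : coroot M i (e j) = -2 * Real.cos (Real.pi / M i j) := by
  simp [coroot]

lemma coroot_e_self (i : B) : coroot M i (e i) = 2 := by
  rw [coroot_e, M.diagonal]; simp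

/-- The action of a simple reflection in the geometric representation. -/
def refl (M : CoxeterMatrix B) (i : B) : Module.End ℝ (B →₀ ℝ) :=
  LinearMap.id - (coroot M i).smulRight (e i)

lemma refl_apply (i : B) (v : B →₀ ℝ) : refl M i v = v - coroot M i v • e i := rfl

lemma refl_e_self (i : B) : refl M i (e i) = -e i := by
  rw [refl_apply, coroot_e_self, two_smul]; abel

lemma refl_refl (i : B) (v : B →₀ ℝ) : refl M i (refl M i v) = v := by
  nth_rw 2 [refl_apply]
  rw [map_sub, map_smul, refl_e_self, refl_apply, smul_neg]; abel

lemma refl_e_ne {i j : B} (x y : ℝ) :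
    refl M i (x • e j + y • e i) =
      x • e j + (2 * Real.cos (Real.pi / M i j) * x - y) • e i := by
  rw [map_add, map_smul, map_smul, refl_e_self, refl_apply, coroot_e]
  module

lemma refl_mul_refl_pow_plane (i j : B) (k : ℕ) (φ : ℝ) :
    ((refl M i * refl M j) ^ k) (Real.sin (φ + Real.pi / M i j) • e i + Real.sin φ • e j) =
      Real.sin (φ + 2 * k * (Real.pi / M i j) + Real.pi / M i j) • e i +
        Real.sin (φ + 2 * k * (Real.pi / M i j)) • e j := by
  set θ := Real.pi / M i j with hθ
  have h : ∀ ψ : ℝ, 2 * Real.cos θ * Real.sin (ψ + θ) - Real.sin ψ = Real.sin (ψ + 2 * θ) := by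
    intro ψ
    have h1 := Real.sin_add (ψ + θ) θ
    have h2 := Real.sin_sub (ψ + θ) θ
    rw [add_sub_cancel_right] at h2
    rw [show ψ + 2 * θ = ψ + θ + θ by ring, h1, h2]; ring
  induction k with
  | zero => simp
  | succ k ih =>
    set ψ := φ + 2 * k * θ with hψ
    have hj : refl M j (Real.sin (ψ + θ) • e i + Real.sin ψ • e j) =
        Real.sin (ψ + θ) • e i + Real.sin (ψ + 2 * θ) • e j := by
      rw [refl_e_ne, M.symmetric j i, ← hθ, h]
    have hi : refl M i (Real.sin (ψ + θ) • e i + Real.sin (ψ + 2 * θ) • e j) =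
        Real.sin (ψ + 2 * θ + θ) • e i + Real.sin (ψ + 2 * θ) • e j := by
      have h1 := h (ψ + θ)
      rw [show ψ + θ + θ = ψ + 2 * θ by ring, show ψ + θ + 2 * θ = ψ + 2 * θ + θ by ring] at h1
      rw [add_comm (_ • e i) (_ • e j), refl_e_ne, ← hθ, h1, add_comm]
    rw [pow_succ', Module.End.mul_apply, ih, Module.End.mul_apply, hj, hi,
      show φ + 2 * ((k + 1 : ℕ) : ℝ) * θ = ψ + 2 * θ by rw [hψ]; push_cast; ring]

lemma sin_pi_div_pos {m : ℕ} (hm : 2 ≤ m) : 0 < Real.sin (Real.pi / m) := by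
  have hm' : (2 : ℝ) ≤ m := by exact_mod_cast hm
  refine Real.sin_pos_of_pos_of_lt_pi (div_pos Real.pi_pos (by linarith)) ?_
  rw [div_lt_iff₀ (by linarith)]
  nlinarith [Real.pi_pos]

lemma liftable (M : CoxeterMatrix B) : M.IsLiftable (refl M) := by
  intro i j
  by_cases hij : i = j
  · subst hij
    rw [M.diagonal, pow_one]
    ext1 x
    exact LinearMap.ext fun v => by simp [refl_refl]
  by_cases h0 : M i j = 0
  · rw [h0, pow_zero]
  have hm : 2 ≤ M i j := by
    have := M.off_diagonal i j hij
    omega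
  have hm0 : (M i j : ℝ) ≠ 0 := by exact_mod_cast h0
  set θ := Real.pi / M i j with hθ
  have hs : Real.sin θ ≠ 0 := (sin_pi_div_pos hm).ne'
  have hp := refl_mul_refl_pow_plane (M := M) i j (M i j)
  rw [← hθ, show 2 * (M i j : ℝ) * θ = 2 * Real.pi by rw [hθ]; field_simp] at hp
  have hi : ((refl M i * refl M j) ^ M i j) (e i) = e i := by
    have h := hp 0
    simp only [zero_add, Real.sin_zero, zero_smul, add_zero, Real.sin_two_pi, map_smul] at h
    rw [add_comm, Real.sin_add_two_pi] at h
    exact smul_right_injective _ hs h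
  have hj : ((refl M i * refl M j) ^ M i j) (e j) = e j := by
    have h := hp (-θ)
    simp only [neg_add_cancel, Real.sin_zero, zero_smul, zero_add, Real.sin_add_two_pi, map_smul,
      show -θ + 2 * Real.pi + θ = 2 * Real.pi by ring, Real.sin_two_pi] at h
    exact smul_right_injective _ (by rwa [Real.sin_neg, neg_ne_zero]) h
  have hfix : ∀ v, coroot M i v = 0 → coroot M j v = 0 →
      ((refl M i * refl M j) ^ M i j) v = v := by
    intro v h1 h2
    have h3 : (refl M i * refl M j) v = v := by
      rw [Module.End.mul_apply, refl_apply j, h2, zero_smul, sub_zero, refl_apply, h1, zero_smul,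
        sub_zero]
    generalize M i j = k
    induction k with
    | zero => simp
    | succ k ih => rw [pow_succ, Module.End.mul_apply, h3, ih]
  refine LinearMap.ext fun v => ?_
  set c := Real.cos θ with hc
  have hcs : 1 - c ^ 2 ≠ 0 := by
    have := Real.sin_sq_add_cos_sq θ
    rw [show 1 - c ^ 2 = Real.sin θ ^ 2 by rw [hc]; linarith]
    exact pow_ne_zero 2 hs
  set a := (coroot M i v + c * coroot M j v) / (2 * (1 - c ^ 2)) with ha
  set b := (coroot M j v + c * coroot M i v) / (2 * (1 - c ^ 2)) with hb
  have hij' : coroot M i (e j) = -2 * c := by rw [coroot_e]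
  have hji' : coroot M j (e i) = -2 * c := by rw [coroot_e, M.symmetric]
  have h := hfix (v - a • e i - b • e j)
    (by
      simp only [map_sub, map_smul, coroot_e_self, hij', smul_eq_mul]
      rw [ha, hb]; field_simp; ring)
    (by
      simp only [map_sub, map_smul, coroot_e_self, hji', smul_eq_mul]
      rw [ha, hb]; field_simp; ring)
  rw [map_sub, map_sub, map_smul, map_smul, hi, hj] at h
  simpa using h

variable (cs : CoxeterSystem M W)

/-- The geometric representation. -/
def rep : W →* Module.End ℝ (B →₀ ℝ) := cs.lift ⟨refl M, liftable M⟩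

variable {cs}

lemma rep_simple (i : B) : rep cs (cs.simple i) = refl M i := cs.lift_apply_simple _ i

lemma rep_mul (g h : W) (v : B →₀ ℝ) : rep cs (g * h) v = rep cs g (rep cs h v) := by
  rw [map_mul, Module.End.mul_apply]

lemma rep_inv_rep (g : W) (v : B →₀ ℝ) : rep cs g⁻¹ (rep cs g v) = v := by
  rw [← rep_mul, inv_mul_cancel, map_one, Module.End.one_apply]

lemma rep_mul_simple_e (g : W) (i : B) : rep cs (g * cs.simple i) (e i) = -rep cs g (e i) := by
  rw [rep_mul, rep_simple, refl_e_self, map_neg]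

lemma simple_injective (cs : CoxeterSystem M W) : Function.Injective cs.simple := by
  intro i j h
  by_contra hne
  have h1 : refl M i (e i) = refl M j (e i) := by rw [← rep_simple (cs := cs), h, rep_simple]
  rw [refl_e_self, refl_apply] at h1
  have h2 := DFunLike.congr_fun h1 i
  simp [Ne.symm hne] at h2
  norm_num at h2

/-- The coefficients of the roots of a rank two subsystem. -/
def coef (c : ℝ) : ℕ → ℝ
  | 0 => 0
  | 1 => 1
  | k + 2 => 2 * c * coef c (k + 1) - coef c k

lemma sin_mul_coef (θ : ℝ) (k : ℕ) : Real.sin θ * coef (Real.cos θ) k = Real.sin (k * θ) := by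
  induction k using Nat.twoStepInduction with
  | zero => simp [coef]
  | one => simp [coef]
  | more k h1 h2 =>
    rw [coef, mul_sub, h1, mul_left_comm, h2]
    push_cast at h2 ⊢
    have h3 := Real.sin_add ((k + 1) * θ) θ
    have h4 := Real.sin_sub ((k + 1) * θ) θ
    rw [show (k + 1) * θ - θ = k * θ by ring] at h4
    rw [show (k + 2) * θ = (k + 1) * θ + θ by ring, h3, h4]; ring

lemma coef_one (k : ℕ) : coef 1 k = k := by
  induction k using Nat.twoStepInduction with
  | zero => simp [coef]
  | one => simp [coef]
  | more k h1 h2 => rw [coef, h1, h2]; push_cast; ring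

lemma coef_nonneg {i j : B} (hij : i ≠ j) {k : ℕ} (hk : M i j ≠ 0 → k ≤ M i j) :
    0 ≤ coef (Real.cos (Real.pi / M i j)) k := by
  by_cases h0 : M i j = 0
  · rw [h0]; simp [coef_one]
  have hm : 2 ≤ M i j := by
    have := M.off_diagonal i j hij
    omega
  have hm' : (0 : ℝ) < M i j := by exact_mod_cast Nat.pos_of_ne_zero h0
  have hkm : (k : ℝ) ≤ M i j := by exact_mod_cast hk h0
  have h1 := sin_mul_coef (Real.pi / M i j) k
  have h2 : 0 ≤ Real.sin (k * (Real.pi / M i j)) := by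
    refine Real.sin_nonneg_of_nonneg_of_le_pi (by positivity) ?_
    rw [mul_div_assoc', div_le_iff₀ hm']
    nlinarith [Real.pi_pos]
  rw [← h1] at h2
  exact nonneg_of_mul_nonneg_right h2 (sin_pi_div_pos hm)

lemma rep_alternatingWord (i j : B) (k : ℕ) :
    rep cs (cs.wordProd (CoxeterSystem.alternatingWord i j k)) (e i) =
      coef (Real.cos (Real.pi / M i j)) (k + 1) • e (if Even k then i else j) +
        coef (Real.cos (Real.pi / M i j)) k • e (if Even k then j else i) := by
  induction k with
  | zero => simp [CoxeterSystem.alternatingWord, coef]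
  | succ k ih =>
    rw [CoxeterSystem.alternatingWord_succ', cs.wordProd_cons, rep_mul, ih, rep_simple]
    by_cases hk : Even k
    · have hk' : ¬ Even (k + 1) := by simpa [Nat.even_add_one] using hk
      simp only [if_pos hk, if_neg hk']
      rw [refl_e_ne, M.symmetric j i, coef, add_comm]
    · have hk' : Even (k + 1) := by simpa [Nat.even_add_one] using hk
      simp only [if_neg hk, if_pos hk']
      rw [refl_e_ne, coef, add_comm]

theorem rep_e_nonneg (w : W) (i : B) (h : cs.length w < cs.length (w * cs.simple i)) :
    0 ≤ rep cs w (e i) := by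
  induction hn : cs.length w using Nat.strong_induction_on generalizing w i with
  | _ n ih =>
  by_cases hw : w = 1
  · subst hw
    rw [map_one, Module.End.one_apply]
    exact Finsupp.single_nonneg.2 zero_le_one
  obtain ⟨j, hj⟩ := cs.exists_rightDescent_of_ne_one hw
  rw [CoxeterSystem.isRightDescent_iff] at hj
  have hij : i ≠ j := by
    rintro rfl
    omega
  set P : ℕ → Prop := fun k => ∃ v, w = v * cs.wordProd (CoxeterSystem.alternatingWord i j k) ∧
    cs.length w = cs.length v + k with hP
  have hP1 : P 1 := ⟨w * cs.simple j, by simp [CoxeterSystem.alternatingWord], hj.symm⟩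
  classical
  have hlen : 1 ≤ cs.length w := by omega
  obtain ⟨v, hv, hvl⟩ : P (Nat.findGreatest P (cs.length w)) := Nat.findGreatest_spec hlen hP1
  have hk1 := Nat.le_findGreatest hlen hP1
  have hmax : ∀ k, P k → k ≤ Nat.findGreatest P (cs.length w) := fun k hk =>
    Nat.le_findGreatest (by obtain ⟨_, _, h⟩ := hk; omega) hk
  generalize Nat.findGreatest P (cs.length w) = k at hv hvl hk1 hmax
  have hnext : ∀ c, c = (if Even k then j else i) → cs.length v < cs.length (v * cs.simple c) := by
    intro c hc
    rcases cs.length_mul_simple v c with h1 | h1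
    · omega
    exfalso
    have : P (k + 1) := ⟨v * cs.simple c, by
      rw [CoxeterSystem.alternatingWord_succ', cs.wordProd_cons, ← hc, mul_assoc,
        CoxeterSystem.simple_mul_simple_cancel_left]
      exact hv, by omega⟩
    have := hmax _ this
    omega
  have hprev : ∀ c, c = (if Even k then i else j) → cs.length v < cs.length (v * cs.simple c) := by
    intro c hc
    rcases cs.length_mul_simple v c with h1 | h1
    · omega
    exfalso
    obtain ⟨l, rfl⟩ : ∃ l, k = l + 1 := ⟨k - 1, by omega⟩
    have hc' : c = if Even l then j else i := by
      rw [hc]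
      by_cases hl : Even l <;> simp [hl, Nat.even_add_one]
    rw [CoxeterSystem.alternatingWord_succ', cs.wordProd_cons, ← hc', ← mul_assoc] at hv
    have h2 := cs.length_mul_le (v * cs.simple c)
      (cs.wordProd (CoxeterSystem.alternatingWord i j l))
    have h3 := cs.length_wordProd_le (CoxeterSystem.alternatingWord i j l)
    rw [CoxeterSystem.length_alternatingWord] at h3
    rw [← hv] at h2
    omega
  have hvi : cs.length v < cs.length (v * cs.simple i) := by
    by_cases hk : Even k
    · exact hprev i (by simp [hk])
    · exact hnext i (by simp [hk])
  have hvj : cs.length v < cs.length (v * cs.simple j) := by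
    by_cases hk : Even k
    · exact hnext j (by simp [hk])
    · exact hprev j (by simp [hk])
  have hkm : M i j ≠ 0 → k + 1 ≤ M i j := by
    intro h0
    by_contra hlt
    refine cs.not_isReduced_alternatingWord j i (m := k + 1) (by rwa [M.symmetric])
      (by rw [M.symmetric]; omega) ?_
    have h1 := cs.length_wordProd_le (CoxeterSystem.alternatingWord j i (k + 1))
    rw [CoxeterSystem.length_alternatingWord] at h1
    have h2 := cs.length_mul_le v (cs.wordProd (CoxeterSystem.alternatingWord j i (k + 1)))
    rw [CoxeterSystem.alternatingWord_succ, cs.wordProd_concat, ← mul_assoc, ← hv,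
      ← cs.wordProd_concat, ← CoxeterSystem.alternatingWord_succ] at h2
    rw [CoxeterSystem.IsReduced, CoxeterSystem.length_alternatingWord]
    omega
  have hei := ih _ (by omega) v i hvi rfl
  have hej := ih _ (by omega) v j hvj rfl
  rw [hv, rep_mul, rep_alternatingWord, map_add, map_smul, map_smul]
  have c1 := coef_nonneg (M := M) hij hkm
  have c2 := coef_nonneg (M := M) hij (k := k) fun h => (Nat.le_succ k).trans (hkm h)
  by_cases hk : Even k
  · simp only [if_pos hk]
    exact add_nonneg (smul_nonneg c1 hei) (smul_nonneg c2 hej)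
  · simp only [if_neg hk]
    exact add_nonneg (smul_nonneg c1 hej) (smul_nonneg c2 hei)

lemma rep_e_nonpos (w : W) (i : B) (h : cs.length (w * cs.simple i) < cs.length w) :
    rep cs w (e i) ≤ 0 := by
  have := rep_e_nonneg (cs := cs) (w * cs.simple i) i (by simpa using h)
  rwa [rep_mul_simple_e, neg_nonneg] at this

/-- The sum of the coordinates with respect to the simple roots. -/
def height : (B →₀ ℝ) →ₗ[ℝ] ℝ := Finsupp.linearCombination ℝ fun _ => 1

lemma height_e (i : B) : height (e i) = 1 := by simp [height]

lemma height_pos {v : B →₀ ℝ} (h0 : v ≠ 0) (h : 0 ≤ v) : 0 < height v := by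
  rw [height, Finsupp.linearCombination_apply]
  refine Finset.sum_pos (fun i hi => ?_) (Finsupp.support_nonempty_iff.2 h0)
  simp only [smul_eq_mul, mul_one]
  exact lt_of_le_of_ne (h i) (Finsupp.mem_support_iff.1 hi).symm

lemma rep_e_ne_zero (g : W) (i : B) : rep cs g (e i) ≠ 0 := fun h => by
  have h1 := rep_inv_rep (cs := cs) g (e i)
  rw [h, map_zero] at h1
  simpa using DFunLike.congr_fun h1 i

lemma height_pos_or_neg (g : W) (i : B) :
    cs.length g < cs.length (g * cs.simple i) ∧ 0 < height (rep cs g (e i)) ∨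
      cs.length (g * cs.simple i) < cs.length g ∧ height (rep cs g (e i)) < 0 := by
  rcases lt_or_gt_of_ne (cs.length_mul_simple_ne g i).symm with h | h
  · exact Or.inl ⟨h, height_pos (rep_e_ne_zero g i) (rep_e_nonneg g i h)⟩
  · refine Or.inr ⟨h, ?_⟩
    have := height_pos (neg_ne_zero.2 (rep_e_ne_zero g i)) (neg_nonneg.2 (rep_e_nonpos g i h))
    rwa [map_neg, Left.neg_pos_iff] at this

lemma height_ne_zero (g : W) (i : B) : height (rep cs g (e i)) ≠ 0 := by
  rcases height_pos_or_neg (cs := cs) g i with h | h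
  · exact h.2.ne'
  · exact h.2.ne

lemma height_pos_iff (g : W) (i : B) :
    0 < height (rep cs g (e i)) ↔ cs.length g < cs.length (g * cs.simple i) := by
  rcases height_pos_or_neg (cs := cs) g i with h | h
  · exact iff_of_true h.2 h.1
  · exact iff_of_false h.2.not_gt h.1.not_gt

lemma nonneg_of_height_pos {g : W} {i : B} (h : 0 < height (rep cs g (e i))) :
    0 ≤ rep cs g (e i) :=
  rep_e_nonneg g i ((height_pos_iff g i).1 h)

lemma eq_one_of_height_pos {g : W} (h : ∀ i, 0 < height (rep cs g (e i))) : g = 1 := by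
  by_contra hg
  obtain ⟨i, hi⟩ := cs.exists_rightDescent_of_ne_one hg
  exact ((height_pos_iff g i).1 (h i)).not_gt hi

lemma eq_one_of_rep_eq {g : W} (h : ∀ v, rep cs g v = v) : g = 1 :=
  eq_one_of_height_pos (cs := cs) fun i => by rw [h, height_e]; exact one_pos

lemma exists_positive_root {t : W} (ht : cs.IsReflection t) :
    ∃ g i, t = g * cs.simple i * g⁻¹ ∧ 0 < height (rep cs g (e i)) := by
  obtain ⟨g, i, rfl⟩ := ht
  rcases lt_or_gt_of_ne (height_ne_zero (cs := cs) g i).symm with h | h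
  · exact ⟨g, i, rfl, h⟩
  · refine ⟨g * cs.simple i, i, ?_, ?_⟩
    · simp [mul_assoc]
    · rwa [rep_mul_simple_e, map_neg, Left.neg_pos_iff]

lemma apply_nonneg_of_nonneg {b : (B →₀ ℝ) →ₗ[ℝ] (B →₀ ℝ) →ₗ[ℝ] ℝ} {v p : B →₀ ℝ} (hv : 0 ≤ v)
    (hp : ∀ i, 0 ≤ b (e i) p) : 0 ≤ b v p := by
  have h : b v p = v.sum fun i c => c * b (e i) p := by
    conv_lhs => rw [← v.sum_single]
    rw [map_finsuppSum, Finsupp.sum, LinearMap.sum_apply]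
    refine Finset.sum_congr rfl fun i _ => ?_
    rw [← mul_one (v i), ← smul_eq_mul, ← Finsupp.smul_single, map_smul, LinearMap.smul_apply]
    simp
  rw [h]
  exact Finset.sum_nonneg fun i _ => mul_nonneg (hv i) (hp i)

/-- An inner product invariant under the geometric representation. -/
structure IsInvariantForm (cs : CoxeterSystem M W) (b : (B →₀ ℝ) →ₗ[ℝ] (B →₀ ℝ) →ₗ[ℝ] ℝ) :
    Prop where
  symm : ∀ u v, b u v = b v u
  pos : ∀ v, v ≠ 0 → 0 < b v v
  inv : ∀ g u v, b (rep cs g u) (rep cs g v) = b u v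

lemma exists_isInvariantForm [Finite W] (cs : CoxeterSystem M W) :
    ∃ b, IsInvariantForm cs b := by
  have : Finite B := Finite.of_injective _ (simple_injective cs)
  cases nonempty_fintype B
  cases nonempty_fintype W
  refine ⟨∑ g : W, ∑ j : B, (LinearMap.mul ℝ ℝ).compl₁₂ (Finsupp.lapply j ∘ₗ rep cs g)
    (Finsupp.lapply j ∘ₗ rep cs g), fun u v => ?_, fun v hv => ?_, fun g u v => ?_⟩
  · simp [LinearMap.sum_apply, mul_comm]
  · simp only [LinearMap.sum_apply, LinearMap.compl₁₂_apply, LinearMap.mul_apply',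
      LinearMap.comp_apply, Finsupp.lapply_apply]
    obtain ⟨i, hi⟩ := Finsupp.ne_iff.1 hv
    refine Finset.sum_pos' (fun g _ => Finset.sum_nonneg fun j _ => mul_self_nonneg _)
      ⟨1, Finset.mem_univ _, Finset.sum_pos' (fun j _ => mul_self_nonneg _)
        ⟨i, Finset.mem_univ _, ?_⟩⟩
    rw [map_one, Module.End.one_apply]
    exact mul_self_pos.2 hi
  · simp only [LinearMap.sum_apply, LinearMap.compl₁₂_apply, LinearMap.mul_apply',
      LinearMap.comp_apply, Finsupp.lapply_apply, ← rep_mul]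
    exact Fintype.sum_equiv (Equiv.mulRight g) _ _ fun x => rfl

namespace IsInvariantForm

variable {b : (B →₀ ℝ) →ₗ[ℝ] (B →₀ ℝ) →ₗ[ℝ] ℝ}

lemma rep_left (hb : IsInvariantForm cs b) (g : W) (u v : B →₀ ℝ) :
    b (rep cs g u) v = b u (rep cs g⁻¹ v) := by
  rw [← hb.inv g⁻¹, rep_inv_rep]

lemma e_pos (hb : IsInvariantForm cs b) (i : B) : 0 < b (e i) (e i) := hb.pos _ (by simp)

lemma coroot_eq (hb : IsInvariantForm cs b) (i : B) (v : B →₀ ℝ) :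
    coroot M i v = 2 * b v (e i) / b (e i) (e i) := by
  have h := hb.inv (cs.simple i) v (e i)
  rw [rep_simple, refl_e_self, refl_apply, map_neg, map_sub, map_smul, LinearMap.sub_apply,
    LinearMap.smul_apply, smul_eq_mul] at h
  rw [eq_div_iff (hb.e_pos i).ne']
  linarith

lemma rep_conj (hb : IsInvariantForm cs b) (g : W) (i : B) (v : B →₀ ℝ) :
    rep cs (g * cs.simple i * g⁻¹) v =
      v - (2 * b v (rep cs g (e i)) / b (e i) (e i)) • rep cs g (e i) := by
  have h : rep cs g (rep cs g⁻¹ v) = v := by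
    simp
  rw [rep_mul, rep_mul, rep_simple, refl_apply, map_sub, map_smul, h, hb.coroot_eq,
    hb.rep_left, inv_inv]

lemma rep_eq_of_rank_one (hb : IsInvariantForm cs b) {g : W} {a v : B →₀ ℝ}
    (h : ∀ v, ∃ c : ℝ, rep cs g v - v = c • a)
    (hv : b a v = 0) : rep cs g v = v := by
  obtain ⟨c, hc⟩ := h v
  rw [sub_eq_iff_eq_add'] at hc
  have h1 := hb.inv g v v
  rw [hc] at h1
  simp only [map_add, map_smul, LinearMap.add_apply, LinearMap.smul_apply, smul_eq_mul,
    hb.symm v a, hv] at h1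
  by_cases hz : c • a = 0
  · rw [hc, hz, add_zero]
  · have := hb.pos _ hz
    simp only [map_smul, LinearMap.smul_apply, smul_eq_mul] at this
    linarith

lemma exists_root_of_rank_one (hb : IsInvariantForm cs b) [Finite W] {g : W} {a : B →₀ ℝ}
    (hg : g ≠ 1) (h : ∀ v, ∃ c : ℝ, rep cs g v - v = c • a) :
    ∃ x i, ∀ p, b a p = 0 → b (rep cs x (e i)) p = 0 := by
  by_contra! hcon
  have : Finite B := Finite.of_injective _ (simple_injective cs)
  obtain ⟨p, hp, hp0⟩ := Module.Dual.exists_forall_mem_ne_zero_of_forall_exists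
    (LinearMap.ker (b a)) (fun x : W × B => b (rep cs x.1 (e x.2))) fun x => by
      obtain ⟨p, hp, hp0⟩ := hcon x.1 x.2
      exact ⟨p, hp, hp0⟩
  obtain ⟨z, hz⟩ := Finite.exists_max fun z : W => height (rep cs z p)
  have hpos : ∀ i, 0 < b (e i) (rep cs z p) := by
    intro i
    have hne := hp0 (z⁻¹, i)
    simp only [hb.rep_left, inv_inv] at hne
    refine lt_of_le_of_ne ?_ hne.symm
    by_contra! hlt
    have h1 := hz (cs.simple i * z)
    rw [rep_mul, rep_simple, refl_apply, hb.coroot_eq, map_sub, map_smul, height_e,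
      hb.symm _ (e i)] at h1
    have h2 : 2 * b (e i) (rep cs z p) / b (e i) (e i) < 0 :=
      div_neg_of_neg_of_pos (by linarith) (hb.e_pos i)
    rw [smul_eq_mul, mul_one] at h1
    linarith
  have hgp : rep cs (z * g * z⁻¹) (rep cs z p) = rep cs z p := by
    rw [rep_mul, rep_inv_rep, rep_mul, hb.rep_eq_of_rank_one h hp]
  have h1 : z * g * z⁻¹ = 1 := eq_one_of_height_pos (cs := cs) fun i => by
    rcases height_pos_or_neg (cs := cs) (z * g * z⁻¹) i with h2 | h2
    · exact h2.2
    exfalso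
    have h3 := apply_nonneg_of_nonneg (neg_nonneg.2 (rep_e_nonpos _ i h2.1)) fun i => (hpos i).le
    rw [map_neg, LinearMap.neg_apply, ← hgp, hb.inv] at h3
    linarith [hpos i]
  exact hg (by simpa [mul_inv_eq_one] using h1)

lemma isReflection_of_rank_one (hb : IsInvariantForm cs b) [Finite W] {g : W} {a : B →₀ ℝ}
    (hg : g ≠ 1) (h : ∀ v, ∃ c : ℝ, rep cs g v - v = c • a) : cs.IsReflection g := by
  obtain ⟨x, i, hx⟩ := hb.exists_root_of_rank_one hg h
  have ha : a ≠ 0 := by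
    rintro rfl
    exact hg (eq_one_of_rep_eq (cs := cs) fun v => hb.rep_eq_of_rank_one h (by simp))
  have haa := hb.pos a ha
  have hdec : ∀ v, ∃ p, ∃ q : ℝ, b a p = 0 ∧ v = p + q • a := fun v =>
    ⟨v - (b a v / b a a) • a, b a v / b a a, by
      rw [map_sub, map_smul, smul_eq_mul, div_mul_cancel₀ _ haa.ne', sub_self], by simp⟩
  set r := rep cs x (e i) with hr
  obtain ⟨p, d, hp, hrp⟩ := hdec r
  have hp0 : p = 0 := by
    by_contra hne
    have h1 := hx p hp
    rw [hrp, map_add, map_smul, LinearMap.add_apply, LinearMap.smul_apply, hp, smul_zero,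
      add_zero] at h1
    exact (hb.pos p hne).ne' h1
  rw [hp0, zero_add] at hrp
  have hd : d ≠ 0 := by
    rintro rfl
    exact rep_e_ne_zero (cs := cs) x i (by rw [← hr, hrp, zero_smul])
  obtain ⟨c, hc⟩ := h a
  have hga : rep cs g a = (1 + c) • a := by
    rw [add_smul, one_smul, ← hc]; abel
  have hc' : (1 + c) * (1 + c) = 1 := by
    have := hb.inv g a a
    rw [hga] at this
    simp only [map_smul, LinearMap.smul_apply, smul_eq_mul] at this
    have h2 : ((1 + c) * (1 + c) - 1) * b a a = 0 := by linarith
    have := (mul_eq_zero.1 h2).resolve_right haa.ne'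
    linarith
  rcases mul_self_eq_one_iff.1 hc' with h1 | h1
  · refine absurd (eq_one_of_rep_eq (cs := cs) fun v => ?_) hg
    obtain ⟨p, q, hp, rfl⟩ := hdec v
    rw [map_add, map_smul, hb.rep_eq_of_rank_one h hp, hga, h1, one_smul]
  · have hta : rep cs (x * cs.simple i * x⁻¹) a = -a := by
      have h2 : rep cs (x * cs.simple i * x⁻¹) r = -r := by
        rw [rep_mul, hr, rep_inv_rep, rep_mul_simple_e]
      rw [hrp, map_smul, ← smul_neg] at h2
      exact smul_right_injective _ hd h2
    have ht : (x * cs.simple i * x⁻¹)⁻¹ * g = 1 := eq_one_of_rep_eq (cs := cs) fun v => by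
      obtain ⟨p, q, hp, rfl⟩ := hdec v
      have h2 : rep cs (x * cs.simple i * x⁻¹) (p + q • a) = rep cs g (p + q • a) := by
        rw [map_add, map_add, map_smul, map_smul, hta, hga, h1, hb.rep_eq_of_rank_one h hp,
          hb.rep_conj, hb.symm p, hx p hp]
        simp
      rw [rep_mul, ← h2, rep_inv_rep]
    rw [inv_mul_eq_one] at ht
    exact ⟨x, i, ht.symm⟩

end IsInvariantForm

/-- The factor normalizing a simple root. -/
def scale (b : (B →₀ ℝ) →ₗ[ℝ] (B →₀ ℝ) →ₗ[ℝ] ℝ) (i : B) : ℝ := √(2 / b (e i) (e i))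

namespace IsInvariantForm

variable {b : (B →₀ ℝ) →ₗ[ℝ] (B →₀ ℝ) →ₗ[ℝ] ℝ}

lemma scale_pos (hb : IsInvariantForm cs b) (i : B) : 0 < scale b i :=
  Real.sqrt_pos.2 (div_pos two_pos (hb.e_pos i))

lemma scale_mul_self (hb : IsInvariantForm cs b) (i : B) :
    scale b i * scale b i = 2 / b (e i) (e i) :=
  Real.mul_self_sqrt (div_pos two_pos (hb.e_pos i)).le

lemma exists_vector_eq_height (hb : IsInvariantForm cs b) [Finite W] :
    ∃ v₀, ∀ v, b v v₀ = height v := by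
  have : Finite B := Finite.of_injective _ (simple_injective cs)
  have hnd : LinearMap.BilinForm.Nondegenerate b := by
    refine ⟨fun u hu => ?_, fun u hu => ?_⟩ <;> by_contra hne <;> exact (hb.pos u hne).ne' (hu u)
  refine ⟨(LinearMap.BilinForm.toDual b hnd).symm height, fun v => ?_⟩
  rw [hb.symm, LinearMap.BilinForm.apply_toDual_symm_apply]

end IsInvariantForm

theorem exists_reflSys [Finite W] (cs : CoxeterSystem M W) :
    ∃ D : ReflSys W (B →₀ ℝ), D.ρ = rep cs ∧ (∀ t, t ∈ D.T ↔ cs.IsReflection t) ∧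
      (∀ v, D.b v D.v₀ = height v) ∧ ∀ t ∈ D.T, ∃ g i, ∃ c : ℝ, 0 < c ∧
        t = g * cs.simple i * g⁻¹ ∧ 0 < height (rep cs g (e i)) ∧ D.α t = c • rep cs g (e i) := by
  obtain ⟨b, hb⟩ := exists_isInvariantForm cs
  obtain ⟨v₀, hv₀⟩ := hb.exists_vector_eq_height
  have hα : ∀ t, ∃ α : B →₀ ℝ, cs.IsReflection t → ∃ g i, t = g * cs.simple i * g⁻¹ ∧
      0 < height (rep cs g (e i)) ∧ α = scale b i • rep cs g (e i) := by
    intro t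
    by_cases ht : cs.IsReflection t
    · obtain ⟨g, i, h1, h2⟩ := exists_positive_root ht
      exact ⟨_, fun _ => ⟨g, i, h1, h2, rfl⟩⟩
    · exact ⟨0, fun h => absurd h ht⟩
  choose α hα using hα
  have hT : ∀ t, t ∈ (Set.toFinite {t | cs.IsReflection t}).toFinset ↔ cs.IsReflection t := by
    simp
  refine ⟨{
    ρ := rep cs
    b := b
    T := (Set.toFinite {t | cs.IsReflection t}).toFinset
    α := α
    v₀ := v₀
    b_symm := hb.symm
    b_pos := hb.pos
    b_inv := hb.inv
    mul_self := fun t ht => ((hT t).1 ht).mul_self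
    refl := fun t ht v => ?_
    norm := fun t ht => ?_
    root_pos := fun t ht => ?_
    conj := fun r hr t ht => ?_
    pair_ne := fun t ht x => ?_
    orbit_inj := fun x y hxy => ?_
    rank_one := fun g _ a hg h => (hT g).2 (hb.isReflection_of_rank_one hg h) }, rfl, hT, hv₀,
    fun t ht => ?_⟩
  · obtain ⟨g, i, rfl, -, h⟩ := hα t ((hT t).1 ht)
    rw [h, hb.rep_conj, map_smul, smul_smul, smul_eq_mul, mul_right_comm, hb.scale_mul_self]
    congr 2; ring
  · obtain ⟨g, i, -, -, h⟩ := hα t ((hT t).1 ht)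
    rw [h, map_smul, map_smul, LinearMap.smul_apply, smul_smul, hb.scale_mul_self, hb.inv,
      smul_eq_mul, div_mul_cancel₀ _ (hb.e_pos i).ne']
  · obtain ⟨g, i, -, hpos, h⟩ := hα t ((hT t).1 ht)
    rw [h, hv₀, map_smul, smul_eq_mul]
    exact mul_pos (hb.scale_pos i) hpos
  · have hr' := (hT r).1 hr
    have h := ((hT t).1 ht).conj r
    rw [hr'.inv] at h
    exact (hT _).2 h
  · obtain ⟨g, i, -, -, h⟩ := hα t ((hT t).1 ht)
    rw [h, map_smul, LinearMap.smul_apply, ← inv_inv x, ← hb.rep_left, hv₀, ← rep_mul]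
    exact smul_ne_zero (hb.scale_pos i).ne' (height_ne_zero _ i)
  · have hfix : rep cs (y⁻¹ * x) v₀ = v₀ := by rw [rep_mul, hxy, rep_inv_rep]
    have h1 : y⁻¹ * x = 1 := eq_one_of_height_pos (cs := cs) fun i => by
      rw [← hv₀, ← hfix, hb.inv, hv₀, height_e]; exact one_pos
    exact (inv_mul_eq_one.1 h1).symm
  · obtain ⟨g, i, h1, h2, h3⟩ := hα t ((hT t).1 ht)
    exact ⟨g, i, scale b i, hb.scale_pos i, h1, h2, h3⟩

/-- A simple reflection permutes the other positive roots. -/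
lemma refl_nonneg {g : W} {i j : B} (h : 0 ≤ rep cs g (e i))
    (hne : ∀ c : ℝ, rep cs g (e i) ≠ c • e j) : 0 < height (rep cs (cs.simple j * g) (e i)) := by
  rcases height_pos_or_neg (cs := cs) (cs.simple j * g) i with h1 | h1
  · exact h1.2
  exfalso
  have h2 := rep_e_nonpos _ i h1.1
  rw [rep_mul, rep_simple, refl_apply] at h2
  refine hne (rep cs g (e i) j) (Finsupp.ext fun k => ?_)
  by_cases hk : k = j
  · subst hk; simp
  · have h3 := h2 k
    simp [Ne.symm hk] at h3 ⊢
    exact le_antisymm h3 (h k)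

theorem exists_reflSys_length [Finite W] (cs : CoxeterSystem M W) :
    ∃ D : ReflSys W (B →₀ ℝ), (∀ t, t ∈ D.T ↔ cs.IsReflection t) ∧
      ∀ x, D.n x = cs.length x := by
  obtain ⟨D, hρ, hT, hv₀, hα⟩ := exists_reflSys cs
  refine ⟨D, hT, ?_⟩
  have hαs : ∀ i, ∃ c : ℝ, 0 < c ∧ D.α (cs.simple i) = c • e i := by
    intro i
    have hs := (hT _).2 (cs.isReflection_simple i)
    obtain ⟨g, j, c, hc, -, hpos, h⟩ := hα _ hs
    have h1 := D.refl _ hs (e i)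
    rw [hρ, rep_simple, refl_e_self] at h1
    have h2 : (D.b (e i) (D.α (cs.simple i))) • D.α (cs.simple i) = (2 : ℝ) • e i := by
      rw [two_smul, ← sub_eq_iff_eq_add, ← neg_sub, ← h1, neg_neg]
    set d := D.b (e i) (D.α (cs.simple i))
    have hd : 0 < d := by
      have h3 := congrArg height h2
      rw [map_smul, map_smul, height_e, smul_eq_mul, smul_eq_mul] at h3
      have h4 := D.root_pos _ hs
      rw [hv₀] at h4
      by_contra! hle
      nlinarith
    refine ⟨d⁻¹ * 2, by positivity, ?_⟩
    rw [mul_smul, ← h2, smul_smul, inv_mul_cancel₀ hd.ne', one_smul]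
  have hsimple : ∀ i, D.Simple (cs.simple i) := by
    intro i
    have hs := (hT _).2 (cs.isReflection_simple i)
    refine ⟨hs, fun t ht hne => ?_⟩
    obtain ⟨g, j, c, hc, -, hpos, h⟩ := hα t ht
    rw [hρ, h, map_smul, hv₀, map_smul, ← rep_mul]
    refine mul_pos hc (refl_nonneg (nonneg_of_height_pos hpos) fun d hd => hne ?_)
    obtain ⟨c', hc', h'⟩ := hαs i
    refine ReflSys.root_eq_of_smul (c := c * d * c'⁻¹) ht hs ?_
    rw [h, hd, h', smul_smul, smul_smul, mul_assoc, mul_assoc, inv_mul_cancel₀ hc'.ne', mul_one]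
  have hpair : ∀ i x, cs.length x < cs.length (cs.simple i * x) → 0 < D.pair (cs.simple i) x := by
    intro i x hx
    obtain ⟨c, hc, h⟩ := hαs i
    have h1 : D.b (e i) (D.ρ x D.v₀) = D.b (D.ρ x⁻¹ (e i)) D.v₀ := by
      rw [ReflSys.b_ρ_left]
    rw [ReflSys.pair, h, map_smul, LinearMap.smul_apply, h1, hρ, hv₀]
    refine mul_pos hc ((height_pos_iff _ _).2 ?_)
    rw [← cs.length_inv (x⁻¹ * _), cs.length_inv]
    simpa using hx
  intro x
  induction hx : cs.length x using Nat.strong_induction_on generalizing x with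
  | _ k ih =>
  by_cases h1 : x = 1
  · subst h1
    rw [← hx, cs.length_one, ReflSys.n, Finset.card_eq_zero]
    refine Finset.eq_empty_of_forall_notMem fun t ht => ?_
    rw [ReflSys.mem_N, ReflSys.pair_one] at ht
    exact ht.2.not_gt (D.root_pos t ht.1)
  obtain ⟨i, hi⟩ := cs.exists_leftDescent_of_ne_one h1
  rw [CoxeterSystem.isLeftDescent_iff] at hi
  have h2 := ih _ (by omega) (cs.simple i * x) rfl
  have h3 := (hsimple i).n_mul (hpair i (cs.simple i * x) (by simp; omega))
  rw [CoxeterSystem.simple_mul_simple_cancel_left] at h3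
  omega

end Tits

theorem statement_13 {B W : Type*} [Group W] [Finite W]
    {M : CoxeterMatrix B} (cs : CoxeterSystem M W) (w : W) (hrs : RatSmooth cs w) :
    HLSS cs w := by
  obtain ⟨D, hT, hn⟩ := Tits.exists_reflSys_length cs
  have : Finite B := Finite.of_injective _ (Tits.simple_injective cs)
  exact hlss_of_realization hT hn hrs

end Paper
end
end
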